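/- In the setting of the previous monotonicity, the map M ↦ λ_M is locally Lipschitz: there is a constant C (depending only on r₊, Λ, α, q₀ and the compact range of M) such that 0 ≤ λ_{M₁} - λ_{M₂} ≤ C(M₁ - M₂) for M_{e=0} ≤ M₂ ≤ M₁ < M₀. Hence if λ_M < 0 for M near M_{e=0} (e.g. by positivity of the energy when e²/r₊² < 1 + (-Λ/3)r₊² and small charge) and λ_M > 0 for some M near M₀, then there exists M_c with λ_{M_c} = 0. -/

import Mathlib

open MeasureTheory Set

/-- Charge squared `e_M²` as a function of the mass `M` (with `r₊` a fixed root). -/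
noncomputable def e2fun (rp Λ M : ℝ) : ℝ :=
  -rp ^ 2 * (1 - 2 * M / rp + (-Λ / 3) * rp ^ 2)

/-- RN–AdS lapse `Ω_M²`, parametrized by `(M, r₊, Λ)`. -/
noncomputable def Om2 (rp Λ M r : ℝ) : ℝ :=
  1 - 2 * M / r + e2fun rp Λ M / r ^ 2 + (-Λ / 3) * r ^ 2

/-- The energy functional `L_M[f]`. -/
noncomputable def Lfun (rp Λ α q0 M : ℝ) (f : ℝ → ℝ) : ℝ :=
  ∫ r in Set.Ioi rp,
    (r ^ 2 * Om2 rp Λ M r * (deriv f r) ^ 2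
      + ((-Λ / 3) * α - q0 ^ 2 * e2fun rp Λ M * (1 / rp - 1 / r) ^ 2 / Om2 rp Λ M r)
          * r ^ 2 * (f r) ^ 2)

/-- `λ_M := -inf { L_M[f] : f ∈ C_c^∞(r₊,∞), ∫ r²f²/Ω_M² = 1 }`. -/
noncomputable def lamfun (rp Λ α q0 M : ℝ) : ℝ :=
  -sInf {x : ℝ | ∃ f : ℝ → ℝ, ContDiff ℝ (⊤ : ℕ∞) f ∧ HasCompactSupport f ∧
    tsupport f ⊆ Set.Ioi rp ∧
    (∫ r in Set.Ioi rp, r ^ 2 * (f r) ^ 2 / Om2 rp Λ M r) = 1 ∧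
    x = Lfun rp Λ α q0 M f}


structure IsT (f : ℝ → ℝ) : Prop where
  smooth : ContDiff ℝ (⊤ : ℕ∞) f
  comp : HasCompactSupport f
  supp : tsupport f ⊆ Set.Ioi 1

theorem quad_integrable {f : ℝ → ℝ} (hs : ContDiff ℝ (⊤ : ℕ∞) f) (hc : HasCompactSupport f)
    {U : Set ℝ} (hU : tsupport f ⊆ U) {c1 c2 c3 : ℝ → ℝ} (h1 : ContinuousOn c1 U)
    (h2 : ContinuousOn c2 U) (h3 : ContinuousOn c3 U) :
    Integrable (fun r => c1 r * (deriv f r) ^ 2 + c2 r * (f r * deriv f r) + c3 r * (f r) ^ 2) := by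
  have hK : IsCompact (tsupport f) := hc
  have hf : Continuous f := hs.continuous
  have hd : Continuous (deriv f) := hs.continuous_deriv (by simp)
  have hco : ContinuousOn (fun r => c1 r * (deriv f r) ^ 2 + c2 r * (f r * deriv f r)
      + c3 r * (f r) ^ 2) (tsupport f) := by
    have := h1.mono hU
    have := h2.mono hU
    have := h3.mono hU
    fun_prop
  rw [← integrableOn_iff_integrable_of_support_subset (s := tsupport f)]
  · exact hco.integrableOn_compact hK
  · intro r hr
    by_contra hn
    apply hr
    have e1 : f r = 0 := image_eq_zero_of_notMem_tsupport hn
    have e2 : deriv f r = 0 := by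
      by_contra h
      exact hn (support_deriv_subset (by simpa using h))
    simp [e1, e2]

theorem quad_supp {f : ℝ → ℝ} {U : Set ℝ} (hU : tsupport f ⊆ U) {c1 c2 c3 : ℝ → ℝ} :
    ∫ r in U, (c1 r * (deriv f r) ^ 2 + c2 r * (f r * deriv f r) + c3 r * (f r) ^ 2)
     = ∫ r, (c1 r * (deriv f r) ^ 2 + c2 r * (f r * deriv f r) + c3 r * (f r) ^ 2) := by
  apply setIntegral_eq_integral_of_forall_compl_eq_zero
  intro r hr
  have hn : r ∉ tsupport f := fun h => hr (hU h)
  have e1 : f r = 0 := image_eq_zero_of_notMem_tsupport hn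
  have e2 : deriv f r = 0 := by
    by_contra h
    exact hn (support_deriv_subset (by simpa using h))
  simp [e1, e2]

theorem quad_nonneg {f : ℝ → ℝ} (hs : ContDiff ℝ (⊤ : ℕ∞) f) (hc : HasCompactSupport f)
    {U : Set ℝ} (hU : tsupport f ⊆ U) {c1 c2 c3 Φ Φ' : ℝ → ℝ}
    (h1 : ContinuousOn c1 U)
    (h2 : ContinuousOn c2 U) (h3 : ContinuousOn c3 U)
    (hΦ : ∀ r ∈ U, HasDerivAt Φ (Φ' r) r) (hΦ' : ContinuousOn Φ' U)
    (hpos : ∀ r ∈ U, ∀ u w : ℝ, 0 ≤ c1 r * w ^ 2 + (c2 r + 2 * Φ r) * (u * w)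
      + (c3 r + Φ' r) * u ^ 2) :
    0 ≤ ∫ r, (c1 r * (deriv f r) ^ 2 + c2 r * (f r * deriv f r) + c3 r * (f r) ^ 2) := by
  have hΦc : ContinuousOn Φ U := fun r hr => (hΦ r hr).continuousAt.continuousWithinAt
  have hz : ∀ r, r ∉ U → f r = 0 ∧ deriv f r = 0 := by
    intro r hr
    have hn : r ∉ tsupport f := fun h => hr (hU h)
    refine ⟨image_eq_zero_of_notMem_tsupport hn, ?_⟩
    by_contra h
    exact hn (support_deriv_subset (by simpa using h))
  -- the total derivative integrates to zero
  have key : ∫ r, (0 * (deriv f r) ^ 2 + (2 * Φ r) * (f r * deriv f r) + Φ' r * (f r) ^ 2) = 0 := by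
    have hint := quad_integrable hs hc hU (c1 := fun _ => 0) (c2 := fun r => 2 * Φ r) (c3 := Φ')
      continuousOn_const (by fun_prop) hΦ'
    have hder : ∀ r, HasDerivAt (fun r => Φ r * (f r) ^ 2)
        (0 * (deriv f r) ^ 2 + (2 * Φ r) * (f r * deriv f r) + Φ' r * (f r) ^ 2) r := by
      intro r
      have hfd : HasDerivAt f (deriv f r) r := (hs.differentiable (by simp) r).hasDerivAt
      by_cases hr : r ∈ tsupport f
      · have := (hΦ r (hU hr)).mul (hfd.pow 2)
        refine this.congr_deriv ?_
        simp only [Pi.pow_apply]; push_cast; ring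
      · have hev : ∀ᶠ y in nhds r, f y = 0 := by
          have : (tsupport f)ᶜ ∈ nhds r := (isClosed_tsupport f).isOpen_compl.mem_nhds hr
          filter_upwards [this] with y hy
          exact image_eq_zero_of_notMem_tsupport hy
        have e1 := hev.self_of_nhds
        have e2 : (fun y => Φ y * (f y) ^ 2) =ᶠ[nhds r] fun _ => (0:ℝ) := by
          filter_upwards [hev] with y hy
          simp [hy]
        have := (hasDerivAt_const r (0:ℝ)).congr_of_eventuallyEq e2
        refine this.congr_deriv ?_
        have e3 : deriv f r = 0 := by
          by_contra h
          exact hr (support_deriv_subset (by simpa using h))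
        simp [e1]
    have hcs : HasCompactSupport (fun r => Φ r * (f r) ^ 2) := by
      apply hc.mono
      intro r hr h
      apply hr
      simp [h]
    have hi2 : Integrable (fun r => Φ r * (f r) ^ 2) := by
      have := quad_integrable hs hc hU (c1 := fun _ => 0) (c2 := fun r => 0) (c3 := Φ)
        continuousOn_const continuousOn_const hΦc
      simpa using this
    exact integral_eq_zero_of_hasDerivAt_of_integrable hder hint hi2
  have hi1 := quad_integrable hs hc hU h1 h2 h3
  have hi2 := quad_integrable hs hc hU (c1 := fun _ => 0) (c2 := fun r => 2 * Φ r) (c3 := Φ')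
      continuousOn_const (by fun_prop) hΦ'
  have : ∫ r, (c1 r * (deriv f r) ^ 2 + c2 r * (f r * deriv f r) + c3 r * (f r) ^ 2)
     = ∫ r, ((c1 r * (deriv f r) ^ 2 + c2 r * (f r * deriv f r) + c3 r * (f r) ^ 2)
       + (0 * (deriv f r) ^ 2 + (2 * Φ r) * (f r * deriv f r) + Φ' r * (f r) ^ 2)) := by
    rw [integral_add hi1 hi2, key, add_zero]
  rw [this]
  apply integral_nonneg
  intro r
  by_cases hr : r ∈ U
  · have := hpos r hr (f r) (deriv f r)
    simp only [Pi.zero_apply]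
    nlinarith [this]
  · obtain ⟨e1, e2⟩ := hz r hr
    simp [e1, e2]


noncomputable def QF (c1 c2 c3 f : ℝ → ℝ) : ℝ :=
  ∫ r, (c1 r * (deriv f r) ^ 2 + c2 r * (f r * deriv f r) + c3 r * (f r) ^ 2)

theorem ts_zero {f : ℝ → ℝ} {r : ℝ} (hn : r ∉ tsupport f) : f r = 0 ∧ deriv f r = 0 := by
  refine ⟨image_eq_zero_of_notMem_tsupport hn, ?_⟩
  by_contra h
  exact hn (support_deriv_subset (by simpa using h))

theorem QF_congr {f c1 c2 c3 d1 d2 d3 : ℝ → ℝ}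
    (h : ∀ r ∈ tsupport f, c1 r * (deriv f r) ^ 2 + c2 r * (f r * deriv f r) + c3 r * (f r) ^ 2
      = d1 r * (deriv f r) ^ 2 + d2 r * (f r * deriv f r) + d3 r * (f r) ^ 2) :
    QF c1 c2 c3 f = QF d1 d2 d3 f := by
  unfold QF
  congr 1
  ext r
  by_cases hr : r ∈ tsupport f
  · exact h r hr
  · obtain ⟨e1, e2⟩ := ts_zero hr
    simp [e1, e2]

theorem QF_comb {f : ℝ → ℝ} (hf : IsT f)
    {c1 c2 c3 d1 d2 d3 : ℝ → ℝ} (h1 : ContinuousOn c1 (Ioi 1))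
    (h2 : ContinuousOn c2 (Ioi 1)) (h3 : ContinuousOn c3 (Ioi 1)) (h1' : ContinuousOn d1 (Ioi 1))
    (h2' : ContinuousOn d2 (Ioi 1)) (h3' : ContinuousOn d3 (Ioi 1)) (k m : ℝ) :
    QF (fun r => k * c1 r + m * d1 r) (fun r => k * c2 r + m * d2 r)
      (fun r => k * c3 r + m * d3 r) f = k * QF c1 c2 c3 f + m * QF d1 d2 d3 f := by
  unfold QF
  rw [← integral_const_mul, ← integral_const_mul, ← integral_add]
  · congr 1
    ext r
    ring
  · exact (quad_integrable hf.smooth hf.comp hf.supp h1 h2 h3).const_mul k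
  · exact (quad_integrable hf.smooth hf.comp hf.supp h1' h2' h3').const_mul m

theorem contDiff_of_tsupport' {f : ℝ → ℝ}
    (h : ∀ r ∈ tsupport f, ContDiffAt ℝ (⊤ : ℕ∞) f r) : ContDiff ℝ (⊤ : ℕ∞) f := by
  rw [contDiff_iff_contDiffAt]
  intro r
  by_cases hr : r ∈ tsupport f
  · exact h r hr
  · have : f =ᶠ[nhds r] fun _ => (0:ℝ) := by
      filter_upwards [(isClosed_tsupport f).isOpen_compl.mem_nhds hr] with y hy
      exact image_eq_zero_of_notMem_tsupport hy
    exact contDiffAt_const.congr_of_eventuallyEq this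

/-- product with a function smooth near the support -/
theorem IsT.mul {h v : ℝ → ℝ} (hv : IsT v) (hh : ∀ r, 1 < r → ContDiffAt ℝ (⊤ : ℕ∞) h r) :
    IsT (fun r => h r * v r) := by
  have hs : tsupport (fun r => h r * v r) ⊆ tsupport v := by
    apply closure_mono
    intro r hr h0
    apply hr
    simp [h0]
  refine ⟨?_, ?_, hs.trans hv.supp⟩
  · apply contDiff_of_tsupport'
    intro r hr
    exact (hh r (hv.supp (hs hr))).mul hv.smooth.contDiffAt
  · apply hv.comp.mono
    intro r hr h0
    apply hr
    simp [h0]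

theorem QF_mul {h h' v c1 c2 c3 : ℝ → ℝ} (hv : IsT v)
    (hh : ∀ r, 1 < r → HasDerivAt h (h' r) r) :
    QF c1 c2 c3 (fun r => h r * v r) = QF (fun r => c1 r * (h r) ^ 2)
      (fun r => 2 * c1 r * h r * h' r + c2 r * (h r) ^ 2)
      (fun r => c1 r * (h' r) ^ 2 + c2 r * h r * h' r + c3 r * (h r) ^ 2) v := by
  unfold QF
  congr 1
  ext r
  by_cases hr : r ∈ tsupport v
  · have h1 := hh r (hv.supp hr)
    have h2 : HasDerivAt v (deriv v r) r := (hv.smooth.differentiable (by simp) r).hasDerivAt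
    have : deriv (fun r => h r * v r) r = h' r * v r + h r * deriv v r := (h1.mul h2).deriv
    rw [this]
    ring
  · obtain ⟨e1, e2⟩ := ts_zero hr
    have hs : tsupport (fun r => h r * v r) ⊆ tsupport v := by
      apply closure_mono
      intro r hr h0
      apply hr
      simp [h0]
    obtain ⟨e3, e4⟩ := ts_zero (fun h => hr (hs h))
    rw [e4, e1, e2]
    simp [e1]

theorem QF_nonneg {f : ℝ → ℝ} (hf : IsT f) {c1 c2 c3 Φ Φ' : ℝ → ℝ}
    (h1 : ContinuousOn c1 (Ioi 1)) (h2 : ContinuousOn c2 (Ioi 1)) (h3 : ContinuousOn c3 (Ioi 1))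
    (hΦ : ∀ r ∈ Ioi (1:ℝ), HasDerivAt Φ (Φ' r) r) (hΦ' : ContinuousOn Φ' (Ioi 1))
    (hpos : ∀ r ∈ Ioi (1:ℝ), ∀ u w : ℝ, 0 ≤ c1 r * w ^ 2 + (c2 r + 2 * Φ r) * (u * w)
      + (c3 r + Φ' r) * u ^ 2) : 0 ≤ QF c1 c2 c3 f :=
  quad_nonneg hf.smooth hf.comp hf.supp h1 h2 h3 hΦ hΦ' hpos

/-- `r²Ω²/(r-1)` -/
def nn (l E r : ℝ) : ℝ := l * r ^ 3 + l * r ^ 2 + (l + 1) * r - E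
def pp (l E r : ℝ) : ℝ := (r - 1) * nn l E r
noncomputable def cc (l b q E m r : ℝ) : ℝ :=
  (-b - q ^ 2 * E * (r - 1) / nn l E r) * r ^ 2 + m * r ^ 4 / pp l E r
noncomputable def Q (l b q E m : ℝ) (f : ℝ → ℝ) : ℝ := QF (pp l E) (fun _ => 0) (cc l b q E m) f
def Pos (l b q E m : ℝ) : Prop := ∀ f, IsT f → 0 ≤ Q l b q E m f

theorem nn_pos {l E r : ℝ} (hl : 0 < l) (hE : E < 1 + 3 * l) (hr : 1 < r) : 0 < nn l E r := by
  unfold nn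
  have h2 : 1 < r ^ 2 := by nlinarith
  have h3 : 1 < r ^ 3 := by nlinarith
  nlinarith
theorem pp_pos {l E r : ℝ} (hl : 0 < l) (hE : E < 1 + 3 * l) (hr : 1 < r) : 0 < pp l E r :=
  mul_pos (by linarith) (nn_pos hl hE hr)
theorem nn_cont (l E : ℝ) : Continuous (nn l E) := by unfold nn; fun_prop
theorem pp_cont (l E : ℝ) : Continuous (pp l E) := by unfold pp nn; fun_prop
theorem cc_cont {l b q E m : ℝ} (hl : 0 < l) (hE : E < 1 + 3 * l) :
    ContinuousOn (cc l b q E m) (Ioi 1) := by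
  unfold cc
  have h1 : ∀ r ∈ Ioi (1:ℝ), nn l E r ≠ 0 := fun r hr => (nn_pos hl hE hr).ne'
  have h2 : ∀ r ∈ Ioi (1:ℝ), pp l E r ≠ 0 := fun r hr => (pp_pos hl hE hr).ne'
  have h3 := (nn_cont l E).continuousOn (s := Ioi (1:ℝ))
  have h4 := (pp_cont l E).continuousOn (s := Ioi (1:ℝ))
  fun_prop (disch := assumption)
theorem nn_deriv (l E r : ℝ) : HasDerivAt (nn l E) (3 * l * r ^ 2 + 2 * l * r + (l + 1)) r := by
  unfold nn
  have := (((((hasDerivAt_id r).pow 3).const_mul l).add (((hasDerivAt_id r).pow 2).const_mul l)).add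
    ((hasDerivAt_id r).const_mul (l + 1))).sub_const E
  refine this.congr_deriv ?_
  simp; ring
theorem pp_deriv (l E r : ℝ) :
    HasDerivAt (pp l E) (nn l E r + (r - 1) * (3 * l * r ^ 2 + 2 * l * r + (l + 1))) r := by
  unfold pp
  have := ((hasDerivAt_id r).sub_const 1).mul (nn_deriv l E r)
  refine this.congr_deriv ?_
  simp


theorem exists_isT_bump : ∃ f, IsT f ∧ f 2 ≠ 0 := by
  let φ : ContDiffBump (2:ℝ) := ⟨1/4, 1/2, by norm_num, by norm_num⟩
  refine ⟨φ, ⟨φ.contDiff, φ.hasCompactSupport, ?_⟩, ?_⟩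
  · rw [φ.tsupport_eq]
    intro r hr
    rw [Metric.mem_closedBall, Real.dist_eq] at hr
    have := abs_le.1 hr
    have h2 : φ.rOut = 1/2 := rfl
    rw [h2] at this
    simp only [mem_Ioi]
    linarith [this.1]
  · have : φ 2 = 1 := φ.one_of_mem_closedBall (by simp [φ])
    rw [this]; norm_num

/-- squared norm -/
noncomputable def NF (l E : ℝ) (f : ℝ → ℝ) : ℝ := ∫ r, r ^ 4 / pp l E r * (f r) ^ 2

theorem NF_pos {l E : ℝ} (hl : 0 < l) (hE : E < 1 + 3 * l) {f : ℝ → ℝ} (hf : IsT f)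
    (h : ∃ r, f r ≠ 0) : 0 < NF l E f := by
  obtain ⟨r0, hr0⟩ := h
  have hz : ∀ r, r ∉ tsupport f → f r = 0 := fun r hr => (ts_zero hr).1
  have hm : r0 ∈ tsupport f := by
    by_contra hh
    exact hr0 (hz r0 hh)
  have hi := quad_integrable hf.smooth hf.comp hf.supp (c1 := fun _ => 0) (c2 := fun _ => 0)
    (c3 := fun r => r ^ 4 / pp l E r) continuousOn_const continuousOn_const (by
      have h2 : ∀ r ∈ Ioi (1:ℝ), pp l E r ≠ 0 := fun r hr => (pp_pos hl hE hr).ne'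
      have h4 := (pp_cont l E).continuousOn (s := Ioi (1:ℝ))
      fun_prop (disch := assumption))
  have hi' : Integrable (fun r => r ^ 4 / pp l E r * (f r) ^ 2) := by
    simpa using hi
  have hcont : ContinuousOn (fun r => r ^ 4 / pp l E r * (f r) ^ 2) (Ioi 1) := by
    have h2 : ∀ r ∈ Ioi (1:ℝ), pp l E r ≠ 0 := fun r hr => (pp_pos hl hE hr).ne'
    have h4 := (pp_cont l E).continuousOn (s := Ioi (1:ℝ))
    have := hf.smooth.continuous
    fun_prop (disch := assumption)
  have hnn : 0 ≤ fun r => r ^ 4 / pp l E r * (f r) ^ 2 := by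
    intro r
    by_cases hr : r ∈ tsupport f
    · have := pp_pos hl hE (hf.supp hr)
      simp only [Pi.zero_apply]
      positivity
    · simp [hz r hr]
  unfold NF
  rw [integral_pos_iff_support_of_nonneg hnn hi']
  have hr1 : (1:ℝ) < r0 := hf.supp hm
  have hat : ContinuousAt (fun r => r ^ 4 / pp l E r * (f r) ^ 2) r0 :=
    hcont.continuousAt (Ioi_mem_nhds hr1)
  have hne : r0 ^ 4 / pp l E r0 * (f r0) ^ 2 ≠ 0 := by
    have := pp_pos hl hE hr1
    have : 0 < r0 := by linarith
    positivity
  have : Function.support (fun r => r ^ 4 / pp l E r * (f r) ^ 2) ∈ nhds r0 :=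
    hat.eventually_ne hne
  exact Measure.measure_pos_of_mem_nhds volume this

theorem Q_eq {l b q E m : ℝ} (hl : 0 < l) (hE : E < 1 + 3 * l) {f : ℝ → ℝ} (hf : IsT f) :
    Q l b q E m f = Q l b q E 0 f + m * NF l E f := by
  have h := QF_comb hf (c1 := pp l E) (c2 := fun _ => 0) (c3 := cc l b q E 0)
    (d1 := fun _ => 0) (d2 := fun _ => 0) (d3 := fun r => r ^ 4 / pp l E r)
    (pp_cont l E).continuousOn continuousOn_const (cc_cont hl hE) continuousOn_const
    continuousOn_const (by
      have h2 : ∀ r ∈ Ioi (1:ℝ), pp l E r ≠ 0 := fun r hr => (pp_pos hl hE hr).ne'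
      have h4 := (pp_cont l E).continuousOn (s := Ioi (1:ℝ))
      fun_prop (disch := assumption)) 1 m
  have e : QF (fun _ => 0) (fun _ => 0) (fun r => r ^ 4 / pp l E r) f = NF l E f := by
    simp [QF, NF]
  rw [e] at h
  unfold Q
  rw [one_mul (QF _ _ _ _)] at h
  rw [← h]
  apply QF_congr
  intro r _
  unfold cc
  ring

theorem Q_smul {l b q E m k : ℝ} {f : ℝ → ℝ} :
    Q l b q E m (fun r => k * f r) = k ^ 2 * Q l b q E m f := by
  unfold Q QF
  rw [← integral_const_mul]
  congr 1
  ext r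
  simp only [deriv_const_mul_field]
  ring
theorem NF_smul {l E k : ℝ} {f : ℝ → ℝ} :
    NF l E (fun r => k * f r) = k ^ 2 * NF l E f := by
  unfold NF
  rw [← integral_const_mul]
  congr 1
  ext r
  ring

section scal
variable {rp Λ α q0 M : ℝ}

theorem scale_Om (hrp : 0 < rp) {s : ℝ} (hs : 1 < s) :
    Om2 rp Λ M (rp * s) = pp (-Λ / 3 * rp ^ 2) (2 * M / rp - 1 - (-Λ / 3 * rp ^ 2)) s / s ^ 2 := by
  have : s ≠ 0 := by linarith
  unfold Om2 pp nn e2fun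
  field_simp
  ring

theorem scale_L (hrp : 0 < rp) {f : ℝ → ℝ} (hf : IsT (fun s => f (rp * s))) {l E : ℝ}
    (hl : l = -Λ / 3 * rp ^ 2) (hE : E = 2 * M / rp - 1 - l) (hl0 : 0 < l) (hE1 : E < 1 + 3 * l) :
    Lfun rp Λ α q0 M f = rp * Q l (-l * α) (q0 * rp) E 0 (fun s => f (rp * s)) := by
  have h0 := quad_supp hf.supp (c1 := pp l E) (c2 := fun _ => 0)
    (c3 := cc l (-l * α) (q0 * rp) E 0)
  unfold Q QF
  rw [← h0]
  unfold Lfun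
  have h1 := integral_comp_mul_left_Ioi (fun r => r ^ 2 * Om2 rp Λ M r * (deriv f r) ^ 2
      + ((-Λ / 3) * α - q0 ^ 2 * e2fun rp Λ M * (1 / rp - 1 / r) ^ 2 / Om2 rp Λ M r)
          * r ^ 2 * (f r) ^ 2) 1 hrp
  rw [mul_one] at h1
  have h2 : ∀ x : ℝ, x = rp * (rp⁻¹ • x) := by intro x; simp; field_simp
  rw [h2 (∫ r in Ioi rp, _), ← h1]
  congr 1
  apply setIntegral_congr_fun measurableSet_Ioi
  intro s hs
  have hs' : (1:ℝ) < s := hs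
  simp only
  rw [scale_Om hrp hs']
  have hd : deriv (fun s => f (rp * s)) s = rp * deriv f (rp * s) := by
    have := deriv_comp_mul_left rp f s
    simpa using this
  rw [hd, ← hl, ← hE]
  have hp := pp_pos hl0 hE1 hs'
  have hn := nn_pos hl0 hE1 hs'
  have h3 : e2fun rp Λ M = rp ^ 2 * E := by
    unfold e2fun; rw [hE, hl]; field_simp; ring
  have h4 : -Λ / 3 * α * rp ^ 2 = l * α := by rw [hl]; ring
  rw [h3]
  unfold cc
  have : s ≠ 0 := by linarith
  have hpn : pp l E s = (s - 1) * nn l E s := rfl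
  have : s - 1 ≠ 0 := by linarith
  have h5 : -Λ / 3 = l / rp ^ 2 := by rw [hl]; field_simp
  rw [h5, hpn]
  field_simp
  ring

theorem scale_N (hrp : 0 < rp) {f : ℝ → ℝ} (hf : IsT (fun s => f (rp * s))) {l E : ℝ}
    (hl : l = -Λ / 3 * rp ^ 2) (hE : E = 2 * M / rp - 1 - l) (hl0 : 0 < l) (hE1 : E < 1 + 3 * l) :
    (∫ r in Set.Ioi rp, r ^ 2 * (f r) ^ 2 / Om2 rp Λ M r)
      = rp ^ 3 * NF l E (fun s => f (rp * s)) := by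
  have h0 := quad_supp hf.supp (c1 := fun _ => 0) (c2 := fun _ => 0)
    (c3 := fun r => r ^ 4 / pp l E r)
  simp only [zero_mul, zero_add] at h0
  unfold NF
  rw [← h0]
  have h1 := integral_comp_mul_left_Ioi (fun r => r ^ 2 * (f r) ^ 2 / Om2 rp Λ M r) 1 hrp
  rw [mul_one] at h1
  have h2 : ∀ x : ℝ, x = rp * (rp⁻¹ • x) := by intro x; simp; field_simp
  rw [h2 (∫ r in Ioi rp, _), ← h1, ← integral_const_mul, ← integral_const_mul]
  apply setIntegral_congr_fun measurableSet_Ioi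
  intro s hs
  have hs' : (1:ℝ) < s := hs
  simp only
  rw [scale_Om hrp hs', ← hl, ← hE]
  have hp := pp_pos hl0 hE1 hs'
  have : s ≠ 0 := by linarith
  field_simp

theorem isT_scale (hrp : 0 < rp) {f : ℝ → ℝ} (h1 : ContDiff ℝ (⊤ : ℕ∞) f)
    (h2 : HasCompactSupport f) (h3 : tsupport f ⊆ Ioi rp) : IsT (fun s => f (rp * s)) := by
  refine ⟨by fun_prop, ?_, ?_⟩
  · exact h2.comp_homeomorph (Homeomorph.mulLeft₀ rp hrp.ne')
  · intro s hs
    have : rp * s ∈ tsupport f := tsupport_comp_subset_preimage f (f := fun s => rp * s)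
      (by fun_prop) hs
    have := h3 this
    simp only [mem_Ioi] at *
    nlinarith

theorem isT_unscale (hrp : 0 < rp) {F : ℝ → ℝ} (hF : IsT F) :
    ContDiff ℝ (⊤ : ℕ∞) (fun r => F (rp⁻¹ * r)) ∧ HasCompactSupport (fun r => F (rp⁻¹ * r)) ∧
    tsupport (fun r => F (rp⁻¹ * r)) ⊆ Ioi rp := by
  refine ⟨hF.smooth.comp (by fun_prop), ?_, ?_⟩
  · exact hF.comp.comp_homeomorph (Homeomorph.mulLeft₀ rp⁻¹ (by positivity))
  · intro s hs
    have : rp⁻¹ * s ∈ tsupport F := tsupport_comp_subset_preimage F (f := fun s => rp⁻¹ * s)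
      (by fun_prop) hs
    have := hF.supp this
    simp only [mem_Ioi] at *
    rw [inv_mul_eq_div, lt_div_iff₀ hrp] at this
    linarith

def LSet (rp Λ α q0 M : ℝ) : Set ℝ := {x : ℝ | ∃ f : ℝ → ℝ, ContDiff ℝ (⊤ : ℕ∞) f ∧
    HasCompactSupport f ∧ tsupport f ⊆ Set.Ioi rp ∧
    (∫ r in Set.Ioi rp, r ^ 2 * (f r) ^ 2 / Om2 rp Λ M r) = 1 ∧
    x = Lfun rp Λ α q0 M f}

theorem pos_iff (hrp : 0 < rp) {l E m : ℝ}
    (hl : l = -Λ / 3 * rp ^ 2) (hE : E = 2 * M / rp - 1 - l) (hl0 : 0 < l) (hE1 : E < 1 + 3 * l) :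
    Pos l (-l * α) (q0 * rp) E m ↔ ∀ x ∈ LSet rp Λ α q0 M, -m / rp ^ 2 ≤ x := by
  constructor
  · rintro h x ⟨f, h1, h2, h3, h4, rfl⟩
    have hT := isT_scale hrp h1 h2 h3
    have := h _ hT
    rw [Q_eq hl0 hE1 hT] at this
    rw [scale_N hrp hT hl hE hl0 hE1] at h4
    rw [scale_L hrp hT hl hE hl0 hE1]
    set A := Q l (-l * α) (q0 * rp) E 0 (fun s => f (rp * s))
    set B := NF l E (fun s => f (rp * s))
    have hB : B = 1 / rp ^ 3 := by field_simp; linarith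
    rw [hB] at this
    have h5 : 0 ≤ rp * (A + m * (1 / rp ^ 3)) := by positivity
    have h6 : rp * (A + m * (1 / rp ^ 3)) = rp * A - (-m / rp ^ 2) := by field_simp; ring
    linarith
  · intro h F hF
    by_cases hz : ∃ r, F r ≠ 0
    · have hN := NF_pos hl0 hE1 hF hz
      set k := Real.sqrt (1 / (rp ^ 3 * NF l E F)) with hk
      have hk2 : k ^ 2 = 1 / (rp ^ 3 * NF l E F) := Real.sq_sqrt (by positivity)
      have hkT : IsT (fun r => k * F r) := hF.mul (fun r _ => contDiffAt_const)
      obtain ⟨h1, h2, h3⟩ := isT_unscale hrp hkT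
      have e : (fun s => (fun r => k * F (rp⁻¹ * r)) (rp * s)) = fun s => k * F s := by
        ext s; simp only; congr 2; field_simp
      have hT : IsT (fun s => (fun r => k * F (rp⁻¹ * r)) (rp * s)) := by rw [e]; exact hkT
      have := h _ ⟨_, h1, h2, h3, by
        rw [scale_N hrp hT hl hE hl0 hE1, e, NF_smul, hk2]; field_simp, rfl⟩
      rw [scale_L hrp hT hl hE hl0 hE1, e, Q_smul, hk2] at this
      rw [Q_eq hl0 hE1 hF]
      have h5 : 0 ≤ rp ^ 2 * NF l E F * (rp * (1 / (rp ^ 3 * NF l E F) * Q l (-l * α) (q0 * rp) E 0 F)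
        - (-m / rp ^ 2)) := by
        apply mul_nonneg (by positivity); linarith
      have h6 : rp ^ 2 * NF l E F * (rp * (1 / (rp ^ 3 * NF l E F) * Q l (-l * α) (q0 * rp) E 0 F)
        - (-m / rp ^ 2)) = Q l (-l * α) (q0 * rp) E 0 F + m * NF l E F := by
        field_simp; ring
      linarith
    · push Not at hz
      have : F = fun _ => 0 := by ext r; exact hz r
      subst this
      simp [Q, QF]

theorem LSet_nonempty (hrp : 0 < rp) {l E : ℝ}
    (hl : l = -Λ / 3 * rp ^ 2) (hE : E = 2 * M / rp - 1 - l) (hl0 : 0 < l) (hE1 : E < 1 + 3 * l) :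
    (LSet rp Λ α q0 M).Nonempty := by
  by_contra hne
  rw [Set.not_nonempty_iff_eq_empty] at hne
  obtain ⟨F, hF, h2⟩ := exists_isT_bump
  have hN := NF_pos hl0 hE1 hF ⟨2, h2⟩
  have hall : ∀ m, Pos l (-l * α) (q0 * rp) E m := by
    intro m
    rw [pos_iff hrp hl hE hl0 hE1, hne]
    simp
  have := hall (-(Q l (-l * α) (q0 * rp) E 0 F + 1) / NF l E F) F hF
  rw [Q_eq hl0 hE1 hF, div_mul_cancel₀ _ hN.ne'] at this
  linarith
end scal


theorem pos_mono {l b q E m m' : ℝ} (hl : 0 < l) (hE : E < 1 + 3 * l) (h : Pos l b q E m)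
    (hm : m ≤ m') : Pos l b q E m' := by
  intro f hf
  have h1 := h f hf
  rw [Q_eq hl hE hf] at *
  have : 0 ≤ NF l E f := by
    by_cases hz : ∃ r, f r ≠ 0
    · exact (NF_pos hl hE hf hz).le
    · push Not at hz
      simp [NF, hz]
  nlinarith

theorem lam_pos {rp Λ α q0 M l E : ℝ} (hrp : 0 < rp)
    (hl : l = -Λ / 3 * rp ^ 2) (hE : E = 2 * M / rp - 1 - l) (hl0 : 0 < l) (hE1 : E < 1 + 3 * l)
    (h : ∃ m, Pos l (-l * α) (q0 * rp) E m) :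
    Pos l (-l * α) (q0 * rp) E (rp ^ 2 * lamfun rp Λ α q0 M) ∧
    ∀ m, Pos l (-l * α) (q0 * rp) E m → rp ^ 2 * lamfun rp Λ α q0 M ≤ m := by
  have hne := LSet_nonempty (α := α) (q0 := q0) hrp hl hE hl0 hE1
  have hlam : lamfun rp Λ α q0 M = - sInf (LSet rp Λ α q0 M) := rfl
  obtain ⟨m, hm⟩ := h
  rw [pos_iff hrp hl hE hl0 hE1] at hm
  have hb : BddBelow (LSet rp Λ α q0 M) := ⟨_, fun x hx => hm x hx⟩
  constructor
  · rw [pos_iff hrp hl hE hl0 hE1]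
    intro x hx
    rw [hlam]
    have := csInf_le hb hx
    refine le_trans (le_of_eq ?_) this
    field_simp
  · intro m' hm'
    rw [pos_iff hrp hl hE hl0 hE1] at hm'
    have := le_csInf hne hm'
    rw [hlam]
    have h2 : 0 ≤ rp ^ 2 * (sInf (LSet rp Λ α q0 M) - -m' / rp ^ 2) := by
      apply mul_nonneg (by positivity); linarith
    have h3 : rp ^ 2 * (sInf (LSet rp Λ α q0 M) - -m' / rp ^ 2)
      = rp ^ 2 * sInf (LSet rp Λ α q0 M) + m' := by field_simp; ring
    linarith

theorem lam_zero {rp Λ α q0 M l E : ℝ} (hrp : 0 < rp)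
    (hl : l = -Λ / 3 * rp ^ 2) (hE : E = 2 * M / rp - 1 - l) (hl0 : 0 < l) (hE1 : E < 1 + 3 * l)
    (h : ¬ ∃ m, Pos l (-l * α) (q0 * rp) E m) : lamfun rp Λ α q0 M = 0 := by
  have hlam : lamfun rp Λ α q0 M = - sInf (LSet rp Λ α q0 M) := rfl
  rw [hlam, Real.sInf_of_not_bddBelow, neg_zero]
  rintro ⟨x, hx⟩
  apply h
  refine ⟨- x * rp ^ 2, ?_⟩
  rw [pos_iff hrp hl hE hl0 hE1]
  intro y hy
  have := hx hy
  refine le_trans (le_of_eq ?_) this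
  field_simp

theorem assembly (rp Λ α q0 : ℝ) (hrp : 0 < rp) (hΛ : Λ < 0)
    (F2 : ∀ l b q E m : ℝ, 0 < l → 0 ≤ E → E < 1 + 3 * l → Pos l b q E m → 0 ≤ m)
    (F3 : ∀ l b q E1 E2 m : ℝ, 0 < l → 0 ≤ E2 → E2 ≤ E1 → E1 < 1 + 3 * l → 0 ≤ m →
      Pos l b q E2 m → Pos l b q E1 (m + (9 / 4 * (1 + 3 * l) + |b| + q ^ 2) * (E1 - E2)))
    (F4 : ∀ l b q E1 E2 m0 m : ℝ, 0 < l → 0 ≤ E2 → E2 < E1 → E1 < 1 + 3 * l → 0 ≤ m0 → m0 < m →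
      Pos l b q E1 m0 → Pos l b q E2 m)
    (Me0 M0 : ℝ) (hMe0 : Me0 = rp / 2 * (1 + (-Λ / 3) * rp ^ 2))
    (hM0 : M0 = rp * (1 + 2 * (-Λ / 3) * rp ^ 2)) :
    (∃ C : ℝ, ∀ M1 M2 : ℝ, Me0 ≤ M2 → M2 ≤ M1 → M1 < M0 →
      0 ≤ lamfun rp Λ α q0 M1 - lamfun rp Λ α q0 M2 ∧
      lamfun rp Λ α q0 M1 - lamfun rp Λ α q0 M2 ≤ C * (M1 - M2)) ∧
    (∀ Ma Mb : ℝ, Me0 ≤ Ma → Ma < M0 → Me0 ≤ Mb → Mb < M0 →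
      lamfun rp Λ α q0 Ma < 0 → 0 < lamfun rp Λ α q0 Mb →
      ∃ Mc : ℝ, Me0 ≤ Mc ∧ Mc < M0 ∧ lamfun rp Λ α q0 Mc = 0) := by
  obtain ⟨l, hl⟩ : ∃ l, l = -Λ / 3 * rp ^ 2 := ⟨_, rfl⟩
  have hl0 : 0 < l := by rw [hl]; have : 0 < -Λ / 3 := by linarith
                         positivity
  have hEl : ∀ M, Me0 ≤ M → M < M0 → 0 ≤ 2 * M / rp - 1 - l ∧ 2 * M / rp - 1 - l < 1 + 3 * l := by
    intro M h1 h2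
    rw [hMe0, ← hl] at h1
    have hM0' : M0 = rp * (1 + 2 * l) := by rw [hM0, hl]; ring
    rw [hM0'] at h2
    constructor
    · have : 1 + l ≤ 2 * M / rp := by rw [le_div_iff₀ hrp]; linarith
      linarith
    · have : 2 * M / rp < 2 + 4 * l := by rw [div_lt_iff₀ hrp]; linarith
      linarith
  have hnon : ∀ M, Me0 ≤ M → M < M0 → 0 ≤ lamfun rp Λ α q0 M := by
    intro M h1 h2
    obtain ⟨h3, h4⟩ := hEl M h1 h2
    by_cases h : ∃ m, Pos l (-l * α) (q0 * rp) (2 * M / rp - 1 - l) m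
    · have := (lam_pos hrp hl rfl hl0 h4 h).1
      have := F2 _ _ _ _ _ hl0 h3 h4 this
      by_contra hn
      push Not at hn
      have : 0 < rp ^ 2 := by positivity
      nlinarith
    · exact (lam_zero hrp hl rfl hl0 h4 h).ge
  refine ⟨⟨2 * (9 / 4 * (1 + 3 * l) + |(-l * α)| + (q0 * rp) ^ 2) / rp ^ 3, ?_⟩, ?_⟩
  swap
  · intro Ma Mb h1 h2 h3 h4 h5
    exact absurd (hnon Ma h1 h2) (not_le.2 h5)
  intro M1 M2 h1 h12 h2
  obtain ⟨a1, a2⟩ := hEl M1 (h1.trans h12) h2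
  obtain ⟨b1, b2⟩ := hEl M2 h1 (h12.trans_lt h2)
  rcases h12.eq_or_lt with rfl | hlt
  · simp
  have hElt : 2 * M2 / rp - 1 - l < 2 * M1 / rp - 1 - l := by
    have : 2 * M2 / rp < 2 * M1 / rp := by gcongr
    linarith
  have hEd : (2 * M1 / rp - 1 - l) - (2 * M2 / rp - 1 - l) = 2 * (M1 - M2) / rp := by ring
  set E1 := 2 * M1 / rp - 1 - l with hE1
  set E2 := 2 * M2 / rp - 1 - l with hE2
  set C := 9 / 4 * (1 + 3 * l) + |(-l * α)| + (q0 * rp) ^ 2 with hC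
  have hC0 : 0 ≤ C := by positivity
  by_cases h : ∃ m, Pos l (-l * α) (q0 * rp) E1 m
  · have p1 := lam_pos hrp hl hE1 hl0 a2 h
    have n1 := F2 _ _ _ _ _ hl0 a1 a2 p1.1
    have h' : ∃ m, Pos l (-l * α) (q0 * rp) E2 m :=
      ⟨_, F4 _ _ _ _ _ _ _ hl0 b1 hElt a2 n1 (lt_add_one _) p1.1⟩
    have p2 := lam_pos hrp hl hE2 hl0 b2 h'
    have n2 := F2 _ _ _ _ _ hl0 b1 b2 p2.1
    have k1 : rp ^ 2 * lamfun rp Λ α q0 M2 ≤ rp ^ 2 * lamfun rp Λ α q0 M1 := by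
      apply le_of_forall_gt_imp_ge_of_dense
      intro m hm
      exact p2.2 _ (F4 _ _ _ _ _ _ _ hl0 b1 hElt a2 n1 hm p1.1)
    have k2 := p1.2 _ (F3 _ _ _ _ _ _ hl0 b1 hElt.le a2 n2 p2.1)
    rw [← hC, hEd] at k2
    have hr2 : 0 < rp ^ 2 := by positivity
    constructor
    · have := le_of_mul_le_mul_left k1 hr2
      linarith
    · have h5 : rp ^ 2 * (lamfun rp Λ α q0 M1 - lamfun rp Λ α q0 M2)
        ≤ rp ^ 2 * (2 * C / rp ^ 3 * (M1 - M2)) := by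
        have : rp ^ 2 * (2 * C / rp ^ 3 * (M1 - M2)) = C * (2 * (M1 - M2) / rp) := by
          field_simp
        rw [this]; linarith
      exact le_of_mul_le_mul_left h5 hr2
  · have h' : ¬ ∃ m, Pos l (-l * α) (q0 * rp) E2 m := by
      rintro ⟨m, hm⟩
      exact h ⟨_, F3 _ _ _ _ _ _ hl0 b1 hElt.le a2 (F2 _ _ _ _ _ hl0 b1 b2 hm) hm⟩
    rw [lam_zero hrp hl hE1 hl0 a2 h, lam_zero hrp hl hE2 hl0 b2 h']
    simp only [sub_self, le_refl, true_and]
    have : 0 ≤ M1 - M2 := by linarith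
    positivity


theorem nn_contDiff (l E : ℝ) : ContDiff ℝ (⊤ : ℕ∞) (nn l E) := by unfold nn; fun_prop

def nd (l r : ℝ) : ℝ := 3 * l * r ^ 2 + 2 * l * r + (l + 1)
theorem nd_cont (l : ℝ) : Continuous (nd l) := by unfold nd; fun_prop
theorem nn_deriv' (l E r : ℝ) : HasDerivAt (nn l E) (nd l r) r := nn_deriv l E r
theorem nd_deriv (l r : ℝ) : HasDerivAt (nd l) (6 * l * r + 2 * l) r := by
  unfold nd
  have := (((((hasDerivAt_id r).pow 2).const_mul (3 * l))).add
    ((hasDerivAt_id r).const_mul (2 * l))).add_const (l + 1)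
  refine this.congr_deriv ?_
  simp; ring

theorem xnd_le {l E r : ℝ} (hl : 0 < l) (hE : E ≤ 1 + 3 * l) (hr : 1 < r) :
    (r - 1) * nd l r ≤ 3 * nn l E r := by
  obtain ⟨x, rfl⟩ : ∃ x, r = 1 + x := ⟨r - 1, by ring⟩
  have hx : 0 < x := by linarith
  unfold nd nn
  have h : 3 * (l * (1 + x) ^ 3 + l * (1 + x) ^ 2 + (l + 1) * (1 + x) - E)
    - (1 + x - 1) * (3 * l * (1 + x) ^ 2 + 2 * l * (1 + x) + (l + 1))
    = 3 * (1 + 3 * l - E) + 2 * (1 + 6 * l) * x + 4 * l * x ^ 2 := by ring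
  have : 0 ≤ 2 * (1 + 6 * l) * x + 4 * l * x ^ 2 := by positivity
  linarith

theorem xnd_mono {l E r : ℝ} (hl : 0 < l) (hE : E ≤ 1 + 3 * l) (hr : 1 < r) :
    0 ≤ (nd l r + (r - 1) * (6 * l * r + 2 * l)) * nn l E r - (r - 1) * nd l r ^ 2 := by
  obtain ⟨x, rfl⟩ : ∃ x, r = 1 + x := ⟨r - 1, by ring⟩
  have hx : 0 < x := by linarith
  obtain ⟨k, hk⟩ : ∃ k, k = 1 + 3 * l - E := ⟨_, rfl⟩
  have hk0 : 0 ≤ k := by linarith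
  have h : (nd l (1 + x) + (1 + x - 1) * (6 * l * (1 + x) + 2 * l)) * nn l E (1 + x)
      - (1 + x - 1) * nd l (1 + x) ^ 2
    = k * (1 + 6 * l + 16 * l * x + 9 * l * x ^ 2) + 4 * l * (1 + 6 * l) * x ^ 2
      + 4 * l * (1 + 6 * l) * x ^ 3 + 4 * l ^ 2 * x ^ 4 := by
    rw [hk]; unfold nd nn; ring
  rw [h]
  positivity

theorem F3pt {l b q E1 E2 m r x δ a n d DD : ℝ} (hl : 0 < l) (hE2 : 0 ≤ E2) (hE2' : E2 < 1 + 3 * l)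
    (hm : 0 ≤ m) (hr1 : 1 < r) (hx : x = r - 1) (hx0 : 0 < x) (hδ : δ = E1 - E2) (hδ0 : 0 ≤ δ)
    (hδ1 : δ ≤ 1 + 3 * l) (e3 : 0 < a) (e4 : 0 < n) (hnd : 0 < d) (hD : 0 ≤ DD)
    (hle : x * d ≤ 3 * n) (hn12 : a = n - δ) (hxlow : (1 + 6 * l) * x ≤ n) :
    0 ≤ 1 * ((-b - q ^ 2 * E1 * x / a) * r ^ 2 +
          (m + (9 / 4 * (1 + 3 * l) + |b| + q ^ 2) * δ) * r ^ 4 / (x * a)) +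
          -1 * (δ ^ 2 * x * d ^ 2 / (4 * n ^ 2 * a) + ((-b - q ^ 2 * E2 * x / n) * r ^ 2
            + m * r ^ 4 / (x * n)) * (a / n)) + DD := by
  have hr4 : 1 ≤ r ^ 4 := one_le_pow₀ hr1.le
  have k1 : δ ^ 2 * x * d ^ 2 / (4 * n ^ 2 * a) ≤ 9 / 4 * (1 + 3 * l) * δ * (r ^ 4 / (x * a)) := by
    have : δ ^ 2 * x * d ^ 2 / (4 * n ^ 2 * a) = 1/4 * δ ^ 2 * (x * d / n) ^ 2 / (x * a) := by
      field_simp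
    rw [this]
    have h1 : x * d / n ≤ 3 := by rw [div_le_iff₀ e4]; linarith
    have h2 : 0 ≤ x * d / n := by positivity
    have h3 : (x * d / n) ^ 2 ≤ 9 := by nlinarith
    rw [← mul_div_assoc]
    apply div_le_div_of_nonneg_right _ (by positivity)
    calc 1/4 * δ ^ 2 * (x * d / n) ^ 2 ≤ 1/4 * δ ^ 2 * 9 := by gcongr
      _ = 9/4 * δ * δ := by ring
      _ ≤ 9/4 * δ * (1 + 3 * l) := by gcongr
      _ = 9 / 4 * (1 + 3 * l) * δ * 1 := by ring
      _ ≤ _ := by gcongr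
  have k2 : b * r ^ 2 * (δ / n) ≤ |b| * δ * (r ^ 4 / (x * a)) := by
    calc b * r ^ 2 * (δ / n) ≤ |b| * r ^ 2 * (δ / n) := by gcongr; exact le_abs_self b
      _ = |b| * δ * (r ^ 2 / n) := by ring
      _ ≤ _ := by
        gcongr |b| * δ * ?_
        rw [div_le_div_iff₀ e4 (by positivity)]
        have : x * a ≤ r ^ 2 * n := by
          apply mul_le_mul _ _ e3.le (by positivity)
          · nlinarith
          · linarith
        calc r ^ 2 * (x * a) ≤ r ^ 2 * (r ^ 2 * n) := by gcongr
          _ = r ^ 4 * n := by ring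
  have k3 : q ^ 2 * r ^ 2 * x * (E1 / a - E2 * a / n ^ 2) ≤ q ^ 2 * δ * (r ^ 4 / (x * a)) := by
    have s1 : E1 / a - E2 * a / n ^ 2 ≤ δ * (1 + 2 * E2 / n) / a := by
      rw [div_sub_div _ _ e3.ne' (by positivity), div_le_div_iff₀ (by positivity) e3]
      have : δ * (1 + 2 * E2 / n) * (a * n ^ 2) = δ * a * (n ^ 2 + 2 * E2 * n) := by
        field_simp
      rw [this]
      have hE : E1 = E2 + δ := by linarith
      rw [hE, hn12]
      have : 0 ≤ (n - δ) * (E2 * δ ^ 2) := by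
        rw [← hn12]; positivity
      nlinarith
    have s2 : x ^ 2 * (1 + 2 * E2 / n) ≤ r ^ 2 := by
      have : 2 * E2 / n * x ≤ 2 := by
        rw [div_mul_eq_mul_div, div_le_iff₀ e4]
        nlinarith
      have hr' : r = x + 1 := by linarith
      rw [hr']
      nlinarith
    calc q ^ 2 * r ^ 2 * x * (E1 / a - E2 * a / n ^ 2)
        ≤ q ^ 2 * r ^ 2 * x * (δ * (1 + 2 * E2 / n) / a) := by gcongr
      _ = q ^ 2 * δ * (r ^ 2 * (x ^ 2 * (1 + 2 * E2 / n)) / (x * a)) := by field_simp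
      _ ≤ q ^ 2 * δ * (r ^ 2 * r ^ 2 / (x * a)) := by gcongr
      _ = _ := by ring
  have k4 : m * r ^ 4 / (x * n) * (a / n) ≤ m * r ^ 4 / (x * a) := by
    have h1 : a / n ≤ 1 := by rw [div_le_one e4]; linarith
    have h2 : m * r ^ 4 / (x * n) ≤ m * r ^ 4 / (x * a) := by
      gcongr; linarith
    calc _ ≤ m * r ^ 4 / (x * n) * 1 := by gcongr
      _ ≤ _ := by linarith
  have hid : 1 * ((-b - q ^ 2 * E1 * x / a) * r ^ 2 +
      (m + (9 / 4 * (1 + 3 * l) + |b| + q ^ 2) * δ) * r ^ 4 / (x * a)) +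
      -1 * (δ ^ 2 * x * d ^ 2 / (4 * n ^ 2 * a) + ((-b - q ^ 2 * E2 * x / n) * r ^ 2
        + m * r ^ 4 / (x * n)) * (a / n)) + DD
    = DD + (9 / 4 * (1 + 3 * l) * δ * (r ^ 4 / (x * a)) - δ ^ 2 * x * d ^ 2 / (4 * n ^ 2 * a))
      + (|b| * δ * (r ^ 4 / (x * a)) - b * r ^ 2 * (δ / n))
      + (q ^ 2 * δ * (r ^ 4 / (x * a)) - q ^ 2 * r ^ 2 * x * (E1 / a - E2 * a / n ^ 2))
      + (m * r ^ 4 / (x * a) - m * r ^ 4 / (x * n) * (a / n)) := by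
    have : δ / n = 1 - a / n := by rw [hn12]; field_simp; ring
    rw [this]; ring
  rw [hid]
  linarith

theorem F3 (l b q E1 E2 m : ℝ) (hl : 0 < l) (hE2 : 0 ≤ E2) (h21 : E2 ≤ E1) (hE1 : E1 < 1 + 3 * l)
    (hm : 0 ≤ m) (hP : Pos l b q E2 m) :
    Pos l b q E1 (m + (9 / 4 * (1 + 3 * l) + |b| + q ^ 2) * (E1 - E2)) := by
  intro f hf
  have hE2' : E2 < 1 + 3 * l := by linarith
  set h : ℝ → ℝ := fun r => Real.sqrt (nn l E1 r / nn l E2 r) with hh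
  have hn1 : ∀ r, 1 < r → 0 < nn l E1 r := fun r hr => nn_pos hl hE1 hr
  have hn2 : ∀ r, 1 < r → 0 < nn l E2 r := fun r hr => nn_pos hl hE2' hr
  set H' : ℝ → ℝ := fun r => (E1 - E2) * nd l r / nn l E2 r ^ 2 with hH'
  have hHd : ∀ r, 1 < r → HasDerivAt (fun r => nn l E1 r / nn l E2 r) (H' r) r := by
    intro r hr
    have := (nn_deriv' l E1 r).div (nn_deriv' l E2 r) (hn2 r hr).ne'
    refine this.congr_deriv ?_
    rw [hH']
    simp only
    congr 1
    unfold nn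
    ring
  have hhd : ∀ r, 1 < r → HasDerivAt h (H' r / (2 * h r)) r := by
    intro r hr
    exact (hHd r hr).sqrt (div_pos (hn1 r hr) (hn2 r hr)).ne'
  have hcd : ∀ r, 1 < r → ContDiffAt ℝ (⊤ : ℕ∞) h r := by
    intro r hr
    exact ContDiffAt.sqrt ((nn_contDiff l E1).contDiffAt.div (nn_contDiff l E2).contDiffAt
      (hn2 r hr).ne') (div_pos (hn1 r hr) (hn2 r hr)).ne'
  have hg := hP _ (hf.mul hcd)
  unfold Q at hg
  rw [QF_mul hf hhd] at hg
  have hh2 : ∀ r, 1 < r → h r ^ 2 = nn l E1 r / nn l E2 r := fun r hr =>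
    Real.sq_sqrt (div_pos (hn1 r hr) (hn2 r hr)).le
  have hh0 : ∀ r, 1 < r → 0 < h r := fun r hr => Real.sqrt_pos.2 (div_pos (hn1 r hr) (hn2 r hr))
  set c3 : ℝ → ℝ := fun r => (E1 - E2) ^ 2 * (r - 1) * nd l r ^ 2 / (4 * nn l E2 r ^ 2 * nn l E1 r)
    + cc l b q E2 m r * (nn l E1 r / nn l E2 r) with hc3
  set c2 : ℝ → ℝ := fun r => (E1 - E2) * (r - 1) * nd l r / nn l E2 r with hc2
  have heq : QF (fun r => pp l E2 r * h r ^ 2)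
      (fun r => 2 * pp l E2 r * h r * (H' r / (2 * h r)) + 0 * h r ^ 2)
      (fun r => pp l E2 r * (H' r / (2 * h r)) ^ 2 + 0 * h r * (H' r / (2 * h r)) +
        cc l b q E2 m r * h r ^ 2) f = QF (pp l E1) c2 c3 f := by
    apply QF_congr
    intro r hr
    have hr1 : 1 < r := hf.supp hr
    have e1 := hh2 r hr1
    have e2 := hh0 r hr1
    have e3 := hn1 r hr1
    have e4 := hn2 r hr1
    have t1 : pp l E2 r * h r ^ 2 = pp l E1 r := by
      rw [e1]; unfold pp; field_simp
    have t2 : 2 * pp l E2 r * h r * (H' r / (2 * h r)) + 0 * h r ^ 2 = c2 r := by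
      rw [hc2, hH']; unfold pp; field_simp; ring
    have t3 : pp l E2 r * (H' r / (2 * h r)) ^ 2 + 0 * h r * (H' r / (2 * h r)) +
        cc l b q E2 m r * h r ^ 2 = c3 r := by
      rw [hc3, div_pow, mul_pow, e1, hH']; unfold pp; field_simp; ring
    rw [t1, t2, t3]
  rw [heq] at hg
  have n1c := (nn_cont l E1).continuousOn (s := Ioi (1:ℝ))
  have n2c := (nn_cont l E2).continuousOn (s := Ioi (1:ℝ))
  have ndc := (nd_cont l).continuousOn (s := Ioi (1:ℝ))
  have n10 : ∀ r ∈ Ioi (1:ℝ), nn l E1 r ≠ 0 := fun r hr => (hn1 r hr).ne'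
  have n20 : ∀ r ∈ Ioi (1:ℝ), nn l E2 r ≠ 0 := fun r hr => (hn2 r hr).ne'
  have ccc := cc_cont (b := b) (q := q) (m := m) hl hE2'
  have c2c : ContinuousOn c2 (Ioi 1) := by
    rw [hc2]; fun_prop (disch := assumption)
  have n30 : ∀ r ∈ Ioi (1:ℝ), 4 * nn l E2 r ^ 2 * nn l E1 r ≠ 0 := fun r hr => by
    have := hn1 r hr
    have := hn2 r hr
    positivity
  have c3c : ContinuousOn c3 (Ioi 1) := by
    rw [hc3]; fun_prop (disch := assumption)
  set m' := m + (9 / 4 * (1 + 3 * l) + |b| + q ^ 2) * (E1 - E2) with hm'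
  have hd := QF_comb hf (c1 := pp l E1) (c2 := fun _ => 0) (c3 := cc l b q E1 m')
    (pp_cont l E1).continuousOn continuousOn_const (cc_cont hl hE1)
    (pp_cont l E1).continuousOn c2c c3c 1 (-1)
  have hfin : 0 ≤ QF (fun r => 1 * pp l E1 r + -1 * pp l E1 r) (fun r => 1 * 0 + -1 * c2 r)
     (fun r => 1 * cc l b q E1 m' r + -1 * c3 r) f := by
    have cc1 := cc_cont (b := b) (q := q) (m := m') hl hE1
    have pp1 := (pp_cont l E1).continuousOn (s := Ioi (1:ℝ))
    have n22 : ∀ r ∈ Ioi (1:ℝ), nn l E2 r ^ 2 ≠ 0 := fun r hr => by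
      have := hn2 r hr
      positivity
    refine QF_nonneg hf (Φ := fun r => (E1 - E2) / 2 * ((r - 1) * nd l r / nn l E2 r))
      (Φ' := fun r => (E1 - E2) / 2 * (((nd l r + (r - 1) * (6 * l * r + 2 * l)) * nn l E2 r
        - (r - 1) * nd l r * nd l r) / nn l E2 r ^ 2)) (by fun_prop) (by fun_prop) (by fun_prop)
        ?_ ?_ ?_
    · intro r hr
      have hr1 : 1 < r := hr
      have := ((((hasDerivAt_id r).sub_const 1).mul (nd_deriv l r)).div (nn_deriv' l E2 r)
        (hn2 r hr1).ne').const_mul ((E1 - E2) / 2)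
      refine this.congr_deriv ?_
      simp
    · fun_prop (disch := assumption)
    · intro r hr u w
      have hr1 : 1 < r := hr
      have e3 := hn1 r hr1
      have e4 := hn2 r hr1
      have t1 : 1 * pp l E1 r + -1 * pp l E1 r = 0 := by ring
      have t2 : 1 * 0 + -1 * c2 r + 2 * ((E1 - E2) / 2 * ((r - 1) * nd l r / nn l E2 r)) = 0 := by
        rw [hc2]; ring
      rw [t1, t2, zero_mul, zero_mul, zero_add, zero_add]
      apply mul_nonneg _ (sq_nonneg u)
      have hmon := xnd_mono hl hE2'.le hr1
      have hle := xnd_le hl hE2'.le hr1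
      have hnd : 0 < nd l r := by unfold nd; positivity
      have hn12 : nn l E1 r = nn l E2 r - (E1 - E2) := by unfold nn; ring
      have hxlow : (1 + 6 * l) * (r - 1) ≤ nn l E2 r := by
        have : nn l E2 r = (1 + 3 * l - E2) + (1 + 6 * l) * (r - 1) + 4 * l * (r - 1) ^ 2
          + l * (r - 1) ^ 3 := by unfold nn; ring
        have h1 : 0 < r - 1 := by linarith
        have : 0 ≤ 4 * l * (r - 1) ^ 2 + l * (r - 1) ^ 3 := by positivity
        linarith
      have hD : 0 ≤ (E1 - E2) / 2 * (((nd l r + (r - 1) * (6 * l * r + 2 * l)) * nn l E2 r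
        - (r - 1) * nd l r * nd l r) / nn l E2 r ^ 2) := by
        apply mul_nonneg (by linarith)
        apply div_nonneg _ (by positivity)
        nlinarith [hmon]
      exact F3pt hl hE2 hE2' hm hr1 rfl (by linarith) rfl (by linarith) (by linarith) e3 e4 hnd hD
        hle hn12 hxlow
  rw [hd] at hfin
  unfold Q
  linarith


theorem exists_eta (K κ S : ℝ) (hκ : 0 < κ) (tail : Set ℝ)
    (ht : ∀ L : ℝ, 0 < L → ∃ a, Icc (a - L) (a + L) ⊆ tail) :
    ∃ η : ℝ → ℝ, ContDiff ℝ (⊤ : ℕ∞) η ∧ HasCompactSupport η ∧ tsupport η ⊆ tail ∧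
      QF (fun _ => K) (fun _ => S) (fun _ => -κ) η < 0 := by
  let φ : ContDiffBump (0:ℝ) := ⟨1, 2, by norm_num, by norm_num⟩
  have hφ : ContDiff ℝ (⊤ : ℕ∞) φ := φ.contDiff
  have hφc : HasCompactSupport φ := φ.hasCompactSupport
  have hφd : Continuous (deriv φ) := hφ.continuous_deriv (by simp)
  set A0 := ∫ t, (deriv φ t) ^ 2 with hA0
  set B0 := ∫ t, (φ t) ^ 2 with hB0
  have hA : 0 ≤ A0 := integral_nonneg (fun t => sq_nonneg _)
  have hB : 0 < B0 := by
    rw [hB0]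
    apply Continuous.integral_pos_of_hasCompactSupport_nonneg_nonzero (x := 0)
    · exact hφ.continuous.pow 2
    · apply hφc.mono
      intro r hr h
      apply hr
      simp [h]
    · intro t; exact sq_nonneg _
    · have : φ 0 = 1 := φ.one_of_mem_closedBall (by simp [φ])
      rw [this]; norm_num
  set ε := Real.sqrt (κ * B0 / (|K| * A0 + 1)) with hε
  have hp : 0 < κ * B0 / (|K| * A0 + 1) := by positivity
  have hε0 : 0 < ε := Real.sqrt_pos.2 hp
  have hε2 : ε ^ 2 = κ * B0 / (|K| * A0 + 1) := Real.sq_sqrt hp.le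
  obtain ⟨a, ha⟩ := ht (2 / ε) (by positivity)
  have hη : ContDiff ℝ (⊤ : ℕ∞) (fun t => φ (ε * (t - a))) := hφ.comp (by fun_prop)
  have hs : tsupport (fun t => φ (ε * (t - a))) ⊆ Icc (a - 2 / ε) (a + 2 / ε) := by
    apply closure_minimal _ isClosed_Icc
    intro t h
    have h1 : ε * (t - a) ∈ Function.support φ := h
    rw [φ.support_eq, Metric.mem_ball, Real.dist_eq, sub_zero] at h1
    have h2 : φ.rOut = 2 := rfl
    rw [h2, abs_lt] at h1
    have e : ε * (2 / ε) = 2 := by field_simp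
    constructor
    · by_contra hc
      push Not at hc
      nlinarith
    · by_contra hc
      push Not at hc
      nlinarith
  have hcs : HasCompactSupport (fun t => φ (ε * (t - a))) :=
    HasCompactSupport.of_support_subset_isCompact isCompact_Icc ((subset_tsupport _).trans hs)
  have hdd : ∀ t, deriv (fun t => φ (ε * (t - a))) t = ε * deriv φ (ε * (t - a)) := by
    intro t
    have h1 : HasDerivAt φ (deriv φ (ε * (t - a))) (ε * (t - a)) :=
      (hφ.differentiable (by simp) _).hasDerivAt
    have h2 : HasDerivAt (fun t => ε * (t - a)) ε t := by
      simpa using ((hasDerivAt_id t).sub_const a).const_mul ε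
    have h3 := (h1.comp t h2).deriv
    refine Eq.trans h3 ?_
    ring
  set η := fun t => φ (ε * (t - a)) with hηd
  refine ⟨η, hη, hcs, hs.trans ha, ?_⟩
  have i1 := quad_integrable hη hcs (subset_univ _) (c1 := fun _ => 1) (c2 := fun _ => 0)
    (c3 := fun _ => 0) continuousOn_const continuousOn_const continuousOn_const
  have i2 := quad_integrable hη hcs (subset_univ _) (c1 := fun _ => 0) (c2 := fun _ => 1)
    (c3 := fun _ => 0) continuousOn_const continuousOn_const continuousOn_const
  have i3 := quad_integrable hη hcs (subset_univ _) (c1 := fun _ => 0) (c2 := fun _ => 0)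
    (c3 := fun _ => 1) continuousOn_const continuousOn_const continuousOn_const
  simp only [one_mul, zero_mul, add_zero, zero_add] at i1 i2 i3
  have v2 : ∫ t, η t * deriv η t = 0 := by
    apply integral_eq_zero_of_hasDerivAt_of_integrable (f := fun t => (η t) ^ 2 / 2) _ i2
      (i3.div_const 2)
    intro t
    have h1 : HasDerivAt η (deriv η t) t := (hη.differentiable (by simp) _).hasDerivAt
    have := (h1.pow 2).div_const 2
    refine this.congr_deriv ?_
    simp only [Nat.cast_ofNat, Nat.add_one_sub_one, pow_one]
    ring
  have ch : ∀ g : ℝ → ℝ, ∫ t, g (ε * (t - a)) = ε⁻¹ * ∫ t, g t := by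
    intro g
    rw [integral_sub_right_eq_self (fun t => g (ε * t)) a, Measure.integral_comp_mul_left]
    rw [abs_of_pos (by positivity)]
    rfl
  have v1 : ∫ t, (deriv η t) ^ 2 = ε * A0 := by
    have : (fun t => (deriv η t) ^ 2) = fun t => ε ^ 2 * (deriv φ (ε * (t - a))) ^ 2 := by
      ext t; rw [hdd]; ring
    rw [this, integral_const_mul, ch (fun t => (deriv φ t) ^ 2), hA0]
    field_simp
  have v3 : ∫ t, (η t) ^ 2 = ε⁻¹ * B0 := ch (fun t => (φ t) ^ 2)
  unfold QF
  rw [integral_add, integral_add, integral_const_mul, integral_const_mul, integral_const_mul,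
    v1, v2, v3]
  · have h1 : |K| * A0 * ε ^ 2 < κ * B0 := by
      rw [hε2, ← mul_div_assoc, div_lt_iff₀ (by positivity)]
      have : 0 < κ * B0 := by positivity
      nlinarith
    have h2 : K * A0 * ε ^ 2 ≤ |K| * A0 * ε ^ 2 := by
      gcongr; exact le_abs_self K
    have h3 : K * (ε * A0) + S * 0 + -κ * (ε⁻¹ * B0) = ε⁻¹ * (K * A0 * ε ^ 2 - κ * B0) := by
      field_simp; ring
    rw [h3]
    apply mul_neg_of_pos_of_neg (by positivity)
    linarith
  · exact i1.const_mul K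
  · exact i2.const_mul S
  · exact (i1.const_mul K).add (i2.const_mul S)
  · exact i3.const_mul (-κ)

theorem tail_neg {c1 c3 : ℝ → ℝ} (h1 : ContinuousOn c1 (Ioi 1)) (h3 : ContinuousOn c3 (Ioi 1))
    (s K κ S : ℝ) (hκ : 0 < κ) (tail : Set ℝ)
    (ht : ∀ L : ℝ, 0 < L → ∃ a, Icc (a - L) (a + L) ⊆ tail)
    (h : ∀ t ∈ tail, ∀ u w : ℝ, Real.exp t * (c1 (1 + Real.exp t) *
        (Real.exp (s * t) * (w + s * u) / Real.exp t) ^ 2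
      + c3 (1 + Real.exp t) * (Real.exp (s * t) * u) ^ 2) ≤ K * w ^ 2 + S * (u * w) + -κ * u ^ 2) :
    ∃ f, IsT f ∧ QF c1 (fun _ => 0) c3 f < 0 := by
  obtain ⟨η, e1, e2, e3, e4⟩ := exists_eta K κ S hκ tail ht
  set f : ℝ → ℝ := fun r => if 1 < r then Real.exp (s * Real.log (r - 1)) * η (Real.log (r - 1))
    else 0 with hf
  have hK : IsCompact ((fun t => 1 + Real.exp t) '' tsupport η) :=
    e2.isCompact.image (by fun_prop)
  have hsup : tsupport f ⊆ (fun t => 1 + Real.exp t) '' tsupport η := by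
    apply closure_minimal _ hK.isClosed
    intro r hr
    have hr' : f r ≠ 0 := hr
    simp only [hf] at hr'
    split_ifs at hr' with h0
    · refine ⟨Real.log (r - 1), subset_tsupport _ (right_ne_zero_of_mul hr'), ?_⟩
      simp only
      rw [Real.exp_log (by linarith)]; ring
    · exact absurd rfl hr'
  have hsup1 : tsupport f ⊆ Ioi 1 := by
    intro r hr
    obtain ⟨t, _, rfl⟩ := hsup hr
    simp [Real.exp_pos]
  have hloc : ∀ r, 1 < r → f =ᶠ[nhds r]
      fun r => Real.exp (s * Real.log (r - 1)) * η (Real.log (r - 1)) := by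
    intro r hr
    filter_upwards [Ioi_mem_nhds hr] with y hy
    simp only [hf]
    rw [if_pos (show 1 < y from hy)]
  have hfT : IsT f := by
    refine ⟨contDiff_of_tsupport' ?_, HasCompactSupport.of_support_subset_isCompact hK
      ((subset_tsupport _).trans hsup), hsup1⟩
    intro r hr
    have hr1 : 1 < r := hsup1 hr
    refine ContDiffAt.congr_of_eventuallyEq ?_ (hloc r hr1)
    have hl : ContDiffAt ℝ (⊤ : ℕ∞) (fun r => Real.log (r - 1)) r :=
      ContDiffAt.log (by fun_prop) (by linarith)
    exact ((contDiffAt_const.mul hl).exp).mul (e1.contDiffAt.comp r hl)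
  have hder : ∀ t, deriv f (1 + Real.exp t) =
      Real.exp (s * t) * (deriv η t + s * η t) / Real.exp t := by
    intro t
    have hr1 : 1 < 1 + Real.exp t := by linarith [Real.exp_pos t]
    rw [(hloc _ hr1).deriv_eq]
    have hl : HasDerivAt (fun r => Real.log (r - 1)) (1 / Real.exp t) (1 + Real.exp t) := by
      have := ((hasDerivAt_id (1 + Real.exp t)).sub_const 1).log (by simp [Real.exp_ne_zero])
      simpa using this
    have hv : Real.log (1 + Real.exp t - 1) = t := by simp
    have hη : HasDerivAt η (deriv η t) (Real.log (1 + Real.exp t - 1)) := by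
      rw [hv]; exact (e1.differentiable (by simp) _).hasDerivAt
    have := ((hl.const_mul s).exp).mul (hη.comp (1 + Real.exp t) hl)
    have h2 := this.deriv
    simp only [Function.comp_apply, hv] at h2
    refine Eq.trans h2 ?_
    ring
  refine ⟨f, hfT, ?_⟩
  have hfv : ∀ t, f (1 + Real.exp t) = Real.exp (s * t) * η t := by
    intro t
    simp only [hf]
    rw [if_pos (by linarith [Real.exp_pos t])]
    simp
  have hint := quad_integrable hfT.smooth hfT.comp hfT.supp h1 (c2 := fun _ => 0)
    continuousOn_const h3
  have hsp := quad_supp hfT.supp (c1 := c1) (c2 := fun _ => 0) (c3 := c3)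
  unfold QF
  rw [← hsp]
  set G : ℝ → ℝ := fun r => c1 r * (deriv f r) ^ 2 + 0 * (f r * deriv f r) + c3 r * (f r) ^ 2
    with hG
  have him : (fun t => 1 + Real.exp t) '' univ = Ioi 1 := by
    ext r
    simp only [image_univ, mem_range, mem_Ioi]
    constructor
    · rintro ⟨t, rfl⟩; linarith [Real.exp_pos t]
    · intro hr
      exact ⟨Real.log (r - 1), by rw [Real.exp_log (by linarith)]; ring⟩
  have hinj : InjOn (fun t => 1 + Real.exp t) univ := by
    intro x _ y _ hxy
    simpa using hxy
  have hd : ∀ t ∈ (univ : Set ℝ), HasDerivWithinAt (fun t => 1 + Real.exp t) (Real.exp t) univ t := by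
    intro t _
    exact ((Real.hasDerivAt_exp t).const_add 1).hasDerivWithinAt
  have ecv := integral_image_eq_integral_abs_deriv_smul MeasurableSet.univ hd hinj G
  have icv := (integrableOn_image_iff_integrableOn_abs_deriv_smul MeasurableSet.univ hd hinj G).1
    (hint.integrableOn)
  rw [him] at ecv
  rw [ecv]
  rw [setIntegral_univ]
  rw [integrableOn_univ] at icv
  refine lt_of_le_of_lt ?_ e4
  unfold QF
  apply integral_mono icv
  · exact quad_integrable e1 e2 (subset_univ _) continuousOn_const continuousOn_const
      continuousOn_const
  · intro t
    simp only [hG, smul_eq_mul, abs_of_pos (Real.exp_pos t), hder, hfv]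
    by_cases hmem : t ∈ tsupport η
    · have := h t (e3 hmem) (η t) (deriv η t)
      rw [zero_mul, add_zero]
      exact this
    · obtain ⟨z1, z2⟩ := ts_zero hmem
      simp [z1, z2]


theorem F2 (l b q E m : ℝ) (hl : 0 < l) (hE0 : 0 ≤ E) (hE : E < 1 + 3 * l) (hP : Pos l b q E m) :
    0 ≤ m := by
  by_contra hm
  push Not at hm
  have hM : 0 < nn l E 2 := nn_pos hl hE (by norm_num)
  set Mb := nn l E 2 with hMb
  set τ := min 1 (-m / (8 * Mb * (|b| + 1))) with hτ
  have hτ0 : 0 < τ := by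
    apply lt_min one_pos
    apply div_pos (by linarith)
    positivity
  have hτ1 : τ ≤ 1 := min_le_left _ _
  have hτ2 : 4 * |b| * τ ≤ -m / (2 * Mb) := by
    have h1 : τ ≤ -m / (8 * Mb * (|b| + 1)) := min_le_right _ _
    rw [le_div_iff₀ (by positivity)] at h1 ⊢
    have : 0 ≤ τ * Mb := by positivity
    nlinarith [abs_nonneg b]
  obtain ⟨f, hf, hneg⟩ := tail_neg (c1 := pp l E) (c3 := cc l b q E m)
    (pp_cont l E).continuousOn (cc_cont hl hE) 0 Mb (-m / (2 * Mb)) 0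
    (by apply div_pos (by linarith); positivity) {t | Real.exp t ≤ τ} (by
      intro L hL
      refine ⟨Real.log τ - L, ?_⟩
      intro t ht
      have : t ≤ Real.log τ := by linarith [ht.2]
      calc Real.exp t ≤ Real.exp (Real.log τ) := Real.exp_le_exp.2 this
        _ = τ := Real.exp_log hτ0) (by
      intro t ht u w
      have ht' : Real.exp t ≤ τ := ht
      have hx : 0 < Real.exp t := Real.exp_pos t
      unfold cc pp
      have hr : 1 < 1 + Real.exp t := by linarith
      have hn := nn_pos hl hE hr
      have hnM : nn l E (1 + Real.exp t) ≤ Mb := by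
        rw [hMb]; unfold nn
        have : 1 + Real.exp t ≤ 2 := by linarith
        gcongr
      generalize nn l E (1 + Real.exp t) = n at *
      generalize Real.exp t = x at *
      have e : x * ((1 + x - 1) * n * (Real.exp (0 * t) * (w + 0 * u) / x) ^ 2 +
        ((-b - q ^ 2 * E * (1 + x - 1) / n) * (1 + x) ^ 2 + m * (1 + x) ^ 4 / ((1 + x - 1) * n)) *
          (Real.exp (0 * t) * u) ^ 2) = n * w ^ 2 + (-b * (1 + x) ^ 2 * x
            - q ^ 2 * E * x ^ 2 * (1 + x) ^ 2 / n + m * (1 + x) ^ 4 / n) * u ^ 2 := by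
        simp only [zero_mul, Real.exp_zero, one_mul, add_zero, add_sub_cancel_left]
        field_simp
      rw [e]
      have k1 : -b * (1 + x) ^ 2 * x ≤ 4 * |b| * τ := by
        have h1 : (1 + x) ^ 2 ≤ 4 := by nlinarith
        calc -b * (1 + x) ^ 2 * x ≤ |b| * (1 + x) ^ 2 * x := by gcongr; exact neg_le_abs b
          _ ≤ |b| * 4 * τ := by gcongr
          _ = _ := by ring
      have k2 : 0 ≤ q ^ 2 * E * x ^ 2 * (1 + x) ^ 2 / n := by positivity
      have k3 : m * (1 + x) ^ 4 / n ≤ m / Mb := by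
        rw [div_le_div_iff₀ hn hM]
        have : 1 ≤ (1 + x) ^ 4 := one_le_pow₀ (by linarith)
        have h2 : n ≤ (1 + x) ^ 4 * Mb := by nlinarith
        nlinarith
      have k4 : -b * (1 + x) ^ 2 * x
            - q ^ 2 * E * x ^ 2 * (1 + x) ^ 2 / n + m * (1 + x) ^ 4 / n ≤ -(-m / (2 * Mb)) := by
        have : m / Mb = -(-m / (2 * Mb)) - (-m / (2 * Mb)) := by field_simp; ring
        linarith
      have := mul_le_mul_of_nonneg_right k4 (sq_nonneg u)
      have := mul_le_mul_of_nonneg_right hnM (sq_nonneg w)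
      linarith)
  have := hP f hf
  unfold Q at this
  linarith

theorem F5pt {l b q E m c κ X x n s u w : ℝ} (hl : 0 < l) (hE0 : 0 ≤ E) (hE : E < 1 + 3 * l)
    (hb : 9 * l / 4 < b) (hm : 0 ≤ m) (hc : c = 2 + 13 * l) (hc0 : 0 < c)
    (hκ : κ = (b - 9 * l / 4) / 2) (hκ0 : 0 < κ) (hX1 : 1 ≤ X) (hXc : c ≤ X)
    (hXk : 9 / 2 * c + 16 * m / l ≤ κ * X) (ht' : X ≤ x) (hx : 0 < x) (hn : 0 < n)
    (hs : s ^ 2 = 1 / x ^ 3)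
    (hn' : n = 1 + 3 * l - E + (1 + 6 * l) * x + 4 * l * x ^ 2 + l * x ^ 3) :
    x * ((1 + x - 1) * n * (s * (w + -3 / 2 * u) / x) ^ 2 +
        ((-b - q ^ 2 * E * (1 + x - 1) / n) * (1 + x) ^ 2 + m * (1 + x) ^ 4 / ((1 + x - 1) * n)) *
          (s * u) ^ 2) ≤ (l + 2) * w ^ 2 + -3 * l * (u * w) + -κ * u ^ 2 := by
  have hx1 : 1 ≤ x := hX1.trans ht'
  have e : x * ((1 + x - 1) * n * (s * (w + -3 / 2 * u) / x) ^ 2 +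
    ((-b - q ^ 2 * E * (1 + x - 1) / n) * (1 + x) ^ 2 + m * (1 + x) ^ 4 / ((1 + x - 1) * n)) *
      (s * u) ^ 2) = n / x ^ 3 * (w - 3 / 2 * u) ^ 2
        + (-b * (1 + x) ^ 2 / x ^ 2
        - q ^ 2 * E * (1 + x) ^ 2 / (x * n) + m * (1 + x) ^ 4 / (x ^ 3 * n)) * u ^ 2 := by
    rw [div_pow, mul_pow, mul_pow, hs]
    simp only [add_sub_cancel_left]
    field_simp
    ring
  rw [e]
  have x12 : x ≤ x ^ 2 := le_self_pow₀ hx1 (by norm_num)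
  have x02 : 1 ≤ x ^ 2 := one_le_pow₀ hx1
  have k0 : n / x ^ 3 ≤ l + c / x := by
    rw [div_le_iff₀ (by positivity)]
    have : (l + c / x) * x ^ 3 = l * x ^ 3 + c * x ^ 2 := by field_simp
    rw [this, hn', hc]
    have : (1 + 6 * l) * x ≤ (1 + 6 * l) * x ^ 2 := by gcongr
    have : (1 + 3 * l) * 1 ≤ (1 + 3 * l) * x ^ 2 := by gcongr
    linarith
  have k1 : b ≤ b * (1 + x) ^ 2 / x ^ 2 := by
    rw [le_div_iff₀ (by positivity)]
    have : 0 < b := by linarith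
    apply mul_le_mul_of_nonneg_left _ this.le
    gcongr; linarith
  have k2 : 0 ≤ q ^ 2 * E * (1 + x) ^ 2 / (x * n) := by positivity
  have k3 : m * (1 + x) ^ 4 / (x ^ 3 * n) ≤ 16 * m / l / x := by
    rw [div_div, div_le_div_iff₀ (by positivity) (by positivity)]
    have h1 : (1 + x) ^ 4 ≤ 16 * x ^ 4 := by
      have : (1 + x) ^ 4 ≤ (2 * x) ^ 4 := by gcongr; linarith
      calc _ ≤ _ := this
        _ = _ := by ring
    have h2 : l * x ^ 3 ≤ n := by
      have : 0 ≤ (1 + 6 * l) * x + 4 * l * x ^ 2 := by positivity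
      rw [hn']; linarith
    have h3 : x ^ 4 ≤ x ^ 5 := pow_le_pow_right₀ hx1 (by norm_num)
    have h5 : x ^ 5 ≤ x ^ 6 := pow_le_pow_right₀ hx1 (by norm_num)
    calc m * (1 + x) ^ 4 * (l * x) ≤ m * (16 * x ^ 4) * (l * x) := by gcongr
      _ = 16 * m * l * x ^ 5 := by ring
      _ ≤ 16 * m * l * x ^ 6 := by gcongr
      _ = 16 * m * (x ^ 3 * (l * x ^ 3)) := by ring
      _ ≤ _ := by gcongr
  have k4 : c / x ≤ 1 := by rw [div_le_one (by linarith)]; linarith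
  have k5 : 9 / 2 * (c / x) + 16 * m / l / x ≤ κ := by
    have : 9 / 2 * (c / x) + 16 * m / l / x = (9 / 2 * c + 16 * m / l) / x := by ring
    rw [this, div_le_iff₀ hx]
    linarith [mul_le_mul_of_nonneg_left ht' hκ0.le]
  have k6 : 0 ≤ c / x := by positivity
  have m1 : n / x ^ 3 * (w - 3 / 2 * u) ^ 2 ≤ (l + c / x) * (w - 3 / 2 * u) ^ 2 := by gcongr
  have m2 : (-b * (1 + x) ^ 2 / x ^ 2
        - q ^ 2 * E * (1 + x) ^ 2 / (x * n) + m * (1 + x) ^ 4 / (x ^ 3 * n)) * u ^ 2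
       ≤ (-b + 16 * m / l / x) * u ^ 2 := by
    have : -b * (1 + x) ^ 2 / x ^ 2 = -(b * (1 + x) ^ 2 / x ^ 2) := by ring
    apply mul_le_mul_of_nonneg_right _ (sq_nonneg u)
    linarith
  have m3 : (c / x) * (w - 3 / 2 * u) ^ 2 ≤ (c / x) * (2 * w ^ 2 + 9 / 2 * u ^ 2) := by
    apply mul_le_mul_of_nonneg_left _ k6
    linarith [sq_nonneg (w + 3 / 2 * u)]
  have m4 : (c / x) * (2 * w ^ 2) ≤ 1 * (2 * w ^ 2) := by gcongr
  have m5 := mul_le_mul_of_nonneg_right k5 (sq_nonneg u)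
  have hbk : b = 9 * l / 4 + 2 * κ := by rw [hκ]; ring
  calc _ ≤ (l + c / x) * (w - 3 / 2 * u) ^ 2 + (-b + 16 * m / l / x) * u ^ 2 := add_le_add m1 m2
    _ ≤ _ := by rw [hbk]; linarith

theorem F5 (l b q E m : ℝ) (hl : 0 < l) (hE0 : 0 ≤ E) (hE : E < 1 + 3 * l) (hb : 9 * l / 4 < b)
    (hm : 0 ≤ m) : ¬ Pos l b q E m := by
  intro hP
  set c := 2 + 13 * l with hc
  have hc0 : 0 < c := by positivity
  set κ := (b - 9 * l / 4) / 2 with hκ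
  have hκ0 : 0 < κ := by rw [hκ]; linarith
  set X := c + (9 / 2 * c + 16 * m / l) / κ + 1 with hX
  have hX1 : 1 ≤ X := by
    have : 0 ≤ (9 / 2 * c + 16 * m / l) / κ := by positivity
    linarith
  have hXc : c ≤ X := by
    have : 0 ≤ (9 / 2 * c + 16 * m / l) / κ := by positivity
    linarith
  have hXk : 9 / 2 * c + 16 * m / l ≤ κ * X := by
    have : κ * X = 9 / 2 * c + 16 * m / l + κ * (c + 1) := by rw [hX]; field_simp; ring
    have : 0 ≤ κ * (c + 1) := by positivity
    linarith
  obtain ⟨f, hf, hneg⟩ := tail_neg (c1 := pp l E) (c3 := cc l b q E m)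
    (pp_cont l E).continuousOn (cc_cont hl hE) (-3 / 2) (l + 2) κ (-3 * l) hκ0
    {t | X ≤ Real.exp t} (by
      intro L hL
      refine ⟨Real.log X + L, ?_⟩
      intro t ht
      have : Real.log X ≤ t := by linarith [ht.1]
      calc X = Real.exp (Real.log X) := (Real.exp_log (by linarith)).symm
        _ ≤ Real.exp t := Real.exp_le_exp.2 this) (by
      intro t ht u w
      have ht' : X ≤ Real.exp t := ht
      have hx : 0 < Real.exp t := Real.exp_pos t
      have hs : Real.exp (-3 / 2 * t) ^ 2 = 1 / Real.exp t ^ 3 := by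
        rw [← Real.exp_nat_mul, ← Real.exp_nat_mul, one_div, ← Real.exp_neg]
        congr 1; push_cast; ring
      unfold cc pp
      have hr : 1 < 1 + Real.exp t := by linarith
      have hn := nn_pos hl hE hr
      have hn' : nn l E (1 + Real.exp t) = 1 + 3 * l - E + (1 + 6 * l) * Real.exp t
        + 4 * l * Real.exp t ^ 2 + l * Real.exp t ^ 3 := by unfold nn; ring
      exact F5pt hl hE0 hE hb hm hc hc0 hκ hκ0 hX1 hXc hXk ht' hx hn hs hn')
  have := hP f hf
  unfold Q at this
  linarith


noncomputable def aF (l b m : ℝ) (v : ℝ → ℝ) : ℝ :=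
  QF (fun r => (r - 1) * nn l 0 r ^ 2) (fun r => (r - 1) * nn l 0 r * nd l r)
    (fun r => (r - 1) * nd l r ^ 2 / 4 - b * nn l 0 r * r ^ 2 + m * r ^ 4 / (r - 1)) v
noncomputable def bF (l b q : ℝ) (v : ℝ → ℝ) : ℝ :=
  QF (fun r => -2 * (r - 1) * nn l 0 r) (fun r => -(r - 1) * nd l r)
    (fun r => (b - q ^ 2 * (r - 1)) * r ^ 2) v
noncomputable def cF (v : ℝ → ℝ) : ℝ := QF (fun r => r - 1) (fun _ => 0) (fun _ => 0) v

theorem aF_c3 (l b m : ℝ) : ContinuousOn (fun r => (r - 1) * nd l r ^ 2 / 4 - b * nn l 0 r * r ^ 2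
    + m * r ^ 4 / (r - 1)) (Ioi 1) := by
  have n1c := (nn_cont l 0).continuousOn (s := Ioi (1:ℝ))
  have ndc := (nd_cont l).continuousOn (s := Ioi (1:ℝ))
  have h0 : ∀ r ∈ Ioi (1:ℝ), r - 1 ≠ 0 := fun r hr => by
    have : 1 < r := hr
    linarith
  fun_prop (disch := assumption)

theorem Qpoly {l b q E m : ℝ} (hl : 0 < l) (hE : E < 1 + 3 * l) {v : ℝ → ℝ} (hv : IsT v) :
    Q l b q E m (fun r => Real.sqrt (nn l E r) * v r) = aF l b m v + E * bF l b q v + E ^ 2 * cF v := by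
  have hn : ∀ r, 1 < r → 0 < nn l E r := fun r hr => nn_pos hl hE hr
  have hd : ∀ r, 1 < r → HasDerivAt (fun r => Real.sqrt (nn l E r))
      (nd l r / (2 * Real.sqrt (nn l E r))) r := fun r hr => (nn_deriv' l E r).sqrt (hn r hr).ne'
  unfold Q
  rw [QF_mul hv hd]
  have n1c := (nn_cont l 0).continuousOn (s := Ioi (1:ℝ))
  have ndc := (nd_cont l).continuousOn (s := Ioi (1:ℝ))
  have h1 := QF_comb hv (c1 := fun r => (r - 1) * nn l 0 r ^ 2)
    (c2 := fun r => (r - 1) * nn l 0 r * nd l r)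
    (d1 := fun r => -2 * (r - 1) * nn l 0 r) (d2 := fun r => -(r - 1) * nd l r)
    (d3 := fun r => (b - q ^ 2 * (r - 1)) * r ^ 2)
    (by fun_prop) (by fun_prop) (aF_c3 l b m) (by fun_prop) (by fun_prop) (by fun_prop) 1 E
  have a3 := aF_c3 l b m
  have h2 := QF_comb hv
    (c1 := fun r => 1 * ((r - 1) * nn l 0 r ^ 2) + E * (-2 * (r - 1) * nn l 0 r))
    (c2 := fun r => 1 * ((r - 1) * nn l 0 r * nd l r) + E * (-(r - 1) * nd l r))
    (c3 := fun r => 1 * ((r - 1) * nd l r ^ 2 / 4 - b * nn l 0 r * r ^ 2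
    + m * r ^ 4 / (r - 1)) + E * ((b - q ^ 2 * (r - 1)) * r ^ 2))
    (d1 := fun r => r - 1) (d2 := fun _ => 0) (d3 := fun _ => 0)
    (by fun_prop) (by fun_prop) (by fun_prop) (by fun_prop) (by fun_prop) (by fun_prop) 1 (E ^ 2)
  rw [h1] at h2
  rw [one_mul, one_mul] at h2
  unfold aF bF cF
  rw [← h2]
  apply QF_congr
  intro r hr
  have hr1 : 1 < r := hv.supp hr
  have hx : 0 < r - 1 := by linarith
  have e3 := hn r hr1
  have e0 := Real.sqrt_pos.2 e3
  have e1 := Real.sq_sqrt e3.le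
  have eN : nn l 0 r = nn l E r + E := by unfold nn; ring
  set s := Real.sqrt (nn l E r) with hs
  have t1 : pp l E r * s ^ 2 = 1 * (1 * ((r - 1) * nn l 0 r ^ 2) + E * (-2 * (r - 1) * nn l 0 r))
      + E ^ 2 * (r - 1) := by
    rw [e1, eN]; unfold pp; ring
  have t2 : 2 * pp l E r * s * (nd l r / (2 * s)) + 0 * s ^ 2
     = 1 * (1 * ((r - 1) * nn l 0 r * nd l r) + E * (-(r - 1) * nd l r)) + E ^ 2 * 0 := by
    rw [eN]; unfold pp; field_simp; ring
  have t3 : pp l E r * (nd l r / (2 * s)) ^ 2 + 0 * s * (nd l r / (2 * s)) + cc l b q E m r * s ^ 2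
     = 1 * (1 * ((r - 1) * nd l r ^ 2 / 4 - b * nn l 0 r * r ^ 2
    + m * r ^ 4 / (r - 1)) + E * ((b - q ^ 2 * (r - 1)) * r ^ 2)) + E ^ 2 * 0 := by
    rw [div_pow, mul_pow, e1, eN]; unfold cc pp; field_simp; ring
  rw [t1, t2, t3]

theorem pos_iff_poly {l b q E m : ℝ} (hl : 0 < l) (hE : E < 1 + 3 * l) :
    Pos l b q E m ↔ ∀ v, IsT v → 0 ≤ aF l b m v + E * bF l b q v + E ^ 2 * cF v := by
  have hn : ∀ r, 1 < r → 0 < nn l E r := fun r hr => nn_pos hl hE hr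
  have hs : ∀ r, 1 < r → ContDiffAt ℝ (⊤ : ℕ∞) (fun r => Real.sqrt (nn l E r)) r := fun r hr =>
    (nn_contDiff l E).contDiffAt.sqrt (hn r hr).ne'
  constructor
  · intro h v hv
    rw [← Qpoly hl hE hv]
    exact h _ (hv.mul hs)
  · intro h f hf
    have hv : IsT (fun r => (Real.sqrt (nn l E r))⁻¹ * f r) := hf.mul (fun r hr =>
      (hs r hr).inv (Real.sqrt_pos.2 (hn r hr)).ne')
    have := h _ hv
    rw [← Qpoly hl hE hv] at this
    have e : (fun r => Real.sqrt (nn l E r) * ((Real.sqrt (nn l E r))⁻¹ * f r)) = f := by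
      ext r
      by_cases hr : r ∈ tsupport f
      · have := (Real.sqrt_pos.2 (hn r (hf.supp hr))).ne'
        field_simp
      · rw [(ts_zero hr).1]; simp
    rwa [e] at this

theorem cF_nonneg {v : ℝ → ℝ} (hv : IsT v) : 0 ≤ cF v := by
  unfold cF QF
  apply integral_nonneg
  intro r
  by_cases hr : r ∈ tsupport v
  · have : 1 < r := hv.supp hr
    have : 0 ≤ r - 1 := by linarith
    simp only [Pi.zero_apply]
    nlinarith [mul_nonneg this (sq_nonneg (deriv v r))]
  · simp [ts_zero hr]

theorem caseA_of {l b q E1 E2 m : ℝ} (hl : 0 < l) (h0 : 0 ≤ E2) (h21 : E2 < E1) (hE1 : E1 < 1 + 3 * l)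
    (hP : Pos l b q E1 m)
    (ha : ∀ v, IsT v → (1 + 3 * l) ^ 2 * cF v ≤ aF l b m v) : Pos l b q E2 m := by
  rw [pos_iff_poly hl hE1] at hP
  rw [pos_iff_poly hl (h21.trans hE1)]
  intro v hv
  have h1 := hP v hv
  have h2 := ha v hv
  have h3 := cF_nonneg hv
  have hE10 : 0 < E1 := by linarith
  -- E1 * φ(E2) = E2 φ(E1) + (E1 - E2) (a - c E1 E2)
  have h4 : E1 * E2 * cF v ≤ (1 + 3 * l) ^ 2 * cF v := by
    apply mul_le_mul_of_nonneg_right _ h3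
    rw [sq]
    apply mul_le_mul <;> linarith
  have h5 : 0 ≤ (E1 - E2) * (aF l b m v - E1 * E2 * cF v) := mul_nonneg (by linarith) (by linarith)
  have h6 := mul_nonneg h0 h1
  have h7 : 0 ≤ E1 * (aF l b m v + E2 * bF l b q v + E2 ^ 2 * cF v) := by
    have : E1 * (aF l b m v + E2 * bF l b q v + E2 ^ 2 * cF v)
      = E2 * (aF l b m v + E1 * bF l b q v + E1 ^ 2 * cF v)
        + (E1 - E2) * (aF l b m v - E1 * E2 * cF v) := by ring
    rw [this]; linarith
  exact nonneg_of_mul_nonneg_right h7 hE10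

/-- limit to `E2 = 0` -/
theorem pos_zero_of {l b q E1 m : ℝ} (hl : 0 < l) (hE0 : 0 < E1) (hE1 : E1 < 1 + 3 * l)
    (h : ∀ E, 0 < E → E < E1 → Pos l b q E m) : Pos l b q 0 m := by
  rw [pos_iff_poly hl (by linarith)]
  intro v hv
  have hc : Filter.Tendsto (fun E : ℝ => aF l b m v + E * bF l b q v + E ^ 2 * cF v)
      (nhdsWithin 0 (Ioi 0)) (nhds (aF l b m v + 0 * bF l b q v + 0 ^ 2 * cF v)) := by
    have : Continuous (fun E : ℝ => aF l b m v + E * bF l b q v + E ^ 2 * cF v) := by fun_prop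
    exact (this.tendsto 0).mono_left nhdsWithin_le_nhds
  refine ge_of_tendsto hc ?_
  filter_upwards [Ioo_mem_nhdsGT hE0] with E hE
  exact (pos_iff_poly hl (by linarith [hE.2])).1 (h E hE.1 hE.2) v hv


theorem quad_complete {A B C u w : ℝ} (hA : 0 < A) (h : 0 ≤ C - B ^ 2 / A) :
    0 ≤ A * w ^ 2 + 2 * B * (u * w) + C * u ^ 2 := by
  have : A * w ^ 2 + 2 * B * (u * w) + C * u ^ 2 = A * (w + B / A * u) ^ 2
      + (C - B ^ 2 / A) * u ^ 2 := by field_simp; ring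
  rw [this]; positivity

theorem cert_num {l x : ℝ} (hl : 0 < l) (hx : 0 < x) :
    0 ≤ 2 * l * (1 + 3 * l) * ((1 + 6 * l) * (1 + x) + l * x ^ 2) * (x + 2 * l) ^ 2
        * (2 * (1 + 3 * l) + x * (1 + 6 * l + 4 * l * x + l * x ^ 2))
      - 9 / 4 * l * (1 + x) ^ 2 * ((1 + 6 * l + 4 * l * x + l * x ^ 2) * (x + 2 * l) + (1 + 3 * l))
        * (1 + 6 * l + 4 * l * x + l * x ^ 2) * (x + 2 * l)
        * (2 * (1 + 3 * l) + x * (1 + 6 * l + 4 * l * x + l * x ^ 2))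
      - (1 + 3 * l) ^ 2 * (2 * l) ^ 2 * (1 + 6 * l + 4 * l * x + l * x ^ 2)
        * (2 * (1 + 3 * l) + x * (1 + 6 * l + 4 * l * x + l * x ^ 2))
      + (9 / 2 * l * x ^ 2 + 9 * l * x + (1 + 3 * l)) * (1 + 6 * l + 4 * l * x + l * x ^ 2) ^ 2
        * (x + 2 * l) ^ 2 * (2 * (1 + 3 * l) + x * (1 + 6 * l + 4 * l * x + l * x ^ 2))
      + 5 / 2 * l * (2 * l) * (1 + 6 * l + 4 * l * x + l * x ^ 2) ^ 2
        * (2 * (1 + 3 * l) + x * (1 + 6 * l + 4 * l * x + l * x ^ 2))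
      - x * ((3 / 2 * l * x ^ 2 + 9 / 2 * l * x + (1 + 3 * l)) * (x + 2 * l) + 5 / 2 * l) ^ 2
        * (1 + 6 * l + 4 * l * x + l * x ^ 2) ^ 2 := by
  ring_nf
  positivity

theorem cert {l x n P E d : ℝ} (hl : 0 < l) (hx : 0 < x) (hE : E = 1 + 3 * l) (hd : d = 2 * l)
    (hn : n = 1 + 6 * l + 4 * l * x + l * x ^ 2) (hP : P = 2 * E + x * n) :
    0 ≤ 2 * l * E * ((1 + 6 * l) * (1 + x) + l * x ^ 2) / n ^ 2
      - 9 / 4 * l * (1 + x) ^ 2 * (1 + E / (n * (x + d))) - E ^ 2 * d ^ 2 / (n * (x + d) ^ 2)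
      + (9 / 2 * l * x ^ 2 + 9 * l * x + E + 5 / 2 * l * d / (x + d) ^ 2)
      - (x * (3 / 2 * l * x ^ 2 + 9 / 2 * l * x + E + 5 / 2 * l / (x + d))) ^ 2 / (x * P) := by
  have hE0 : 0 < E := by rw [hE]; positivity
  have hd0 : 0 < d := by rw [hd]; positivity
  have hn0 : 0 < n := by rw [hn]; positivity
  have hP0 : 0 < P := by rw [hP]; positivity
  have hD : 0 < x + d := by positivity
  obtain ⟨D, hDe⟩ : ∃ D, D = x + d := ⟨_, rfl⟩
  rw [← hDe] at hD ⊢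
  have : 2 * l * E * ((1 + 6 * l) * (1 + x) + l * x ^ 2) / n ^ 2
      - 9 / 4 * l * (1 + x) ^ 2 * (1 + E / (n * D)) - E ^ 2 * d ^ 2 / (n * D ^ 2)
      + (9 / 2 * l * x ^ 2 + 9 * l * x + E + 5 / 2 * l * d / D ^ 2)
      - (x * (3 / 2 * l * x ^ 2 + 9 / 2 * l * x + E + 5 / 2 * l / D)) ^ 2 / (x * P)
    = (2 * l * E * ((1 + 6 * l) * (1 + x) + l * x ^ 2) * D ^ 2 * P
      - 9 / 4 * l * (1 + x) ^ 2 * (n * D + E) * n * D * P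
      - E ^ 2 * d ^ 2 * n * P
      + (9 / 2 * l * x ^ 2 + 9 * l * x + E) * n ^ 2 * D ^ 2 * P
      + 5 / 2 * l * d * n ^ 2 * P
      - x * ((3 / 2 * l * x ^ 2 + 9 / 2 * l * x + E) * D + 5 / 2 * l) ^ 2 * n ^ 2)
        / (n ^ 2 * D ^ 2 * P) := by
    field_simp
    ring
  rw [this]
  apply div_nonneg _ (by positivity)
  rw [hDe, hP, hn, hd, hE]
  exact cert_num hl hx

/-- `V ≥ V_low` -/
theorem Vlow {l x n E d b m : ℝ} (hl : 0 < l) (hx : 0 < x) (hE0 : 0 < E) (hd : 0 < d) (hn0 : 0 < n)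
    (hb0 : 0 < b) (hb : b ≤ 9 / 4 * l) (hm : b ^ 2 / 4 ≤ m) :
    - (9 / 4 * l * (1 + x) ^ 2 * (1 + E / (n * (x + d)))) - E ^ 2 * d ^ 2 / (n * (x + d) ^ 2)
    ≤ - b * (1 + x) ^ 2 * (E + x * n) / (x * n) + m * (1 + x) ^ 4 / (x ^ 2 * n) := by
  have hD : 0 < x + d := by positivity
  obtain ⟨D, hDe⟩ : ∃ D, D = x + d := ⟨_, rfl⟩
  rw [← hDe] at hD ⊢
  have h1 : b * (1 + x) ^ 2 * (1 + E / (n * D)) ≤ 9 / 4 * l * (1 + x) ^ 2 * (1 + E / (n * D)) := by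
    gcongr
  have h2 : b ^ 2 / 4 * (1 + x) ^ 4 / (x ^ 2 * n) ≤ m * (1 + x) ^ 4 / (x ^ 2 * n) := by gcongr
  have h3 : - b * (1 + x) ^ 2 * (E + x * n) / (x * n) + b ^ 2 / 4 * (1 + x) ^ 4 / (x ^ 2 * n)
    - (- (b * (1 + x) ^ 2 * (1 + E / (n * D))) - E ^ 2 * d ^ 2 / (n * D ^ 2))
    = (b * (1 + x) ^ 2 / (2 * x) - E * d / D) ^ 2 / n := by
    have : d = D - x := by linarith
    rw [this]
    field_simp
    ring
  have h4 : 0 ≤ (b * (1 + x) ^ 2 / (2 * x) - E * d / D) ^ 2 / n := by positivity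
  linarith

/-- the algebraic identity -/
theorem caseA_id {l b m x n N P nd' ψ ψ' E : ℝ} (hl : 0 < l) (hx : 0 < x) (hE : E = 1 + 3 * l)
    (hn : n = 1 + 6 * l + 4 * l * x + l * x ^ 2) (hN : N = E + x * n) (hP : P = 2 * E + x * n)
    (hnd : nd' = 1 + 6 * l + 8 * l * x + 3 * l * x ^ 2) :
    x * nd' ^ 2 / 4 - b * N * (1 + x) ^ 2 + m * (1 + x) ^ 4 / x
      + ((1 + 6 * l + 8 * l * x + 3 * l * x ^ 2) * ψ + x * n * ψ' + E * (nd' + x * (8 * l + 6 * l * x)) / 2)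
      - (x * N * nd' / 2 + (x * n * ψ + E * x * nd' / 2)) ^ 2 / (x * (N ^ 2 - E ^ 2))
    = x * n * (2 * l * E * ((1 + 6 * l) * (1 + x) + l * x ^ 2) / n ^ 2
      + (- b * (1 + x) ^ 2 * (E + x * n) / (x * n) + m * (1 + x) ^ 4 / (x ^ 2 * n)) + ψ'
        - ψ ^ 2 / (x * P)) := by
  have hE0 : 0 < E := by rw [hE]; positivity
  have hn0 : 0 < n := by rw [hn]; positivity
  have hP0 : 0 < P := by rw [hP]; positivity
  have e1 : N ^ 2 - E ^ 2 = x * n * P := by rw [hN, hP]; ring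
  have e2 : x * N * nd' / 2 + (x * n * ψ + E * x * nd' / 2) = x * (nd' * P / 2 + n * ψ) := by
    rw [hN, hP]; ring
  have e3 : (x * (nd' * P / 2 + n * ψ)) ^ 2 / (x * (x * n * P)) = 
    nd' ^ 2 * P / (4 * n) + nd' * ψ + n * ψ ^ 2 / P := by field_simp; ring
  rw [e1, e2, e3, hN, ← hnd]
  have e4 : x * n * (2 * l * E * ((1 + 6 * l) * (1 + x) + l * x ^ 2) / n ^ 2
      + (- b * (1 + x) ^ 2 * (E + x * n) / (x * n) + m * (1 + x) ^ 4 / (x ^ 2 * n)) + ψ'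
        - ψ ^ 2 / (x * P)) = 2 * l * E * x * ((1 + 6 * l) * (1 + x) + l * x ^ 2) / n 
      - b * (1 + x) ^ 2 * (E + x * n) + m * (1 + x) ^ 4 / x + x * n * ψ' - n * ψ ^ 2 / P := by
    field_simp; ring
  rw [e4]
  have e5 : x * nd' ^ 2 / 4 - nd' ^ 2 * P / (4 * n) + E * (nd' + x * (8 * l + 6 * l * x)) / 2
    = 2 * l * E * x * ((1 + 6 * l) * (1 + x) + l * x ^ 2) / n := by
    rw [hP]
    field_simp
    rw [hnd, hn]
    ring
  rw [← e5]
  ring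

theorem caseA_form {l b m : ℝ} (hl : 0 < l) (ψ ψ' : ℝ → ℝ)
    (hψ : ∀ r, 1 < r → HasDerivAt ψ (ψ' r) r) (hψ' : ContinuousOn ψ' (Ioi 1))
    (h : ∀ x, 0 < x → 0 ≤ 2 * l * (1 + 3 * l) * ((1 + 6 * l) * (1 + x) + l * x ^ 2)
        / (1 + 6 * l + 4 * l * x + l * x ^ 2) ^ 2
      + (- b * (1 + x) ^ 2 * ((1 + 3 * l) + x * (1 + 6 * l + 4 * l * x + l * x ^ 2))
          / (x * (1 + 6 * l + 4 * l * x + l * x ^ 2))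
        + m * (1 + x) ^ 4 / (x ^ 2 * (1 + 6 * l + 4 * l * x + l * x ^ 2))) + ψ' (1 + x)
        - ψ (1 + x) ^ 2 / (x * (2 * (1 + 3 * l) + x * (1 + 6 * l + 4 * l * x + l * x ^ 2))))
    (v : ℝ → ℝ) (hv : IsT v) : (1 + 3 * l) ^ 2 * cF v ≤ aF l b m v := by
  have n1c := (nn_cont l 0).continuousOn (s := Ioi (1:ℝ))
  have ndc := (nd_cont l).continuousOn (s := Ioi (1:ℝ))
  have nec := (nn_cont l (1 + 3 * l)).continuousOn (s := Ioi (1:ℝ))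
  have a3 := aF_c3 l b m
  have hc := QF_comb hv (c1 := fun r => (r - 1) * nn l 0 r ^ 2)
    (c2 := fun r => (r - 1) * nn l 0 r * nd l r)
    (d1 := fun r => r - 1) (d2 := fun _ => 0) (d3 := fun _ => 0)
    (by fun_prop) (by fun_prop) a3 (by fun_prop) (by fun_prop) (by fun_prop) 1
    (-(1 + 3 * l) ^ 2)
  have hψc : ContinuousOn ψ (Ioi 1) := fun r hr => (hψ r hr).continuousAt.continuousWithinAt
  have hpos : 0 ≤ QF (fun r => 1 * ((r - 1) * nn l 0 r ^ 2) + -(1 + 3 * l) ^ 2 * (r - 1))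
     (fun r => 1 * ((r - 1) * nn l 0 r * nd l r) + -(1 + 3 * l) ^ 2 * 0)
     (fun r => 1 * ((r - 1) * nd l r ^ 2 / 4 - b * nn l 0 r * r ^ 2
    + m * r ^ 4 / (r - 1)) + -(1 + 3 * l) ^ 2 * 0) v := by
    refine QF_nonneg hv (Φ := fun r => nn l (1 + 3 * l) r * ψ r + (1 + 3 * l) / 2 * ((r - 1) * nd l r))
      (Φ' := fun r => (nd l r * ψ r + nn l (1 + 3 * l) r * ψ' r)
        + (1 + 3 * l) / 2 * (1 * nd l r + (r - 1) * (6 * l * r + 2 * l)))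
      (by fun_prop) (by fun_prop) (by fun_prop) ?_ (by fun_prop) ?_
    · intro r hr
      exact ((nn_deriv' l _ r).mul (hψ r hr)).add
        ((((hasDerivAt_id r).sub_const 1).mul (nd_deriv l r)).const_mul _)
    · intro r hr u w
      have hr1 : 1 < r := hr
      obtain ⟨x, rfl⟩ : ∃ x, r = 1 + x := ⟨r - 1, by ring⟩
      have hx : 0 < x := by linarith
      have hx' := h x hx
      obtain ⟨n, hn⟩ : ∃ n, n = 1 + 6 * l + 4 * l * x + l * x ^ 2 := ⟨_, rfl⟩
      have hn0 : 0 < n := by rw [hn]; positivity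
      obtain ⟨E, hE⟩ : ∃ E, E = 1 + 3 * l := ⟨_, rfl⟩
      have hE0 : 0 < E := by rw [hE]; positivity
      have e1 : nn l (1 + 3 * l) (1 + x) = x * n := by rw [hn]; unfold nn; ring
      have e2 : nn l 0 (1 + x) = E + x * n := by rw [hn, hE]; unfold nn; ring
      have e3 : nd l (1 + x) = 1 + 6 * l + 8 * l * x + 3 * l * x ^ 2 := by unfold nd; ring
      have id1 := caseA_id (b := b) (m := m) (ψ := ψ (1 + x)) (ψ' := ψ' (1 + x)) hl hx hE hn rfl
        rfl rfl
      rw [← hn, ← hE] at hx'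
      have hA : 0 < x * ((E + x * n) ^ 2 - E ^ 2) := by
        have : (E + x * n) ^ 2 - E ^ 2 = x * n * (2 * E + x * n) := by ring
        rw [this]; positivity
      have key := quad_complete (u := u) (w := w) hA (by
        rw [id1]
        exact mul_nonneg (by positivity) hx')
      rw [e1, e2, e3, ← hE]
      refine key.trans_eq ?_
      rw [show (1:ℝ) + x - 1 = x by ring]
      ring
  rw [hc] at hpos
  unfold aF cF
  linarith

theorem caseA_neg {l b m : ℝ} (hl : 0 < l) (hb : b ≤ 0) (hm : 0 ≤ m) (v : ℝ → ℝ) (hv : IsT v) :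
    (1 + 3 * l) ^ 2 * cF v ≤ aF l b m v := by
  refine caseA_form hl (fun _ => 0) (fun _ => 0) (fun r _ => hasDerivAt_const r 0)
    continuousOn_const ?_ v hv
  intro x hx
  have hb' : 0 ≤ -b := by linarith
  obtain ⟨c, rfl⟩ : ∃ c, b = -c := ⟨-b, by ring⟩
  rw [neg_neg] at hb' ⊢
  simp only [ne_eq, OfNat.ofNat_ne_zero, not_false_eq_true, zero_pow, zero_div, sub_zero, add_zero]
  positivity

theorem caseA_pos {l b m : ℝ} (hl : 0 < l) (hb0 : 0 < b) (hb : b ≤ 9 / 4 * l) (hm : b ^ 2 / 4 ≤ m)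
    (v : ℝ → ℝ) (hv : IsT v) :
    (1 + 3 * l) ^ 2 * cF v ≤ aF l b m v := by
  have hD : ∀ r : ℝ, 1 < r → r - 1 + 2 * l ≠ 0 := fun r hr => by
    have : 0 < r - 1 := by linarith
    positivity
  refine caseA_form hl (fun r => 3 / 2 * l * (r - 1) ^ 3 + 9 / 2 * l * (r - 1) ^ 2
      + (1 + 3 * l) * (r - 1) + 5 / 2 * l * ((r - 1) / (r - 1 + 2 * l)))
    (fun r => 9 / 2 * l * (r - 1) ^ 2 + 9 * l * (r - 1) + (1 + 3 * l)
      + 5 / 2 * l * (2 * l) / (r - 1 + 2 * l) ^ 2) ?_ ?_ ?_ v hv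
  · intro r hr
    have h1 := (hasDerivAt_id r).sub_const 1
    have := ((((h1.pow 3).const_mul (3 / 2 * l)).add ((h1.pow 2).const_mul (9 / 2 * l))).add
      (h1.const_mul (1 + 3 * l))).add ((h1.div (h1.add_const (2 * l)) (hD r hr)).const_mul (5 / 2 * l))
    refine this.congr_deriv ?_
    simp
    ring
  · have : ∀ r ∈ Ioi (1:ℝ), (r - 1 + 2 * l) ^ 2 ≠ 0 := fun r hr => pow_ne_zero 2 (hD r hr)
    fun_prop (disch := assumption)
  · intro x hx
    have k1 := cert hl hx rfl rfl rfl rfl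
    have k2 := Vlow (x := x) (n := 1 + 6 * l + 4 * l * x + l * x ^ 2) (E := 1 + 3 * l) (d := 2 * l)
      hl hx (by positivity) (by positivity) (by positivity) hb0 hb hm
    have e : 3 / 2 * l * (1 + x - 1) ^ 3 + 9 / 2 * l * (1 + x - 1) ^ 2
      + (1 + 3 * l) * (1 + x - 1) + 5 / 2 * l * ((1 + x - 1) / (1 + x - 1 + 2 * l))
      = x * (3 / 2 * l * x ^ 2 + 9 / 2 * l * x + (1 + 3 * l) + 5 / 2 * l / (x + 2 * l)) := by
      rw [show (1:ℝ) + x - 1 = x by ring]; ring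
    rw [e, show (1:ℝ) + x - 1 = x by ring]
    linarith


theorem ode_theta {α β : ℝ → ℝ} {A B t0 : ℝ} (ht0 : t0 ∈ Ioo A B)
    (hα : ContinuousOn α (Icc A B)) (hβ : ContinuousOn β (Icc A B)) :
    ∃ θ : ℝ → ℝ, θ t0 = 0 ∧ ∀ t ∈ Ioo A B,
      HasDerivAt θ (α t * Real.cos (θ t) ^ 2 - β t * Real.sin (θ t) ^ 2) t := by
  obtain ⟨M1, hM1⟩ := isCompact_Icc.exists_bound_of_continuousOn hα
  obtain ⟨M2, hM2⟩ := isCompact_Icc.exists_bound_of_continuousOn hβ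
  set M := max M1 (max M2 0) with hM
  have h1 : ∀ t ∈ Icc A B, |α t| ≤ M := fun t ht => (hM1 t ht).trans (le_max_left _ _)
  have h2 : ∀ t ∈ Icc A B, |β t| ≤ M := fun t ht => (hM2 t ht).trans
    ((le_max_left _ _).trans (le_max_right _ _))
  have hM0 : 0 ≤ M := (le_max_right _ _).trans (le_max_right _ _)
  have hAB : 0 ≤ B - A := by linarith [ht0.1, ht0.2]
  have hP : IsPicardLindelof (fun t y => α t * Real.cos y ^ 2 - β t * Real.sin y ^ 2)
      (⟨t0, Ioo_subset_Icc_self ht0⟩ : Icc A B) (0:ℝ) (⟨2 * M * (B - A), by positivity⟩ : NNReal) 0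
      (⟨2 * M, by positivity⟩ : NNReal) (⟨2 * M, by positivity⟩ : NNReal) := by
    refine ⟨?_, ?_, ?_, ?_⟩
    · intro t ht
      apply LipschitzOnWith.of_dist_le_mul
      intro y _ y' _
      rw [Real.dist_eq, Real.dist_eq]
      have e : α t * Real.cos y ^ 2 - β t * Real.sin y ^ 2
        - (α t * Real.cos y' ^ 2 - β t * Real.sin y' ^ 2)
        = (α t + β t) / 2 * (Real.cos (2 * y) - Real.cos (2 * y')) := by
        rw [Real.cos_two_mul, Real.cos_two_mul, Real.sin_sq, Real.sin_sq]; ring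
      rw [e, abs_mul]
      have k1 : |(α t + β t) / 2| ≤ M := by
        rw [abs_div, abs_two, div_le_iff₀ (by norm_num)]
        linarith [abs_add_le (α t) (β t), h1 t ht, h2 t ht]
      have k2 : |Real.cos (2 * y) - Real.cos (2 * y')| ≤ 2 * |y - y'| := by
        have := Real.abs_cos_sub_cos_le (2 * y) (2 * y')
        rwa [← mul_sub, abs_mul, abs_two] at this
      calc _ ≤ M * (2 * |y - y'|) := by gcongr
        _ = 2 * M * |y - y'| := by ring
    · intro y _
      fun_prop
    · intro t ht y _
      have a1 := h1 t ht
      have a2 := h2 t ht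
      have s1 := Real.sin_sq_add_cos_sq y
      rw [abs_le] at a1 a2
      change |_| ≤ 2 * M
      rw [abs_le]
      have c0 := sq_nonneg (Real.cos y)
      have s0 := sq_nonneg (Real.sin y)
      generalize Real.cos y ^ 2 = c at *
      generalize Real.sin y ^ 2 = s at *
      constructor <;> nlinarith
    · change 2 * M * max (B - t0) (t0 - A) ≤ 2 * M * (B - A) - 0
      rw [sub_zero]
      apply mul_le_mul_of_nonneg_left _ (by positivity)
      apply max_le <;> linarith [ht0.1, ht0.2]
  obtain ⟨θ, h0, hθ⟩ := hP.exists_eq_forall_mem_Icc_hasDerivWithinAt₀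
  refine ⟨θ, h0, fun t ht => ?_⟩
  exact (hθ t (Ioo_subset_Icc_self ht)).hasDerivAt (Icc_mem_nhds ht.1 ht.2)

theorem ode_uv {α β : ℝ → ℝ} {A B t0 : ℝ} (ht0 : t0 ∈ Ioo A B)
    (hα : ContinuousOn α (Icc A B)) (hβ : ContinuousOn β (Icc A B)) :
    ∃ u v : ℝ → ℝ, u t0 = 0 ∧ v t0 = 1 ∧ ∀ t ∈ Ioo A B,
      HasDerivAt u (α t * v t) t ∧ HasDerivAt v (β t * u t) t := by
  obtain ⟨θ, h0, hθ⟩ := ode_theta ht0 hα hβ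
  set g : ℝ → ℝ := fun t => (α t + β t) * (Real.sin (θ t) * Real.cos (θ t)) with hg
  have hθc : ContinuousOn θ (Ioo A B) := fun t ht => (hθ t ht).continuousAt.continuousWithinAt
  have hα' := hα.mono Ioo_subset_Icc_self
  have hβ' := hβ.mono Ioo_subset_Icc_self
  have hgc : ContinuousOn g (Ioo A B) := by
    rw [hg]; fun_prop
  have hσ : ∀ t ∈ Ioo A B, HasDerivAt (fun t => ∫ s in t0..t, g s) (g t) t := by
    intro t ht
    apply intervalIntegral.integral_hasDerivAt_right
    · apply ContinuousOn.intervalIntegrable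
      apply hgc.mono
      exact (ordConnected_Ioo).uIcc_subset ht0 ht
    · exact hgc.stronglyMeasurableAtFilter isOpen_Ioo t ht
    · exact hgc.continuousAt (isOpen_Ioo.mem_nhds ht)
  set σ : ℝ → ℝ := fun t => ∫ s in t0..t, g s with hσd
  refine ⟨fun t => Real.exp (σ t) * Real.sin (θ t), fun t => Real.exp (σ t) * Real.cos (θ t), ?_, ?_, ?_⟩
  · simp [h0]
  · simp [h0, hσd]
  · intro t ht
    have d1 := (hσ t ht).exp.mul (hθ t ht).sin
    have d2 := (hσ t ht).exp.mul (hθ t ht).cos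
    have s1 := Real.sin_sq (θ t)
    constructor
    · refine d1.congr_deriv ?_
      rw [hg]; simp only
      have : Real.cos (θ t) ^ 3 = Real.cos (θ t) * Real.cos (θ t) ^ 2 := by ring
      linear_combination (Real.exp (σ t) * α t * Real.cos (θ t)) * s1
    · refine d2.congr_deriv ?_
      rw [hg]; simp only
      linear_combination (Real.exp (σ t) * β t * Real.sin (θ t)) * s1


theorem uv_smooth {α β u v : ℝ → ℝ} {A B : ℝ} (hα : ContDiffOn ℝ (⊤ : ℕ∞) α (Ioo A B))
    (hβ : ContDiffOn ℝ (⊤ : ℕ∞) β (Ioo A B))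
    (h : ∀ t ∈ Ioo A B, HasDerivAt u (α t * v t) t ∧ HasDerivAt v (β t * u t) t) :
    ContDiffOn ℝ (⊤ : ℕ∞) u (Ioo A B) := by
  have key : ∀ n : ℕ, ContDiffOn ℝ n u (Ioo A B) ∧ ContDiffOn ℝ n v (Ioo A B) := by
    intro n
    induction n with
    | zero =>
      constructor
      · exact contDiffOn_zero.2 (fun t ht => (h t ht).1.continuousAt.continuousWithinAt)
      · exact contDiffOn_zero.2 (fun t ht => (h t ht).2.continuousAt.continuousWithinAt)
    | succ n ih =>
      have hα' : ContDiffOn ℝ n α (Ioo A B) := hα.of_le (by exact_mod_cast le_top)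
      have hβ' : ContDiffOn ℝ n β (Ioo A B) := hβ.of_le (by exact_mod_cast le_top)
      push_cast
      constructor
      · rw [contDiffOn_succ_iff_deriv_of_isOpen isOpen_Ioo]
        refine ⟨fun t ht => (h t ht).1.differentiableAt.differentiableWithinAt, by simp, ?_⟩
        exact (hα'.mul ih.2).congr (fun t ht => (h t ht).1.deriv)
      · rw [contDiffOn_succ_iff_deriv_of_isOpen isOpen_Ioo]
        refine ⟨fun t ht => (h t ht).2.differentiableAt.differentiableWithinAt, by simp, ?_⟩
        exact (hβ'.mul ih.1).congr (fun t ht => (h t ht).2.deriv)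
  exact contDiffOn_infty.2 (fun n => (key n).1)

theorem IsT.mul' {h v : ℝ → ℝ} (hv : IsT v) (hh : ∀ r ∈ tsupport v, ContDiffAt ℝ (⊤ : ℕ∞) h r) :
    IsT (fun r => h r * v r) := by
  have hs : tsupport (fun r => h r * v r) ⊆ tsupport v := by
    apply closure_mono
    intro r hr h0
    apply hr
    simp [h0]
  refine ⟨?_, ?_, hs.trans hv.supp⟩
  · apply contDiff_of_tsupport'
    intro r hr
    exact (hh r (hs hr)).mul hv.smooth.contDiffAt
  · apply hv.comp.mono
    intro r hr h0
    apply hr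
    simp [h0]

theorem QF_mul' {h h' v c1 c2 c3 : ℝ → ℝ} (hv : IsT v)
    (hh : ∀ r ∈ tsupport v, HasDerivAt h (h' r) r) :
    QF c1 c2 c3 (fun r => h r * v r) = QF (fun r => c1 r * (h r) ^ 2)
      (fun r => 2 * c1 r * h r * h' r + c2 r * (h r) ^ 2)
      (fun r => c1 r * (h' r) ^ 2 + c2 r * h r * h' r + c3 r * (h r) ^ 2) v := by
  unfold QF
  congr 1
  ext r
  by_cases hr : r ∈ tsupport v
  · have h1 := hh r hr
    have h2 : HasDerivAt v (deriv v r) r := (hv.smooth.differentiable (by simp) r).hasDerivAt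
    have : deriv (fun r => h r * v r) r = h' r * v r + h r * deriv v r := (h1.mul h2).deriv
    rw [this]
    ring
  · obtain ⟨e1, e2⟩ := ts_zero hr
    have hs : tsupport (fun r => h r * v r) ⊆ tsupport v := by
      apply closure_mono
      intro r hr h0
      apply hr
      simp [h0]
    obtain ⟨e3, e4⟩ := ts_zero (fun h => hr (hs h))
    rw [e4, e1, e2]
    simp [e1]

/-- cutoff -/
theorem cutoffs : ∃ K : ℝ, 0 < K ∧ ∀ a c ε : ℝ, 0 < ε → 1 < a → a < c → ∃ η : ℝ → ℝ, IsT η ∧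
    tsupport η ⊆ Icc (a + ε) (c - ε) ∧ (∀ r, |deriv η r| ≤ K / ε) ∧
    (∀ r, 0 ≤ η r) ∧ (∀ r ∈ Icc (a + 2 * ε) (c - 2 * ε), η r = 1) ∧
    (∀ r, r ∉ Icc a (a + 2 * ε) → r ∉ Icc (c - 2 * ε) c → deriv η r = 0) := by
  set S := Real.smoothTransition with hS
  have hSd : ContDiff ℝ (⊤ : ℕ∞) S := Real.smoothTransition.contDiff
  have hSc : Continuous (deriv S) := hSd.continuous_deriv (by simp)
  have hSD : ∀ y, HasDerivAt S (deriv S y) y := fun y =>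
    (hSd.differentiable (by simp) y).hasDerivAt
  have z1 : ∀ y, y < 0 → deriv S y = 0 := by
    intro y hy
    have : S =ᶠ[nhds y] fun _ => 0 := by
      filter_upwards [Iio_mem_nhds hy] with z hz
      exact Real.smoothTransition.zero_of_nonpos (le_of_lt hz)
    rw [this.deriv_eq]; simp
  have z2 : ∀ y, 1 < y → deriv S y = 0 := by
    intro y hy
    have : S =ᶠ[nhds y] fun _ => 1 := by
      filter_upwards [Ioi_mem_nhds hy] with z hz
      exact Real.smoothTransition.one_of_one_le (le_of_lt hz)
    rw [this.deriv_eq]; simp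
  obtain ⟨K0, hK0⟩ := (isCompact_Icc (a := (0:ℝ)) (b := 1)).exists_bound_of_continuousOn
    hSc.continuousOn
  have hK : ∀ y, |deriv S y| ≤ |K0| + 1 := by
    intro y
    by_cases hy : y ∈ Icc (0:ℝ) 1
    · have := hK0 y hy
      rw [Real.norm_eq_abs] at this
      linarith [le_abs_self K0]
    · have : deriv S y = 0 := by
        by_cases h0 : y < 0
        · exact z1 y h0
        · apply z2
          by_contra h1
          exact hy ⟨by linarith, by linarith⟩
      rw [this, abs_zero]; positivity
  have s0 : ∀ y, 0 ≤ S y := Real.smoothTransition.nonneg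
  have s1 : ∀ y, S y ≤ 1 := Real.smoothTransition.le_one
  refine ⟨2 * (|K0| + 1), by positivity, ?_⟩
  intro a c ε hε ha hac
  set η : ℝ → ℝ := fun r => S ((r - a) / ε - 1) * S ((c - r) / ε - 1) with hη
  have hsm : ContDiff ℝ (⊤ : ℕ∞) η := by
    rw [hη]
    apply ContDiff.mul
    · exact hSd.comp (by fun_prop)
    · exact hSd.comp (by fun_prop)
  have hts : tsupport η ⊆ Icc (a + ε) (c - ε) := by
    apply closure_minimal _ isClosed_Icc
    intro r hr
    by_contra hn
    apply hr
    rw [hη]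
    simp only
    by_cases h1 : a + ε ≤ r
    · have h2 : c - ε < r := by
        by_contra h2
        exact hn ⟨h1, by linarith⟩
      have : S ((c - r) / ε - 1) = 0 := by
        apply Real.smoothTransition.zero_of_nonpos
        rw [sub_nonpos, div_le_one hε]; linarith
      rw [this, mul_zero]
    · have : S ((r - a) / ε - 1) = 0 := by
        apply Real.smoothTransition.zero_of_nonpos
        rw [sub_nonpos, div_le_one hε]; linarith
      rw [this, zero_mul]
  have hd : ∀ r, deriv η r = deriv S ((r - a) / ε - 1) / ε * S ((c - r) / ε - 1)
      - S ((r - a) / ε - 1) * (deriv S ((c - r) / ε - 1) / ε) := by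
    intro r
    have i1 : HasDerivAt (fun r : ℝ => (r - a) / ε - 1) (1 / ε) r :=
      (((hasDerivAt_id r).sub_const a).div_const ε).sub_const 1
    have i2 : HasDerivAt (fun r : ℝ => (c - r) / ε - 1) (-1 / ε) r :=
      (((hasDerivAt_id r).const_sub c).div_const ε).sub_const 1
    have j1 := (hSD ((r - a) / ε - 1)).comp r i1
    have j2 := (hSD ((c - r) / ε - 1)).comp r i2
    refine Eq.trans (j1.mul j2).deriv ?_
    simp only [Function.comp_apply]
    ring
  refine ⟨η, ⟨hsm, ?_, ?_⟩, hts, ?_, ?_, ?_, ?_⟩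
  · exact HasCompactSupport.of_support_subset_isCompact isCompact_Icc (subset_tsupport η |>.trans hts)
  · intro r hr
    have := hts hr
    have : a + ε ≤ r := this.1
    show 1 < r
    linarith
  · intro r
    rw [hd]
    have e1 : |deriv S ((r - a) / ε - 1) / ε * S ((c - r) / ε - 1)| ≤ (|K0| + 1) / ε * 1 := by
      rw [abs_mul, abs_div, abs_of_pos hε, abs_of_nonneg (s0 _)]
      gcongr
      · exact s0 _
      · exact hK _
      · exact s1 _
    have e2 : |S ((r - a) / ε - 1) * (deriv S ((c - r) / ε - 1) / ε)| ≤ 1 * ((|K0| + 1) / ε) := by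
      rw [abs_mul, abs_div, abs_of_pos hε, abs_of_nonneg (s0 _)]
      gcongr
      · exact s1 _
      · exact hK _
    calc _ ≤ _ := abs_sub _ _
      _ ≤ _ := add_le_add e1 e2
      _ = _ := by ring
  · intro r
    exact mul_nonneg (s0 _) (s0 _)
  · intro r hr
    have e1 : S ((r - a) / ε - 1) = 1 := by
      apply Real.smoothTransition.one_of_one_le
      rw [le_sub_iff_add_le, le_div_iff₀ hε]; linarith [hr.1]
    have e2 : S ((c - r) / ε - 1) = 1 := by
      apply Real.smoothTransition.one_of_one_le
      rw [le_sub_iff_add_le, le_div_iff₀ hε]; linarith [hr.2]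
    rw [hη]; simp only
    rw [e1, e2, one_mul]
  · intro r h1 h2
    rw [hd]
    have A1 : r < a ∨ a + 2 * ε < r := by
      by_contra hh
      push Not at hh
      exact h1 hh
    have A2 : r < c - 2 * ε ∨ c < r := by
      by_contra hh
      push Not at hh
      exact h2 hh
    have w1 : deriv S ((r - a) / ε - 1) = 0 := by
      rcases A1 with hA | hA
      · apply z1
        have : (r - a) / ε < 0 := div_neg_of_neg_of_pos (by linarith) hε
        linarith
      · apply z2
        rw [lt_sub_iff_add_lt, lt_div_iff₀ hε]; linarith
    have w2 : deriv S ((c - r) / ε - 1) = 0 := by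
      rcases A2 with hA | hA
      · apply z2
        rw [lt_sub_iff_add_lt, lt_div_iff₀ hε]; linarith
      · apply z1
        have : (c - r) / ε < 0 := div_neg_of_neg_of_pos (by linarith) hε
        linarith
    rw [w1, w2]; ring


theorem sol_cont {α β u v : ℝ → ℝ} {A B : ℝ}
    (h : ∀ t ∈ Ioo A B, HasDerivAt u (α t * v t) t ∧ HasDerivAt v (β t * u t) t) :
    ContinuousOn u (Ioo A B) ∧ ContinuousOn v (Ioo A B) :=
  ⟨fun t ht => (h t ht).1.continuousAt.continuousWithinAt,
   fun t ht => (h t ht).2.continuousAt.continuousWithinAt⟩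

theorem cc_smooth {l b q E m : ℝ} (hl : 0 < l) (hE : E < 1 + 3 * l) :
    ContDiffOn ℝ (⊤ : ℕ∞) (cc l b q E m) (Ioi 1) := by
  have h1 : ∀ r ∈ Ioi (1:ℝ), nn l E r ≠ 0 := fun r hr => (nn_pos hl hE hr).ne'
  have h2 : ∀ r ∈ Ioi (1:ℝ), pp l E r ≠ 0 := fun r hr => (pp_pos hl hE hr).ne'
  have h3 : ContDiffOn ℝ (⊤ : ℕ∞) (nn l E) (Ioi (1:ℝ)) := by
    unfold nn; fun_prop
  have h4 : ContDiffOn ℝ (⊤ : ℕ∞) (pp l E) (Ioi (1:ℝ)) := by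
    unfold pp nn; fun_prop
  unfold cc
  fun_prop (disch := assumption)

theorem ppinv_smooth {l E : ℝ} (hl : 0 < l) (hE : E < 1 + 3 * l) :
    ContDiffOn ℝ (⊤ : ℕ∞) (fun r => 1 / pp l E r) (Ioi 1) := by
  have h2 : ∀ r ∈ Ioi (1:ℝ), pp l E r ≠ 0 := fun r hr => (pp_pos hl hE hr).ne'
  have h4 : ContDiffOn ℝ (⊤ : ℕ∞) (pp l E) (Ioi (1:ℝ)) := by
    unfold pp nn; fun_prop
  fun_prop (disch := assumption)

theorem nz1 {l b q E m0 m A B : ℝ} {u v η : ℝ → ℝ} (hl : 0 < l) (hE : E < 1 + 3 * l)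
    (hA : 1 ≤ A) (hP : Pos l b q E m0)
    (h : ∀ t ∈ Ioo A B, HasDerivAt u (1 / pp l E t * v t) t ∧
      HasDerivAt v (cc l b q E m t * u t) t) (hη : IsT η) (hs : tsupport η ⊆ Ioo A B) :
    Integrable (fun r => (pp l E r * (u r) ^ 2) * (deriv η r) ^ 2 + 0 * (η r * deriv η r)
      + (-((m - m0) * (r ^ 4 / pp l E r) * (u r) ^ 2)) * (η r) ^ 2) ∧
    0 ≤ ∫ r, ((pp l E r * (u r) ^ 2) * (deriv η r) ^ 2 + 0 * (η r * deriv η r)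
      + (-((m - m0) * (r ^ 4 / pp l E r) * (u r) ^ 2)) * (η r) ^ 2) := by
  have hsub : Ioo A B ⊆ Ioi 1 := fun r hr => lt_of_le_of_lt hA hr.1
  obtain ⟨hu, hv⟩ := sol_cont h
  have h2 : ∀ r ∈ Ioo A B, pp l E r ≠ 0 := fun r hr => (pp_pos hl hE (hsub hr)).ne'
  have h4 := (pp_cont l E).continuousOn (s := Ioo A B)
  have hc : ContinuousOn (cc l b q E m) (Ioo A B) := (cc_cont hl hE).mono hsub
  have hc0 : ContinuousOn (cc l b q E m0) (Ioo A B) := (cc_cont hl hE).mono hsub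
  have hus := uv_smooth ((ppinv_smooth hl hE).mono hsub) ((cc_smooth hl hE).mono hsub) h
  have hT : IsT (fun r => u r * η r) := hη.mul' (fun r hr =>
    hus.contDiffAt (isOpen_Ioo.mem_nhds (hs hr)))
  have q1 := hP _ hT
  unfold Q at q1
  rw [QF_mul' hη (fun r hr => (h r (hs hr)).1)] at q1
  have q2 := quad_nonneg hη.smooth hη.comp hs (c1 := fun _ => 0)
    (c2 := fun r => -2 * (u r * v r))
    (c3 := fun r => -((v r) ^ 2 / pp l E r + cc l b q E m r * (u r) ^ 2))
    (Φ := fun r => u r * v r) (Φ' := fun r => (v r) ^ 2 / pp l E r + cc l b q E m r * (u r) ^ 2)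
    continuousOn_const (by fun_prop) (by fun_prop (disch := assumption))
    (by
      intro r hr
      refine ((h r hr).1.mul (h r hr).2).congr_deriv ?_
      ring) (by fun_prop (disch := assumption)) (by
      intro r hr x y
      apply le_of_eq
      ring)
  have i2 := quad_integrable hη.smooth hη.comp hs (c1 := fun _ => 0)
    (c2 := fun r => -2 * (u r * v r))
    (c3 := fun r => -((v r) ^ 2 / pp l E r + cc l b q E m r * (u r) ^ 2))
    continuousOn_const (by fun_prop) (by fun_prop (disch := assumption))
  have i1 := quad_integrable hη.smooth hη.comp hs (c1 := fun r => pp l E r * (u r) ^ 2)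
    (c2 := fun r => 2 * pp l E r * u r * (1 / pp l E r * v r) + (fun _ => (0:ℝ)) r * (u r) ^ 2)
    (c3 := fun r => pp l E r * (1 / pp l E r * v r) ^ 2
      + (fun _ => (0:ℝ)) r * u r * (1 / pp l E r * v r) + cc l b q E m0 r * (u r) ^ 2)
    (by fun_prop) (by fun_prop (disch := assumption)) (by fun_prop (disch := assumption))
  have i3 := quad_integrable hη.smooth hη.comp hs (c1 := fun r => pp l E r * (u r) ^ 2)
    (c2 := fun r => 0)
    (c3 := fun r => (-((m - m0) * (r ^ 4 / pp l E r) * (u r) ^ 2)))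
    (by fun_prop) (by fun_prop (disch := assumption)) (by fun_prop (disch := assumption))
  refine ⟨i3, ?_⟩
  unfold QF at q1
  have := add_nonneg q1 q2
  rw [← integral_add i1 i2] at this
  refine this.trans_eq ?_
  congr 1
  funext r
  by_cases hr : r ∈ tsupport η
  · have hp := h2 r (hs hr)
    have hcd : cc l b q E m r = cc l b q E m0 r + (m - m0) * (r ^ 4 / pp l E r) := by
      unfold cc; ring
    rw [hcd]
    generalize cc l b q E m0 r = z
    generalize pp l E r = p at hp
    field_simp
    ring
  · obtain ⟨e1, e2⟩ := ts_zero hr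
    simp [e1, e2]

theorem nozero {l b q E m0 m A B a0 c : ℝ} {u v : ℝ → ℝ} (hl : 0 < l) (hE : E < 1 + 3 * l)
    (hA : 1 ≤ A) (hP : Pos l b q E m0) (hm : m0 < m)
    (h : ∀ t ∈ Ioo A B, HasDerivAt u (1 / pp l E t * v t) t ∧
      HasDerivAt v (cc l b q E m t * u t) t) (ha0 : A < a0) (hac : a0 < c) (hcB : c < B)
    (hu0 : u a0 = 0) (huc : u c = 0) (hpos : ∀ t ∈ Ioo a0 c, 0 < u t) : False := by
  have hsub : Ioo A B ⊆ Ioi 1 := fun r hr => lt_of_le_of_lt hA hr.1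
  have hsub2 : Icc a0 c ⊆ Ioo A B := fun r hr => ⟨ha0.trans_le hr.1, hr.2.trans_lt hcB⟩
  obtain ⟨hu, hv⟩ := sol_cont h
  have h2 : ∀ r ∈ Icc a0 c, pp l E r ≠ 0 := fun r hr => (pp_pos hl hE (hsub (hsub2 hr))).ne'
  have h4 := (pp_cont l E).continuousOn (s := Icc a0 c)
  have hu' := hu.mono hsub2
  have hv' := hv.mono hsub2
  obtain ⟨C, hC⟩ := isCompact_Icc.exists_bound_of_continuousOn
    (show ContinuousOn (fun r => 1 / pp l E r * v r) (Icc a0 c) by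
      fun_prop (disch := assumption))
  obtain ⟨P, hPb⟩ := isCompact_Icc.exists_bound_of_continuousOn h4
  have ma : a0 ∈ Icc a0 c := ⟨le_rfl, hac.le⟩
  have mc : c ∈ Icc a0 c := ⟨hac.le, le_rfl⟩
  have hC0 : 0 ≤ C := (norm_nonneg _).trans (hC a0 ma)
  have hP0 : 0 ≤ P := (norm_nonneg _).trans (hPb a0 ma)
  have mvt : ∀ x ∈ Icc a0 c, ∀ y ∈ Icc a0 c, ‖u y - u x‖ ≤ C * ‖y - x‖ := by
    intro x hx y hy
    exact (convex_Icc a0 c).norm_image_sub_le_of_norm_hasDerivWithin_le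
      (fun t ht => (h t (hsub2 ht)).1.hasDerivWithinAt) hC hx hy
  have b1 : ∀ r ∈ Icc a0 c, |u r| ≤ C * (r - a0) := by
    intro r hr
    have := mvt a0 ma r hr
    rw [hu0, sub_zero, Real.norm_eq_abs, Real.norm_eq_abs, abs_of_nonneg (sub_nonneg.2 hr.1)] at this
    exact this
  have b2 : ∀ r ∈ Icc a0 c, |u r| ≤ C * (c - r) := by
    intro r hr
    have := mvt r hr c mc
    rw [huc, zero_sub, norm_neg, Real.norm_eq_abs, Real.norm_eq_abs,
      abs_of_nonneg (sub_nonneg.2 hr.2)] at this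
    exact this
  obtain ⟨K, hK, hcut⟩ := cutoffs
  -- middle third
  set L := c - a0 with hL
  have hLp : 0 < L := by linarith
  have hmid : Icc (a0 + L / 3) (c - L / 3) ⊆ Icc a0 c := by
    intro r hr; exact ⟨by linarith [hr.1], by linarith [hr.2]⟩
  obtain ⟨r0, hr0, hmin⟩ := isCompact_Icc.exists_isMinOn (s := Icc (a0 + L / 3) (c - L / 3))
    ⟨a0 + L / 3, by constructor <;> linarith⟩
    (show ContinuousOn (fun r => (m - m0) * (r ^ 4 / pp l E r) * (u r) ^ 2) _ by
      have := hu'.mono hmid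
      have := h4.mono hmid
      have : ∀ r ∈ Icc (a0 + L / 3) (c - L / 3), pp l E r ≠ 0 := fun r hr => h2 r (hmid hr)
      fun_prop (disch := assumption))
  set d := (m - m0) * (r0 ^ 4 / pp l E r0) * (u r0) ^ 2 with hd
  have hd0 : 0 < d := by
    have e1 : 0 < u r0 := hpos r0 ⟨by linarith [hr0.1], by linarith [hr0.2]⟩
    have e2 : 1 < r0 := hsub (hsub2 (hmid hr0))
    have e3 := pp_pos hl hE e2
    have e4 : 0 < m - m0 := by linarith
    positivity
  set M := 4 * C ^ 2 * K ^ 2 * P with hM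
  have hM0 : 0 ≤ M := by positivity
  set ε := min (L / 6) (d * (L / 3) / (4 * M + 1) / 2) with hε
  have hε0 : 0 < ε := by
    apply lt_min (by positivity)
    positivity
  have hε1 : ε ≤ L / 6 := min_le_left _ _
  have hε2 : 4 * M * ε < d * (L / 3) := by
    have e1 : ε ≤ d * (L / 3) / (4 * M + 1) / 2 := min_le_right _ _
    have e2 : (4 * M + 1) * ε ≤ d * (L / 3) / 2 := by
      rw [div_right_comm, le_div_iff₀ (by positivity)] at e1
      linarith
    have e3 : 0 < d * (L / 3) := by positivity
    linarith
  obtain ⟨η, hη, hs, hder, hnn, hone, hz⟩ := hcut a0 c ε hε0 (lt_of_le_of_lt hA ha0) hac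
  have hs' : tsupport η ⊆ Icc a0 c := fun r hr =>
    ⟨by linarith [(hs hr).1], by linarith [(hs hr).2]⟩
  obtain ⟨hi, hge⟩ := nz1 hl hE hA hP h hη (hs'.trans hsub2)
  set S1 := Icc a0 (a0 + 2 * ε) with hS1
  set S2 := Icc (c - 2 * ε) c with hS2
  set S3 := Icc (a0 + L / 3) (c - L / 3) with hS3
  have I1 : Integrable (S1.indicator (fun _ => M)) :=
    (integrable_indicator_iff measurableSet_Icc).2 (integrableOn_const (by exact (measure_Icc_lt_top).ne))
  have I2 : Integrable (S2.indicator (fun _ => M)) :=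
    (integrable_indicator_iff measurableSet_Icc).2 (integrableOn_const (by exact (measure_Icc_lt_top).ne))
  have I3 : Integrable (S3.indicator (fun _ => d)) :=
    (integrable_indicator_iff measurableSet_Icc).2 (integrableOn_const (by exact (measure_Icc_lt_top).ne))
  have v1 : ∫ r, S1.indicator (fun _ => M) r = 2 * ε * M := by
    rw [integral_indicator measurableSet_Icc, setIntegral_const, Real.volume_real_Icc_of_le (by linarith)]
    simp
  have v2 : ∫ r, S2.indicator (fun _ => M) r = 2 * ε * M := by
    rw [integral_indicator measurableSet_Icc, setIntegral_const, Real.volume_real_Icc_of_le (by linarith)]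
    simp
  have v3 : ∫ r, S3.indicator (fun _ => d) r = L / 3 * d := by
    rw [integral_indicator measurableSet_Icc, setIntegral_const, Real.volume_real_Icc_of_le (by linarith)]
    rw [smul_eq_mul]
    have : c - L / 3 - (a0 + L / 3) = L / 3 := by rw [hL]; ring
    rw [this]
  have hle : ∫ r, ((pp l E r * (u r) ^ 2) * (deriv η r) ^ 2 + 0 * (η r * deriv η r)
      + (-((m - m0) * (r ^ 4 / pp l E r) * (u r) ^ 2)) * (η r) ^ 2) ≤
      ∫ r, (S1.indicator (fun _ => M) r + S2.indicator (fun _ => M) r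
        - S3.indicator (fun _ => d) r) := by
    apply integral_mono hi ((I1.add I2).sub I3)
    intro r
    have t1 : (pp l E r * (u r) ^ 2) * (deriv η r) ^ 2 ≤
        S1.indicator (fun _ => M) r + S2.indicator (fun _ => M) r := by
      have n1 : 0 ≤ S1.indicator (fun _ => M) r := indicator_nonneg (fun _ _ => hM0) r
      have n2 : 0 ≤ S2.indicator (fun _ => M) r := indicator_nonneg (fun _ _ => hM0) r
      have gen : r ∈ Icc a0 c → |u r| ≤ C * (2 * ε) →
          (pp l E r * (u r) ^ 2) * (deriv η r) ^ 2 ≤ M := by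
        intro hr hur
        have e1 : pp l E r ≤ P := (le_abs_self _).trans (hPb r hr)
        have e2 : (u r) ^ 2 ≤ (C * (2 * ε)) ^ 2 := by
          rw [← sq_abs]; gcongr
        have e3 : (deriv η r) ^ 2 ≤ (K / ε) ^ 2 := by
          rw [← sq_abs]; gcongr; exact hder r
        calc _ ≤ P * (C * (2 * ε)) ^ 2 * (K / ε) ^ 2 := by gcongr
          _ = M := by rw [hM]; field_simp; ring
      by_cases m1 : r ∈ S1
      · rw [indicator_of_mem m1]
        have hr : r ∈ Icc a0 c := ⟨m1.1, by linarith [m1.2]⟩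
        have := gen hr ((b1 r hr).trans (by gcongr; linarith [m1.2]))
        linarith
      · by_cases m2 : r ∈ S2
        · rw [indicator_of_mem m2]
          have hr : r ∈ Icc a0 c := ⟨by linarith [m2.1], m2.2⟩
          have := gen hr ((b2 r hr).trans (by gcongr; linarith [m2.1]))
          linarith
        · rw [hz r m1 m2]
          simp only [ne_eq, OfNat.ofNat_ne_zero, not_false_eq_true, zero_pow, mul_zero]
          linarith
    have t2 : S3.indicator (fun _ => d) r ≤
        ((m - m0) * (r ^ 4 / pp l E r) * (u r) ^ 2) * (η r) ^ 2 := by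
      by_cases m3 : r ∈ S3
      · rw [indicator_of_mem m3, hone r ⟨by linarith [m3.1], by linarith [m3.2]⟩]
        have := hmin m3
        simp only [mem_ofPred_eq] at this
        linarith
      · rw [indicator_of_notMem m3]
        by_cases hr : r ∈ tsupport η
        · have e3 := pp_pos hl hE (hsub (hsub2 (hs' hr)))
          have e4 : 0 < m - m0 := by linarith
          positivity
        · rw [(ts_zero hr).1]; simp
    have e : (((S1.indicator fun x => M) + S2.indicator fun x => M) - S3.indicator fun x => d) r
      = S1.indicator (fun _ => M) r + S2.indicator (fun _ => M) r
        - S3.indicator (fun _ => d) r := rfl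
    rw [e]
    linarith
  have I12 := I1.add I2
  have : ∫ r, (S1.indicator (fun _ => M) r + S2.indicator (fun _ => M) r
        - S3.indicator (fun _ => d) r) = 2 * ε * M + 2 * ε * M - L / 3 * d := by
    rw [integral_sub (by exact I1.add I2) I3, integral_add I1 I2, v1, v2, v3]
  rw [this] at hle
  linarith


theorem u_pos {l b q E m0 m A B a0 : ℝ} {u v : ℝ → ℝ} (hl : 0 < l) (hE : E < 1 + 3 * l)
    (hA : 1 ≤ A) (hP : Pos l b q E m0) (hm : m0 < m)
    (h : ∀ t ∈ Ioo A B, HasDerivAt u (1 / pp l E t * v t) t ∧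
      HasDerivAt v (cc l b q E m t * u t) t) (ha0 : A < a0) (ha0B : a0 < B)
    (hu0 : u a0 = 0) (hv0 : v a0 = 1) : ∀ t ∈ Ioo a0 B, 0 < u t := by
  intro t ht
  by_contra hneg
  push Not at hneg
  have hp := pp_pos hl hE (lt_of_le_of_lt hA ha0)
  have hd := (h a0 ⟨ha0, ha0B⟩).1
  rw [hv0, mul_one, hasDerivAt_iff_tendsto_slope] at hd
  have hev := hd.eventually (lt_mem_nhds (show 0 < 1 / pp l E a0 by positivity))
  have hev2 : ∀ᶠ x in nhdsWithin a0 (Ioi a0), 0 < slope u a0 x :=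
    hev.filter_mono (nhdsWithin_mono _ (fun x hx => ne_of_gt hx))
  obtain ⟨w, hw, hws⟩ := mem_nhdsGT_iff_exists_Ioo_subset.1 hev2
  have hpos1 : ∀ x ∈ Ioo a0 w, 0 < u x := by
    intro x hx
    have : 0 < slope u a0 x := hws hx
    rw [slope_def_field, hu0, sub_zero] at this
    have e : 0 < x - a0 := sub_pos.2 hx.1
    exact (div_pos_iff_of_pos_right e).1 this
  simp only [mem_Ioi] at hw
  have hwt : w ≤ t := by
    by_contra hh
    push Not at hh
    exact absurd (hpos1 t ⟨ht.1, hh⟩) (not_lt.2 hneg)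
  set x0 := (a0 + w) / 2 with hx0
  have hx0p := hpos1 x0 ⟨by linarith, by linarith⟩
  have hsub : Icc x0 t ⊆ Ioo A B := fun r hr => ⟨by linarith [hr.1], hr.2.trans_lt ht.2⟩
  have hu := (sol_cont h).1.mono hsub
  have hcl : IsClosed (Icc x0 t ∩ u ⁻¹' (Iic 0)) := hu.preimage_isClosed_of_isClosed isClosed_Icc isClosed_Iic
  have hcp : IsCompact (Icc x0 t ∩ u ⁻¹' (Iic 0)) := isCompact_Icc.of_isClosed_subset hcl inter_subset_left
  obtain ⟨c, ⟨hc1, hc2⟩, hcm⟩ := hcp.exists_isLeast ⟨t, ⟨by linarith, le_rfl⟩, hneg⟩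
  have hc2' : u c ≤ 0 := hc2
  have hpc : ∀ y ∈ Ioo a0 c, 0 < u y := by
    intro y hy
    by_cases hyw : y < w
    · exact hpos1 y ⟨hy.1, hyw⟩
    · by_contra hh
      push Not at hh hyw
      have := hcm ⟨⟨by linarith, by linarith [hy.2, hc1.2]⟩, hh⟩
      linarith [hy.2]
  have hca : a0 < c := by linarith [hc1.1]
  have hx0c : x0 < c := by
    rcases eq_or_lt_of_le hc1.1 with e | e
    · rw [← e] at hc2'; linarith
    · exact e
  have huc : u c = 0 := by
    by_contra hne
    have hlt : u c < 0 := lt_of_le_of_ne hc2' hne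
    have := intermediate_value_Icc' hx0c.le (hu.mono (Icc_subset_Icc_right hc1.2)) (⟨hlt.le, hx0p.le⟩ : (0:ℝ) ∈ Icc (u c) (u x0))
    obtain ⟨y, hy, hy0⟩ := this
    have hyc : y ≠ c := by
      intro e; rw [e] at hy0; linarith
    have := hpc y ⟨by linarith [hy.1], lt_of_le_of_ne hy.2 hyc⟩
    linarith
  exact nozero hl hE hA hP hm h ha0 hca (hc1.2.trans_lt ht.2) hu0 huc hpc

theorem theta_exists {l b q E m0 m B a0 : ℝ} (hl : 0 < l) (hE : E < 1 + 3 * l)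
    (hP : Pos l b q E m0) (hm : m0 < m) (ha0 : 1 < a0) (hB : a0 < B) :
    ∃ Θ : ℝ → ℝ, ∀ r ∈ Ioc a0 B,
      HasDerivAt Θ (cc l b q E m r - (Θ r) ^ 2 / pp l E r) r := by
  set A := (1 + a0) / 2 with hA
  have hsub : Icc A (B + 1) ⊆ Ioi 1 := fun r hr => by
    simp only [mem_Ioi]; linarith [hr.1]
  obtain ⟨u, v, hu0, hv0, h⟩ := ode_uv (A := A) (B := B + 1) (t0 := a0) ⟨by linarith, by linarith⟩
    ((ppinv_smooth hl hE).continuousOn.mono hsub)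
    ((cc_smooth (b := b) (q := q) (m := m) hl hE).continuousOn.mono hsub)
  have hup := u_pos hl hE (by linarith) hP hm h (by linarith) (by linarith) hu0 hv0
  refine ⟨fun r => v r / u r, fun r hr => ?_⟩
  have hur := hup r ⟨hr.1, by linarith [hr.2]⟩
  obtain ⟨d1, d2⟩ := h r ⟨by linarith [hr.1], by linarith [hr.2]⟩
  refine (d2.div d1 hur.ne').congr_deriv ?_
  have hp := pp_pos hl hE (show 1 < r by linarith [hr.1])
  generalize cc l b q E m r = z
  generalize pp l E r = p at hp
  field_simp


theorem nn_mono {l E x y : ℝ} (hl : 0 < l) (hx : 0 ≤ x) (hxy : x ≤ y) : nn l E x ≤ nn l E y := by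
  unfold nn
  gcongr

theorem cc_le {l b q E m r : ℝ} (hl : 0 < l) (hE0 : 0 ≤ E) (hE : E < 1 + 3 * l) (hr : 1 < r) :
    cc l b q E m r ≤ m * r ^ 4 / pp l E r - b * r ^ 2 := by
  have hn := nn_pos hl hE hr
  have : 0 ≤ q ^ 2 * E * (r - 1) / nn l E r := by
    have : 0 < r - 1 := by linarith
    positivity
  have h2 := mul_nonneg this (sq_nonneg r)
  unfold cc
  linarith

theorem zder_le {μ b r p c z : ℝ} (hr : 1 < r) (hp : 0 < p) (hμ : 0 < μ) (hz : 0 < z)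
    (hc : c ≤ μ ^ 2 * r ^ 4 / p - b * r ^ 2) :
    ((c - (r ^ 2 * (z + μ)) ^ 2 / p) * r ^ 2 - (r ^ 2 * (z + μ)) * (2 * r)) / (r ^ 2) ^ 2
     ≤ -(z ^ 2 * (1 / p)) - b := by
  have h0 : 0 < r := by linarith
  rw [div_le_iff₀ (by positivity)]
  have h1 : c * r ^ 2 ≤ (μ ^ 2 * r ^ 4 / p - b * r ^ 2) * r ^ 2 := by gcongr
  have h2 : 0 ≤ r ^ 2 * (z + μ) * (2 * r) := by positivity
  have h3 : (μ ^ 2 * r ^ 4 / p - b * r ^ 2) * r ^ 2 - (r ^ 2 * (z + μ)) ^ 2 / p * r ^ 2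
     - (-(z ^ 2 * (1 / p)) - b) * (r ^ 2) ^ 2 =
     -(r ^ 4 / p * (z ^ 2 * (r ^ 2 - 1) + 2 * μ * z * r ^ 2)) := by
    field_simp; ring
  have h4 : 0 ≤ r ^ 4 / p * (z ^ 2 * (r ^ 2 - 1) + 2 * μ * z * r ^ 2) := by
    have : 0 < r ^ 2 - 1 := by nlinarith
    positivity
  linarith

theorem no_high {l b q E μ a : ℝ} (hl : 0 < l) (hE0 : 0 ≤ E) (hE : E < 1 + 3 * l) (hμ : 0 < μ)
    (hb : 0 < b) (ha : 1 < a) : ∃ a0, 1 < a0 ∧ a0 < a ∧ ∀ Θ : ℝ → ℝ,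
    (∀ r ∈ Ioc a0 a, HasDerivAt Θ (cc l b q E (μ ^ 2) r - (Θ r) ^ 2 / pp l E r) r) →
    ∃ a1 ∈ Ioc a0 a, Θ a1 ≤ μ * a1 ^ 2 := by
  set C := nn l E a with hC
  have hC0 : 0 < C := nn_pos hl hE ha
  set a' := (1 + a) / 2 with ha'
  have ha1 : 1 < a' := by linarith
  have ha2 : a' < a := by linarith
  set X := 1 / (b * (a - a')) + 1 with hX
  have hX0 : 0 < X := by
    have : 0 < a - a' := by linarith
    positivity
  set s1 := 1 + (a' - 1) * Real.exp (-(C * X)) with hs1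
  have hex : Real.exp (-(C * X)) < 1 := by
    rw [← Real.exp_zero]
    exact Real.exp_lt_exp.2 (by have := mul_pos hC0 hX0; linarith)
  have hs1a : 1 < s1 := by
    have : 0 < (a' - 1) * Real.exp (-(C * X)) := mul_pos (by linarith) (Real.exp_pos _)
    linarith
  have hs1b : s1 < a' := by
    have : (a' - 1) * Real.exp (-(C * X)) < (a' - 1) * 1 :=
      mul_lt_mul_of_pos_left hex (by linarith)
    linarith
  refine ⟨(1 + s1) / 2, by linarith, by linarith, ?_⟩
  intro Θ hΘ
  by_contra hcon
  push Not at hcon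
  set z : ℝ → ℝ := fun r => Θ r / r ^ 2 - μ with hz
  have hsubs : ∀ r ∈ Icc s1 a, r ∈ Ioc ((1 + s1) / 2) a := fun r hr => ⟨by linarith [hr.1], hr.2⟩
  have hz0 : ∀ r ∈ Icc s1 a, 0 < z r := by
    intro r hr
    have h1 := hcon r (hsubs r hr)
    have : 0 < r := by linarith [hr.1]
    simp only [hz]
    rw [sub_pos, lt_div_iff₀ (by positivity)]
    exact h1
  have hzd : ∀ r ∈ Icc s1 a, ∃ d, HasDerivAt z d r ∧ d ≤ -((z r) ^ 2 * (1 / pp l E r)) - b := by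
    intro r hr
    have hr0 : 0 < r := by linarith [hr.1]
    have hr1 : 1 < r := by linarith [hr.1]
    have h1 := hΘ r (hsubs r hr)
    have h2 := ((h1.div ((hasDerivAt_id r).pow 2) (by simp; positivity)).sub_const μ)
    refine ⟨_, h2, ?_⟩
    have e : Θ r = r ^ 2 * (z r + μ) := by simp only [hz]; field_simp; ring
    have := zder_le hr1 (pp_pos hl hE hr1) hμ (hz0 r hr) (cc_le (q := q) (b := b) (m := μ ^ 2) hl hE0 hE hr1)
    rw [← e] at this
    simpa using this
  choose! zd hzd1 hzd2 using hzd
  have mono1 : MonotoneOn (fun r => (z r)⁻¹ - 1 / C * Real.log (r - 1)) (Icc s1 a') := by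
    have hD : ∀ r ∈ Icc s1 a', HasDerivAt (fun r => (z r)⁻¹ - 1 / C * Real.log (r - 1))
        (-zd r / (z r) ^ 2 - 1 / C * (1 / (r - 1))) r := by
      intro r hr
      have hr' : r ∈ Icc s1 a := ⟨hr.1, by linarith [hr.2]⟩
      have h1 := (hzd1 r hr').inv (hz0 r hr').ne'
      have h2 := ((((hasDerivAt_id r).sub_const 1).log (by simp; linarith [hr.1]))).const_mul (1 / C)
      exact h1.sub h2
    apply monotoneOn_of_deriv_nonneg (convex_Icc _ _)
    · exact fun r hr => (hD r hr).continuousAt.continuousWithinAt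
    · exact fun r hr => (hD r (interior_subset hr)).differentiableAt.differentiableWithinAt
    · intro r hr
      have hr := interior_subset hr
      rw [(hD r hr).deriv]
      have hr' : r ∈ Icc s1 a := ⟨hr.1, by linarith [hr.2]⟩
      have hr1 : 1 < r := by linarith [hr.1]
      have h1 := hzd2 r hr'
      have h2 := hz0 r hr'
      have hp := pp_pos hl hE hr1
      have h3 : 1 / pp l E r ≤ -zd r / (z r) ^ 2 := by
        rw [le_div_iff₀ (by positivity)]
        linarith
      have h4 : 1 / C * (1 / (r - 1)) ≤ 1 / pp l E r := by
        rw [one_div_mul_one_div]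
        apply one_div_le_one_div_of_le hp
        unfold pp
        rw [mul_comm]
        apply mul_le_mul_of_nonneg_right _ (by linarith)
        exact nn_mono hl (by linarith) hr'.2
      linarith
  have anti : AntitoneOn (fun r => z r + b * r) (Icc a' a) := by
    have hD : ∀ r ∈ Icc a' a, HasDerivAt (fun r => z r + b * r) (zd r + b * 1) r := by
      intro r hr
      have hr' : r ∈ Icc s1 a := ⟨by linarith [hr.1], hr.2⟩
      exact (hzd1 r hr').add ((hasDerivAt_id r).const_mul b)
    apply antitoneOn_of_deriv_nonpos (convex_Icc _ _)
    · exact fun r hr => (hD r hr).continuousAt.continuousWithinAt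
    · exact fun r hr => (hD r (interior_subset hr)).differentiableAt.differentiableWithinAt
    · intro r hr
      have hr := interior_subset hr
      rw [(hD r hr).deriv]
      have hr' : r ∈ Icc s1 a := ⟨by linarith [hr.1], hr.2⟩
      have hr1 : 1 < r := by linarith [hr.1]
      have h1 := hzd2 r hr'
      have hp := pp_pos hl hE hr1
      have : 0 ≤ (z r) ^ 2 * (1 / pp l E r) := by positivity
      linarith
  have k1 := mono1 (⟨le_rfl, hs1b.le⟩ : s1 ∈ Icc s1 a') (⟨hs1b.le, le_rfl⟩ : a' ∈ Icc s1 a') hs1b.le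
  have k2 := anti (⟨le_rfl, ha2.le⟩ : a' ∈ Icc a' a) (⟨ha2.le, le_rfl⟩ : a ∈ Icc a' a) ha2.le
  simp only at k1 k2
  have elog : Real.log (s1 - 1) = Real.log (a' - 1) - C * X := by
    rw [hs1, add_sub_cancel_left, Real.log_mul (by linarith) (Real.exp_pos _).ne', Real.log_exp]
    ring
  rw [elog] at k1
  have z1 := hz0 s1 ⟨le_rfl, by linarith⟩
  have z2 := hz0 a' ⟨by linarith, by linarith⟩
  have z3 := hz0 a ⟨by linarith, le_rfl⟩
  have k3 : X ≤ (z a')⁻¹ := by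
    have : 1 / C * (Real.log (a' - 1) - C * X) = 1 / C * Real.log (a' - 1) - X := by
      field_simp
    rw [this] at k1
    have := inv_pos.2 z1
    linarith
  have hba : 0 < b * (a - a') := mul_pos hb (by linarith)
  have k4 : z a' < b * (a - a') := by
    have h1 : (b * (a - a'))⁻¹ < (z a')⁻¹ := by
      rw [hX, one_div] at k3; linarith
    exact (inv_lt_inv₀ hba z2).1 h1
  linarith


theorem theta_cross {l b q E m0 μ a B : ℝ} (hl : 0 < l) (hE0 : 0 ≤ E) (hE : E < 1 + 3 * l)
    (hμ : 0 < μ) (hb : 2 * μ < b) (hP : Pos l b q E m0) (hm : m0 < μ ^ 2)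
    (ha : 1 < a) (haB : a < B) :
    ∃ Θ : ℝ → ℝ, ∃ r1, a ≤ r1 ∧ r1 ≤ B ∧
      (∀ r ∈ Icc a B, HasDerivAt Θ (cc l b q E (μ ^ 2) r - (Θ r) ^ 2 / pp l E r) r) ∧
      (∀ r ∈ Ico a r1, (Θ r) ^ 2 ≤ μ ^ 2 * r ^ 4) ∧
      (∀ r ∈ Ico r1 B, μ ^ 2 * r ^ 4 ≤ (Θ r) ^ 2) := by
  obtain ⟨a0, ha0, ha0a, hlow⟩ := no_high (q := q) hl hE0 hE hμ (by linarith : 0 < b) ha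
  obtain ⟨Θ, hΘ⟩ := theta_exists hl hE hP hm ha0 (ha0a.trans haB)
  obtain ⟨a1, ha1, hΘ1⟩ := hlow Θ (fun r hr => hΘ r ⟨hr.1, hr.2.trans haB.le⟩)
  have hsqd : ∀ k x : ℝ, HasDerivAt (fun r => k * r ^ 2) (k * (2 * x)) x := by
    intro k x
    have := ((hasDerivAt_id x).pow 2).const_mul k
    refine this.congr_deriv ?_
    simp
  -- upper barrier
  have hup : ∀ r ∈ Icc a1 B, Θ r ≤ μ * r ^ 2 := by
    refine fun r hr => image_le_of_deriv_right_lt_deriv_boundary' (f := Θ) (a := a1) (b := B)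
      (f' := fun r => cc l b q E (μ ^ 2) r - (Θ r) ^ 2 / pp l E r)
      (B := fun x => μ * x ^ 2) (B' := fun x => μ * (2 * x)) ?_ ?_ ?_ ?_ ?_ ?_ hr
    · exact fun r hr => (hΘ r ⟨by linarith [hr.1, ha1.1], hr.2⟩).continuousAt.continuousWithinAt
    · exact fun r hr => (hΘ r ⟨by linarith [hr.1, ha1.1], hr.2.le⟩).hasDerivWithinAt
    · exact hΘ1
    · fun_prop
    · exact fun r hr => (hsqd μ r).hasDerivWithinAt
    · intro r hr he
      have hr1 : 1 < r := by linarith [hr.1, ha1.1]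
      have h1 := cc_le (q := q) (b := b) (m := μ ^ 2) hl hE0 hE hr1
      have e : (Θ r) ^ 2 / pp l E r = μ ^ 2 * r ^ 4 / pp l E r := by rw [he]; ring
      rw [e]
      have h2 : 0 < b * r ^ 2 := mul_pos (by linarith) (by positivity)
      have h3 : 0 < μ * (2 * r) := by positivity
      linarith
  -- lower barrier
  have hdn : ∀ r1 ∈ Icc a B, Θ r1 ≤ (-μ) * r1 ^ 2 → ∀ r ∈ Icc r1 B, Θ r ≤ (-μ) * r ^ 2 := by
    intro r1 hr1 h0
    refine fun r hr => image_le_of_deriv_right_lt_deriv_boundary' (f := Θ) (a := r1) (b := B)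
      (f' := fun r => cc l b q E (μ ^ 2) r - (Θ r) ^ 2 / pp l E r)
      (B := fun x => (-μ) * x ^ 2) (B' := fun x => (-μ) * (2 * x)) ?_ ?_ ?_ ?_ ?_ ?_ hr
    · exact fun r hr => (hΘ r ⟨by linarith [hr.1, hr1.1], hr.2⟩).continuousAt.continuousWithinAt
    · exact fun r hr => (hΘ r ⟨by linarith [hr.1, hr1.1], hr.2.le⟩).hasDerivWithinAt
    · exact h0
    · fun_prop
    · exact fun r hr => (hsqd (-μ) r).hasDerivWithinAt
    · intro r hr he
      have hr1 : 1 < r := by linarith [hr.1, hr1.1]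
      have h1 := cc_le (q := q) (b := b) (m := μ ^ 2) hl hE0 hE hr1
      have e : (Θ r) ^ 2 / pp l E r = μ ^ 2 * r ^ 4 / pp l E r := by rw [he]; ring
      rw [e]
      have h2 : 2 * μ * r ≤ 2 * μ * r ^ 2 := by
        apply mul_le_mul_of_nonneg_left _ (by positivity)
        nlinarith
      have h3 : 2 * μ * r ^ 2 < b * r ^ 2 := mul_lt_mul_of_pos_right hb (by positivity)
      linarith
  have habs : ∀ r, 1 < r → -μ * r ^ 2 ≤ Θ r → Θ r ≤ μ * r ^ 2 → (Θ r) ^ 2 ≤ μ ^ 2 * r ^ 4 := by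
    intro r hr h1 h2
    have := sq_le_sq' (by linarith) h2
    calc _ ≤ _ := this
      _ = _ := by ring
  have hD : ∀ r ∈ Icc a B, HasDerivAt Θ (cc l b q E (μ ^ 2) r - (Θ r) ^ 2 / pp l E r) r :=
    fun r hr => hΘ r ⟨by linarith [hr.1], hr.2⟩
  by_cases hex : ∃ r ∈ Icc a B, Θ r ≤ -μ * r ^ 2
  · obtain ⟨rx, hrx, hrx2⟩ := hex
    have hc : ContinuousOn (fun r => Θ r - -μ * r ^ 2) (Icc a B) := by
      have : ContinuousOn Θ (Icc a B) := fun r hr => (hD r hr).continuousAt.continuousWithinAt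
      fun_prop
    have hcl := hc.preimage_isClosed_of_isClosed isClosed_Icc (isClosed_Iic (a := (0:ℝ)))
    have hcp := isCompact_Icc.of_isClosed_subset hcl inter_subset_left
    obtain ⟨r1, ⟨h1, h2⟩, hmin⟩ := hcp.exists_isLeast ⟨rx, hrx, by
      simp only [mem_preimage, mem_Iic]; linarith⟩
    simp only [mem_preimage, mem_Iic] at h2
    refine ⟨Θ, r1, h1.1, h1.2, hD, ?_, ?_⟩
    · intro r hr
      have hr' : r ∈ Icc a B := ⟨hr.1, hr.2.le.trans h1.2⟩
      apply habs r (by linarith [hr.1]) _ (hup r ⟨by linarith [hr.1, ha1.2], hr'.2⟩)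
      by_contra hh
      push Not at hh
      have := hmin ⟨hr', by simp only [mem_preimage, mem_Iic]; linarith⟩
      linarith [hr.2]
    · intro r hr
      have := hdn r1 h1 (by linarith) r ⟨hr.1, hr.2.le⟩
      have h3 : 0 ≤ μ * r ^ 2 := by positivity
      have := pow_le_pow_left₀ h3 (show μ * r ^ 2 ≤ -Θ r by linarith) 2
      calc _ = (μ * r ^ 2) ^ 2 := by ring
        _ ≤ _ := this
        _ = _ := by ring
  · push Not at hex
    refine ⟨Θ, B, haB.le, le_rfl, hD, ?_, ?_⟩
    · intro r hr
      exact habs r (by linarith [hr.1]) (hex r ⟨hr.1, hr.2.le⟩).le (hup r ⟨by linarith [hr.1, ha1.2], hr.2.le⟩)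
    · intro r hr
      exact absurd hr.1 (not_le.2 hr.2)


theorem g_ineq {l E1 E2 κ r : ℝ} (hl : 0 < l) (hE2 : 0 ≤ E2) (hκ : 1 ≤ κ)
    (hκE : κ ^ 2 * E2 ≤ E1) (hE1 : E1 < 1 + 3 * l) (hr : 1 < r) :
    E2 * (r - 1) / nn l E2 r ≤ E1 * (κ * r - 1) / nn l E1 (κ * r) := by
  have hκ2 : 1 ≤ κ ^ 2 := one_le_pow₀ hκ
  have hE21 : E2 ≤ κ ^ 2 * E2 := by nlinarith
  have hR : 1 < κ * r := by nlinarith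
  have n1 := nn_pos hl hE1 hR
  have n2 := nn_pos hl (show E2 < 1 + 3 * l by linarith) hr
  rw [div_le_div_iff₀ n2 n1]
  have br : 0 ≤ (κ * r - 1) * nn l E2 r + E2 * (r - 1) := by
    have h1 := mul_nonneg (sub_nonneg.2 hR.le) n2.le
    have h2 := mul_nonneg hE2 (sub_nonneg.2 hr.le)
    linarith
  have k1 := mul_le_mul_of_nonneg_right hκE br
  have k2 : κ ^ 2 * ((κ * r - 1) * nn l E2 r + E2 * (r - 1)) - (r - 1) * (nn l E1 (κ * r) + E1)
     = (κ - 1) * r * (κ ^ 2 * (2 * l * r ^ 2 + (l + 1) * r - E2) + (r - 1) * (l + 1) * κ) := by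
    unfold nn; ring
  have k3 : 0 ≤ (κ - 1) * r * (κ ^ 2 * (2 * l * r ^ 2 + (l + 1) * r - E2) + (r - 1) * (l + 1) * κ) := by
    have e1 : 0 ≤ κ - 1 := by linarith
    have e2 : 0 ≤ r - 1 := by linarith
    have e3 : 0 ≤ 2 * l * r ^ 2 + (l + 1) * r - E2 := by
      have a1 : 1 ≤ r ^ 2 := one_le_pow₀ hr.le
      have a2 : l * 1 ≤ l * r ^ 2 := mul_le_mul_of_nonneg_left a1 hl.le
      have a3 : (l + 1) * 1 ≤ (l + 1) * r := mul_le_mul_of_nonneg_left hr.le (by linarith)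
      linarith
    have e4 : 0 < r := by linarith
    have e5 : 0 < κ := by linarith
    positivity
  have k4 := mul_nonneg hE2 k3
  rw [← k2] at k4
  linarith

theorem alg_core {m κ r P1 P2 T : ℝ} (hm : 0 ≤ m) (hκ : 1 ≤ κ) (h1 : 0 < P1)
    (h : (T ^ 2 ≤ m * (κ * r) ^ 4 ∧ (κ ^ 4 * P2 - P1 ≤ 0 ∨ (κ ^ 2 * P2 - P1 ≤ 0 ∧ 0 ≤ κ ^ 4 * P2 - P1)))
      ∨ (m * (κ * r) ^ 4 ≤ T ^ 2 ∧ 0 ≤ κ ^ 4 * P2 - P1)) :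
    m * r ^ 4 * κ ^ 6 * (κ ^ 2 * P2 - P1) ≤ T ^ 2 * (κ ^ 4 * P2 - P1) := by
  have hκ2 : 0 ≤ κ ^ 2 - 1 := by linarith [one_le_pow₀ hκ (n := 2)]
  have key : m * r ^ 4 * κ ^ 6 * (κ ^ 2 * P2 - P1) ≤ m * (κ * r) ^ 4 * (κ ^ 4 * P2 - P1) := by
    have : 0 ≤ m * (κ * r) ^ 4 * ((κ ^ 2 - 1) * P1) := by
      have := pow_nonneg (sq_nonneg (κ * r)) 2
      rw [← pow_mul] at this
      positivity
    nlinarith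
  have hmr : 0 ≤ m * r ^ 4 * κ ^ 6 := by
    have : 0 < κ := by linarith
    positivity
  rcases h with ⟨hT, h2 | ⟨h2, h3⟩⟩ | ⟨hT, h2⟩
  · exact key.trans (mul_le_mul_of_nonpos_right hT h2)
  · exact (mul_nonpos_of_nonneg_of_nonpos hmr h2).trans (mul_nonneg (sq_nonneg _) h3)
  · exact key.trans (mul_le_mul_of_nonneg_right hT h2)

theorem jac_pt {l b q E1 E2 m κ r T : ℝ} (hl : 0 < l) (hE2 : 0 ≤ E2) (hκ : 1 ≤ κ)
    (hκE : κ ^ 2 * E2 ≤ E1) (hE1 : E1 < 1 + 3 * l) (hr : 1 < r)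
    (h : m * r ^ 4 * κ ^ 6 * (κ ^ 2 * pp l E2 r - pp l E1 (κ * r))
      ≤ T ^ 2 * (κ ^ 4 * pp l E2 r - pp l E1 (κ * r))) :
    0 ≤ cc l b q E2 m r - (cc l b q E1 m (κ * r) - T ^ 2 / pp l E1 (κ * r)) / κ ^ 2
      - (-(T / κ ^ 3)) ^ 2 / pp l E2 r := by
  have hg := g_ineq hl hE2 hκ hκE hE1 hr
  have hκ2 : 1 ≤ κ ^ 2 := one_le_pow₀ hκ
  have hE21 : E2 ≤ κ ^ 2 * E2 := by nlinarith
  have hR : 1 < κ * r := by nlinarith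
  have p1 := pp_pos hl hE1 hR
  have p2 := pp_pos hl (show E2 < 1 + 3 * l by linarith) hr
  have hκ0 : 0 < κ := by linarith
  have e : cc l b q E2 m r - (cc l b q E1 m (κ * r) - T ^ 2 / pp l E1 (κ * r)) / κ ^ 2
      - (-(T / κ ^ 3)) ^ 2 / pp l E2 r =
      q ^ 2 * r ^ 2 * (E1 * (κ * r - 1) / nn l E1 (κ * r) - E2 * (r - 1) / nn l E2 r)
      + (T ^ 2 * (κ ^ 4 * pp l E2 r - pp l E1 (κ * r))
        - m * r ^ 4 * κ ^ 6 * (κ ^ 2 * pp l E2 r - pp l E1 (κ * r)))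
        / (κ ^ 6 * pp l E1 (κ * r) * pp l E2 r) := by
    unfold cc
    have a1 : q ^ 2 * E2 * (r - 1) / nn l E2 r = q ^ 2 * (E2 * (r - 1) / nn l E2 r) := by ring
    have a2 : q ^ 2 * E1 * (κ * r - 1) / nn l E1 (κ * r)
      = q ^ 2 * (E1 * (κ * r - 1) / nn l E1 (κ * r)) := by ring
    rw [a1, a2]
    generalize E2 * (r - 1) / nn l E2 r = x
    generalize E1 * (κ * r - 1) / nn l E1 (κ * r) = y
    generalize pp l E1 (κ * r) = P1 at p1
    generalize pp l E2 r = P2 at p2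
    field_simp
    ring
  rw [e]
  apply add_nonneg
  · exact mul_nonneg (by positivity) (by linarith)
  · exact div_nonneg (by linarith) (by positivity)

theorem quad_conv_le {x y w s r : ℝ} (hx : 0 ≤ x) (hs : 1 < s) (h1 : x + y + w ≤ 0)
    (h2 : x * s ^ 2 + y * s + w ≤ 0) (hr : 1 ≤ r) (hrs : r ≤ s) : x * r ^ 2 + y * r + w ≤ 0 := by
  have a1 := mul_nonneg (sub_nonneg.2 hrs) (neg_nonneg.2 h1)
  have a2 := mul_nonneg (sub_nonneg.2 hr) (neg_nonneg.2 h2)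
  have a3 := mul_nonneg hx (mul_nonneg (mul_nonneg (sub_nonneg.2 hs.le) (sub_nonneg.2 hr)) (sub_nonneg.2 hrs))
  have : (s - 1) * (x * r ^ 2 + y * r + w) ≤ 0 := by linarith
  exact nonpos_of_mul_nonpos_right this (by linarith)

theorem quad_conv_ge {x y w s r : ℝ} (hx : 0 ≤ x) (hs : 1 < s) (h1 : x + y + w ≤ 0)
    (h2 : 0 ≤ x * s ^ 2 + y * s + w) (hrs : s ≤ r) : 0 ≤ x * r ^ 2 + y * r + w := by
  have hr : 1 ≤ r := by linarith
  have a1 := mul_nonneg (sub_nonneg.2 hrs) (neg_nonneg.2 h1)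
  have a2 := mul_nonneg (sub_nonneg.2 hr) h2
  have a3 := mul_nonneg hx (mul_nonneg (mul_nonneg (sub_nonneg.2 hs.le) (sub_nonneg.2 hr)) (sub_nonneg.2 hrs))
  have : 0 ≤ (s - 1) * (x * r ^ 2 + y * r + w) := by linarith
  exact nonneg_of_mul_nonneg_right this (by linarith)

theorem Aa_eq (l E1 E2 κ r : ℝ) : κ ^ 4 * pp l E2 r - pp l E1 (κ * r) =
    (κ ^ 2 * (κ ^ 2 - 1)) * r ^ 2 + ((1 + l + E1) * κ - κ ^ 4 * (1 + l + E2)) * r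
      + (κ ^ 4 * E2 - E1) := by
  unfold pp nn; ring

theorem kappa_exists {l E1 E2 r1 : ℝ} (hl : 0 < l) (hE2 : 0 < E2) (hE21 : E2 < E1)
    (hE1 : E1 < 1 + 3 * l) (hr1 : 1 < r1) :
    ∃ κ, 1 ≤ κ ∧ κ ^ 2 * E2 ≤ E1 ∧
      (∀ r, 1 < r → κ * r < r1 → (κ ^ 4 * pp l E2 r - pp l E1 (κ * r) ≤ 0 ∨
        (κ ^ 2 * pp l E2 r - pp l E1 (κ * r) ≤ 0 ∧ 0 ≤ κ ^ 4 * pp l E2 r - pp l E1 (κ * r)))) ∧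
      (∀ r, 1 < r → r1 ≤ κ * r → 0 ≤ κ ^ 4 * pp l E2 r - pp l E1 (κ * r)) := by
  set k := Real.sqrt (E1 / E2) with hk
  have hk2 : k ^ 2 = E1 / E2 := Real.sq_sqrt (div_nonneg (by linarith) hE2.le)
  have hk2' : k ^ 2 * E2 = E1 := by rw [hk2]; field_simp
  have hk1 : 1 ≤ k := by
    rw [hk, Real.one_le_sqrt, one_le_div hE2]; exact hE21.le
  have hA1 : ∀ κ : ℝ, 1 ≤ κ → κ ^ 4 * pp l E2 1 - pp l E1 (κ * 1) ≤ 0 := by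
    intro κ hκ
    have : 0 ≤ pp l E1 κ := by
      rcases eq_or_lt_of_le hκ with e | e
      · rw [← e]; unfold pp; simp
      · exact (pp_pos hl hE1 e).le
    have e : pp l E2 1 = 0 := by unfold pp; simp
    rw [e, mul_one]; linarith
  have hle : ∀ κ r : ℝ, 1 ≤ κ → κ < r1 → κ ^ 4 * pp l E2 (r1 / κ) - pp l E1 r1 ≤ 0 → 1 < r → κ * r < r1 →
      κ ^ 4 * pp l E2 r - pp l E1 (κ * r) ≤ 0 := by
    intro κ r hκ hκr h hr hrr
    have h0 : 0 < κ := by linarith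
    have hA := hA1 κ hκ
    have e : κ * (r1 / κ) = r1 := by field_simp
    have e' := Aa_eq l E1 E2 κ (r1 / κ)
    rw [e] at e'
    rw [e'] at h
    simp only [Aa_eq] at hA ⊢
    refine quad_conv_le (s := r1 / κ) ?_ ?_ (by linarith) h hr.le ?_
    · have : 0 ≤ κ ^ 2 - 1 := by linarith [one_le_pow₀ hκ (n := 2)]
      positivity
    · rw [lt_div_iff₀ h0]; linarith
    · rw [le_div_iff₀ h0]; linarith
  have hge : ∀ κ r : ℝ, 1 ≤ κ → κ < r1 → 0 ≤ κ ^ 4 * pp l E2 (r1 / κ) - pp l E1 r1 → 1 < r → r1 ≤ κ * r →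
      0 ≤ κ ^ 4 * pp l E2 r - pp l E1 (κ * r) := by
    intro κ r hκ hκr h hr hrr
    have h0 : 0 < κ := by linarith
    have hA := hA1 κ hκ
    have e : κ * (r1 / κ) = r1 := by field_simp
    have e' := Aa_eq l E1 E2 κ (r1 / κ)
    rw [e] at e'
    rw [e'] at h
    simp only [Aa_eq] at hA ⊢
    refine quad_conv_ge (s := r1 / κ) ?_ ?_ (by linarith) h ?_
    · have : 0 ≤ κ ^ 2 - 1 := by linarith [one_le_pow₀ hκ (n := 2)]
      positivity
    · rw [lt_div_iff₀ h0]; linarith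
    · rw [div_le_iff₀ h0]; linarith
  by_cases hc : k < r1 ∧ 0 ≤ k ^ 4 * pp l E2 (r1 / k) - pp l E1 r1
  · refine ⟨k, hk1, hk2'.le, ?_, fun r hr hrr => hge k r hk1 hc.1 hc.2 hr hrr⟩
    intro r hr hrr
    rcases le_total (k ^ 4 * pp l E2 r - pp l E1 (k * r)) 0 with h | h
    · exact Or.inl h
    · refine Or.inr ⟨?_, h⟩
      have e : k ^ 2 * pp l E2 r - pp l E1 (k * r) =
        -((k - 1) * r * (l * (k ^ 2 * (k + 1) * r ^ 3) + k * (1 + l) - E1)) := by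
        rw [← hk2']; unfold pp nn; ring
      rw [e]
      have h3 : 1 ≤ r ^ 3 := one_le_pow₀ hr.le
      have h4 : 1 ≤ k ^ 2 := one_le_pow₀ hk1
      have h5 : 2 ≤ k ^ 2 * (k + 1) := by nlinarith
      have h6 : 2 ≤ k ^ 2 * (k + 1) * r ^ 3 := by nlinarith
      have h7 : l * 2 ≤ l * (k ^ 2 * (k + 1) * r ^ 3) := mul_le_mul_of_nonneg_left h6 hl.le
      have h8 : 1 * (1 + l) ≤ k * (1 + l) := mul_le_mul_of_nonneg_right hk1 (by linarith)
      have h9 : 0 ≤ l * (k ^ 2 * (k + 1) * r ^ 3) + k * (1 + l) - E1 := by linarith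
      have h10 : 0 ≤ k - 1 := by linarith
      have : 0 ≤ (k - 1) * r * (l * (k ^ 2 * (k + 1) * r ^ 3) + k * (1 + l) - E1) :=
        mul_nonneg (mul_nonneg h10 (by linarith)) h9
      linarith
  · set G : ℝ → ℝ := fun κ => κ ^ 4 * pp l E2 (r1 / κ) - pp l E1 r1 with hG
    have hp := pp_pos hl hE1 hr1
    have hGr : G r1 < 0 := by
      have e : pp l E2 1 = 0 := by unfold pp; simp
      simp only [hG]
      rw [div_self (by linarith), e]; linarith
    have hG1 : 0 < G 1 := by
      have : G 1 = (E1 - E2) * (r1 - 1) := by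
        simp only [hG]; unfold pp nn; simp; ring
      rw [this]; exact mul_pos (by linarith) (by linarith)
    have hGK : G (min k r1) ≤ 0 := by
      rcases lt_or_ge k r1 with h | h
      · rw [min_eq_left h.le]
        by_contra hh
        exact hc ⟨h, (not_le.1 hh).le⟩
      · rw [min_eq_right h]; exact hGr.le
    have h1K : 1 ≤ min k r1 := le_min hk1 hr1.le
    have hcont : ContinuousOn G (Icc 1 (min k r1)) := by
      have h2 : ∀ x ∈ Icc 1 (min k r1), x ≠ 0 := fun x hx => by linarith [hx.1]
      simp only [hG]
      unfold pp nn
      fun_prop (disch := assumption)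
    obtain ⟨κ, hκ, hκ0⟩ := intermediate_value_Icc' h1K hcont (⟨hGK, hG1.le⟩ : (0:ℝ) ∈ Icc (G (min k r1)) (G 1))
    have hκr : κ < r1 := by
      rcases eq_or_lt_of_le (hκ.2.trans (min_le_right _ _)) with e | e
      · rw [e] at hκ0; linarith
      · exact e
    have hκk : κ ≤ k := hκ.2.trans (min_le_left _ _)
    refine ⟨κ, hκ.1, ?_, fun r hr hrr => Or.inl (hle κ r hκ.1 hκr hκ0.le hr hrr),
      fun r hr hrr => hge κ r hκ.1 hκr hκ0.ge hr hrr⟩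
    rw [← hk2']
    have : 0 ≤ κ := by linarith [hκ.1]
    gcongr


theorem isT_interval {f : ℝ → ℝ} (hf : IsT f) : ∃ a c, 1 < a ∧ a < c ∧ tsupport f ⊆ Icc a c := by
  have hK : IsCompact (tsupport f) := hf.comp
  rcases (tsupport f).eq_empty_or_nonempty with h | h
  · exact ⟨2, 3, by norm_num, by norm_num, by rw [h]; exact empty_subset _⟩
  · obtain ⟨x, hx, hx2⟩ := hK.exists_isLeast h
    obtain ⟨y, hy, hy2⟩ := hK.exists_isGreatest h
    have h1 : 1 < x := hf.supp hx
    have h2 : x ≤ y := hx2 hy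
    exact ⟨x, y + 1, h1, by linarith, fun r hr => ⟨hx2 hr, by linarith [hy2 hr]⟩⟩

theorem caseB {l b q E1 E2 m0 μ : ℝ} (hl : 0 < l) (hE2 : 0 < E2) (hE21 : E2 < E1)
    (hE1 : E1 < 1 + 3 * l) (hμ : 0 < μ) (hb : 2 * μ < b) (hm : m0 < μ ^ 2)
    (hP : Pos l b q E1 m0) : Pos l b q E2 (μ ^ 2) := by
  intro f hf
  obtain ⟨a, c, ha, hac, hs⟩ := isT_interval hf
  set k := Real.sqrt (E1 / E2) with hk
  have hE10 : 0 < E1 := by linarith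
  have hk2 : k ^ 2 = E1 / E2 := Real.sq_sqrt (div_nonneg hE10.le hE2.le)
  have hk2' : k ^ 2 * E2 = E1 := by rw [hk2]; field_simp
  have hk1 : 1 ≤ k := by
    rw [hk, Real.one_le_sqrt, one_le_div hE2]; exact hE21.le
  have hcB : c ≤ k * c := by nlinarith
  obtain ⟨Θ, r1, har, hrB, hD, hbef, haft⟩ := theta_cross (B := k * c + 1) hl hE10.le hE1 hμ hb hP hm
    ha (by linarith)
  obtain ⟨κ, hκ1, hκE, hκb, hκa⟩ := kappa_exists hl hE2 hE21 hE1 (lt_of_lt_of_le ha har)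
  have hκ0 : 0 < κ := by linarith
  have hκk : κ ≤ k := by
    have : κ ^ 2 ≤ k ^ 2 := by
      rw [hk2, le_div_iff₀ hE2]; exact hκE
    exact (sq_le_sq₀ hκ0.le (by linarith)).1 this
  have hmem : ∀ r ∈ Icc a c, κ * r ∈ Icc a (k * c + 1) ∧ κ * r < k * c + 1 ∧ 1 < r ∧ 1 < κ * r := by
    intro r hr
    have h1 : 1 * r ≤ κ * r := mul_le_mul_of_nonneg_right hκ1 (by linarith [hr.1])
    have h2 : κ * r ≤ k * c := mul_le_mul hκk hr.2 (by linarith [hr.1]) (by linarith)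
    exact ⟨⟨by linarith [hr.1], by linarith⟩, by linarith, by linarith [hr.1], by linarith [hr.1]⟩
  have hE2l : E2 < 1 + 3 * l := by linarith
  have hlin : ∀ r : ℝ, HasDerivAt (fun r => κ * r) κ r := by
    intro r
    simpa using (hasDerivAt_id r).const_mul κ
  have hder : ∀ r ∈ Icc a c, HasDerivAt (fun r => -(Θ (κ * r) / κ ^ 3))
      (-((cc l b q E1 (μ ^ 2) (κ * r) - (Θ (κ * r)) ^ 2 / pp l E1 (κ * r)) / κ ^ 2)) r := by
    intro r hr
    have h1 := hD (κ * r) (hmem r hr).1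
    have h2 := ((h1.comp r (hlin r)).div_const (κ ^ 3)).neg
    refine h2.congr_deriv ?_
    field_simp
  have hsub : Icc a c ⊆ Ioi 1 := fun r hr => (hmem r hr).2.2.1
  have hmaps : MapsTo (fun r => κ * r) (Icc a c) (Ioi 1) := fun r hr => (hmem r hr).2.2.2
  have hc1 : ContinuousOn (fun r => cc l b q E1 (μ ^ 2) (κ * r)) (Icc a c) :=
    (cc_cont hl hE1).comp (by fun_prop) hmaps
  have hc2 : ContinuousOn (fun r => Θ (κ * r)) (Icc a c) := by
    have : ContinuousOn Θ (Icc a (k * c + 1)) := fun r hr => (hD r hr).continuousAt.continuousWithinAt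
    exact this.comp (by fun_prop) (fun r hr => (hmem r hr).1)
  have hc3 : ContinuousOn (fun r => pp l E1 (κ * r)) (Icc a c) := by
    have := pp_cont l E1
    fun_prop
  have hc4 : ∀ r ∈ Icc a c, pp l E1 (κ * r) ≠ 0 := fun r hr => (pp_pos hl hE1 (hmaps hr)).ne'
  have hκ2 : κ ^ 2 ≠ 0 := by positivity
  unfold Q QF
  refine quad_nonneg hf.smooth hf.comp hs (c1 := pp l E2) (c2 := fun _ => 0)
    (c3 := cc l b q E2 (μ ^ 2)) (Φ := fun r => -(Θ (κ * r) / κ ^ 3))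
    (Φ' := fun r => -((cc l b q E1 (μ ^ 2) (κ * r) - (Θ (κ * r)) ^ 2 / pp l E1 (κ * r)) / κ ^ 2))
    (pp_cont l E2).continuousOn continuousOn_const ((cc_cont hl hE2l).mono hsub) hder ?_ ?_
  · have : ContinuousOn (fun r => (Θ (κ * r)) ^ 2 / pp l E1 (κ * r)) (Icc a c) :=
      (hc2.pow 2).div hc3 hc4
    exact ((hc1.sub this).div_const _).neg
  · intro r hr x y
    obtain ⟨g1, g2, g3, g4⟩ := hmem r hr
    have core := alg_core (r := r) (T := Θ (κ * r)) (P2 := pp l E2 r) (sq_nonneg μ) hκ1 (pp_pos hl hE1 g4) (by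
      rcases lt_or_ge (κ * r) r1 with h | h
      · exact Or.inl ⟨hbef _ ⟨g1.1, h⟩, hκb r g3 h⟩
      · exact Or.inr ⟨haft _ ⟨h, g2⟩, hκa r g3 h⟩)
    have jac := jac_pt (b := b) (q := q) hl hE2.le hκ1 hκE hE1 g3 core
    have := quad_complete (pp_pos hl hE2l g3) (u := x) (w := y)
      (B := -(Θ (κ * r) / κ ^ 3)) (C := cc l b q E2 (μ ^ 2) r +
        -((cc l b q E1 (μ ^ 2) (κ * r) - (Θ (κ * r)) ^ 2 / pp l E1 (κ * r)) / κ ^ 2))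
      (by rw [← sub_eq_add_neg]; exact jac)
    linarith

theorem F4 : ∀ l b q E1 E2 m0 m : ℝ, 0 < l → 0 ≤ E2 → E2 < E1 → E1 < 1 + 3 * l → 0 ≤ m0 → m0 < m →
    Pos l b q E1 m0 → Pos l b q E2 m := by
  intro l b q E1 E2 m0 m hl hE2 hE21 hE1 hm0 hm hP
  have hm' : 0 ≤ m := by linarith
  have hPm : Pos l b q E1 m := pos_mono hl hE1 hP hm.le
  rcases lt_or_ge (9 * l / 4) b with hb | hb
  · exact absurd hP (F5 l b q E1 m0 hl (by linarith) hE1 hb hm0)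
  rcases le_or_gt b 0 with hb0 | hb0
  · exact caseA_of hl hE2 hE21 hE1 hPm (fun v hv => caseA_neg hl hb0 hm' v hv)
  rcases le_or_gt (b ^ 2 / 4) m with hbm | hbm
  · exact caseA_of hl hE2 hE21 hE1 hPm (fun v hv => caseA_pos hl hb0 (by linarith) hbm v hv)
  have hmp : 0 < m := by linarith
  set μ := Real.sqrt m with hμ
  have hμ0 : 0 < μ := Real.sqrt_pos.2 hmp
  have hμ2 : μ ^ 2 = m := Real.sq_sqrt hm'
  have h2μ : 2 * μ < b := by
    apply lt_of_pow_lt_pow_left₀ 2 hb0.le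
    rw [mul_pow, hμ2]; linarith
  have hB : ∀ E, 0 < E → E < E1 → Pos l b q E m := by
    intro E h0 h1
    have := caseB hl h0 h1 hE1 hμ0 h2μ (by rw [hμ2]; exact hm) hP
    rwa [hμ2] at this
  rcases eq_or_lt_of_le hE2 with e | e
  · rw [← e]
    exact pos_zero_of hl (by linarith) hE1 hB
  · exact hB E2 e hE21

/-- `M ↦ λ_M` is monotone locally Lipschitz on `[M_{e=0}, M₀)`; hence if `λ` is
negative somewhere and positive somewhere in this range, it has a zero `M_c`. -/
theorem lam_lipschitz_and_zero_crossing (rp Λ α q0 : ℝ) (hrp : 0 < rp) (hΛ : Λ < 0)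
    (Me0 M0 : ℝ) (hMe0 : Me0 = rp / 2 * (1 + (-Λ / 3) * rp ^ 2))
    (hM0 : M0 = rp * (1 + 2 * (-Λ / 3) * rp ^ 2)) :
    (∃ C : ℝ, ∀ M1 M2 : ℝ, Me0 ≤ M2 → M2 ≤ M1 → M1 < M0 →
      0 ≤ lamfun rp Λ α q0 M1 - lamfun rp Λ α q0 M2 ∧
      lamfun rp Λ α q0 M1 - lamfun rp Λ α q0 M2 ≤ C * (M1 - M2)) ∧
    (∀ Ma Mb : ℝ, Me0 ≤ Ma → Ma < M0 → Me0 ≤ Mb → Mb < M0 →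
      lamfun rp Λ α q0 Ma < 0 → 0 < lamfun rp Λ α q0 Mb →
      ∃ Mc : ℝ, Me0 ≤ Mc ∧ Mc < M0 ∧ lamfun rp Λ α q0 Mc = 0) := by
  exact assembly rp Λ α q0 hrp hΛ F2 F3 F4 Me0 M0 hMe0 hM0
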